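/- Let Φ : (0,∞) → ℝ be C^∞ with Φ'(s) > 0 for all s > 0, and assume lim_{s→∞} Φ(s) exists and is finite. Let a < b and let u₀ : [a,b] → ℝ be an increasing differentiable function with u₀(a) = 0, u₀(b) = 1 and u₀'(x) ≥ c > 0 for all x. Then there exist T ∈ (0,∞], continuous curves l, r : [0,T) → ℝ, and a continuous function u on the closure of Ω = {(x,t) : 0 < t < T, l(t) < x < r(t)}, such that (u,l,r) is a Type II solution with initial data u₀, u is smooth and strictly monotone in x inside Ω, and moreover ∂ₓu(x,t) ≥ c whenever 0 < u(x,t) < 1. The Type II solution with these data is unique. -/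

import Mathlib

open Set Filter Topology
/-- The space-time domain `Ω = {(x,t) : 0 < t < T, l(t) < x < r(t)}` of a Type II
solution (time horizon `T ∈ (0,∞]` is encoded as an extended real number). -/
def typeIIDomain (T : EReal) (l r : ℝ → ℝ) : Set (ℝ × ℝ) :=
  {p : ℝ × ℝ | 0 < p.2 ∧ (p.2 : EReal) < T ∧ l p.2 < p.1 ∧ p.1 < r p.2}
/-- A Type II solution of `u_t = (Φ(u_x))_x` with initial data `u₀ : [a,b] → ℝ`:
continuous interface curves `l, r` on `[0,T)` with `l(0) = a`, `r(0) = b`,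
`l(t) < r(t)`, a function `u` continuous on the closure of
`Ω = {(x,t) : 0 < t < T, l(t) < x < r(t)}` and smooth in `Ω`, solving the equation
in `Ω`, taking the initial data on `[a,b]`, the boundary values `u = 0` on `x = l(t)`
and `u = 1` on `x = r(t)`, with `∂ₓu → +∞` at both lateral boundaries. -/
structure IsTypeIISolution (Φ : ℝ → ℝ) (T : EReal) (a b : ℝ) (u₀ : ℝ → ℝ)
    (u : ℝ → ℝ → ℝ) (l r : ℝ → ℝ) : Prop where
  T_pos : 0 < T
  l_init : l 0 = a
  r_init : r 0 = b
  l_lt_r : ∀ t : ℝ, 0 < t → (t : EReal) < T → l t < r t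
  l_cont : ContinuousOn l {t : ℝ | 0 ≤ t ∧ (t : EReal) < T}
  r_cont : ContinuousOn r {t : ℝ | 0 ≤ t ∧ (t : EReal) < T}
  u_cont : ContinuousOn (fun p : ℝ × ℝ => u p.1 p.2) (closure (typeIIDomain T l r))
  u_smooth : ContDiffOn ℝ (⊤ : ℕ∞) (fun p : ℝ × ℝ => u p.1 p.2) (typeIIDomain T l r)
  pde : ∀ x t : ℝ, (x, t) ∈ typeIIDomain T l r →
    deriv (fun s => u x s) t = deriv (fun y => Φ (deriv (fun z => u z t) y)) x
  init : ∀ x : ℝ, a ≤ x → x ≤ b → u x 0 = u₀ x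
  bdry_left : ∀ t : ℝ, 0 < t → (t : EReal) < T → u (l t) t = 0
  bdry_right : ∀ t : ℝ, 0 < t → (t : EReal) < T → u (r t) t = 1
  grad_left : ∀ t : ℝ, 0 < t → (t : EReal) < T →
    Tendsto (fun x => deriv (fun z => u z t) x) (nhdsWithin (l t) (Ioi (l t))) atTop
  grad_right : ∀ t : ℝ, 0 < t → (t : EReal) < T →
    Tendsto (fun x => deriv (fun z => u z t) x) (nhdsWithin (r t) (Iio (r t))) atTop
notation "Si" => by simp
notation "Fu" => by fun_prop
notation "Rg" => by ring
notation "Lx" x:max => by linarith [x]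
notation "Ly" x:max y:max => by linarith [x, y]
notation "Ec" x:max => by exact_mod_cast x
notation "Sx" x:max => by simpa using x
notation "Tt" => (⊤ : ℕ∞)
notation "Sl" => IsTypeIISolution
notation:max n:max "~~" => n + 2
notation "Oo" => (0:ℝ)
notation "Re" => ℝ
notation "Rp" => ℝ × ℝ
notation "Fn" => ℝ → ℝ
notation "I" => Icc (0:ℝ) 1
notation "Io" => Ioo (0:ℝ) 1
notation "Jc" => Icc (0:ℝ) 2
notation "Jo" => Ioo (0:ℝ) 2
notation:max n:max "~" => n + 1
notation:max n:max "&" => (n : ℝ)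
notation "Om" => by omega
notation "Po" => by positivity
notation "Nn" => by norm_num
notation "Li" => by linarith
notation "Fr" => Finset.range
notation "Dv" => HasDerivAt
notation "Co" => ContinuousOn
alias Aa := mul_le_mul_of_nonneg_left
alias Ae := mul_le_mul_of_nonneg_right
alias Ai := Ioo_subset_Icc_self
alias Ao := eventually_ge_atTop
alias Au := EReal.coe_lt_coe_iff
alias Ad := le_rfl
alias Af := hasDerivAt_id
alias Ag := abs_of_pos
alias Ak := abs_of_nonneg
alias Al := min_le_right
alias Am := min_le_left
alias An := Finset.mul_sum
alias Ap := le_div_iff₀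
alias Ar := abs_le
alias As := Finset.sum_le_sum
alias Ba := Finset.mem_range
alias Be := sq_nonneg
alias Bi := self_mem_nhdsWithin
alias Bo := zero_le_one
alias Bu := mul_nonneg
alias Bb := Real.dist_eq
alias Bd := Real.norm_eq_abs
alias Bf := Icc_subset_Icc_right
alias Bg := Finset.sum_add_distrib
alias Bk := Ioo_mem_nhds
alias Bl := Finset.sum_nonneg
alias Bm := pow_le_pow_left₀
alias Bn := lt_of_le_of_ne
alias Bp := le_of_tendsto_of_tendsto
alias Br := abs_sub_comm
alias Bs := Ioo_subset_Ioc_self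
alias Bt := tendsto_nhdsWithin_iff
alias Ca := le_of_mul_le_mul_left
alias Ce := gt_mem_nhds
alias Ci := div_le_iff₀
alias Cu := Nat.exists_eq_add_of_le
alias Cb := Nat.lt_or_ge
alias Cd := left_mem_Icc
alias Cf := le_abs_self
alias Cg := max_eq_right
alias Ck := div_le_one
alias Cl := div_le_div_of_nonneg_right
alias Cm := Ioi_mem_nhds
alias Cn := isOpen_Ioo
alias Cp := Metric.ball_mem_nhds
alias Cr := Ioo_subset_Ico_self
alias Cs := Finset.sum_range_succ
alias Ct := one_div_pos
alias Da := nhdsWithin_le_nhds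
alias De := hasDerivAt_const
alias Di := differentiableAt_of_deriv_ne_zero
alias Du := Finset.sum_congr
alias Db := one_div_mul_eq_div
alias Dd := mul_le_mul
alias Dk := hasDerivAt_iff_isLittleO
alias Dl := ge_of_tendsto
alias Dm := div_mul_eq_mul_div
alias Dn := Nat.eq_zero_or_pos
alias Dp := Nat.cast_sub
alias Dr := pow_le_one₀
alias Dt := norm_iteratedFDeriv_eq_norm_iteratedDeriv
alias Ea := left_mem_uIcc
alias Ee := add_sub_cancel_left
alias Ei := abs_sub_left_of_mem_uIcc
alias Eo := Ioi_subset_Ici_self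
alias Eu := HasDerivAt.fun_sum
alias Eb := lt_min
alias Ef := right_mem_Icc
alias Eg := mul_le_of_le_one_left
alias Ek := le_of_forall_pos_le_add
alias El := half_lt_self
alias Em := Finset.sum_range_succ'
alias Ep := Eventually.of_forall
alias Er := le_total
alias Es := lt_div_iff₀
alias Et := mem_nhdsLT_iff_exists_mem_Ico_Ioo_subset
alias Fa := max_eq_left
alias Fe := HasDerivAt.const_mul
alias Fi := Asymptotics.isLittleO_iff
structure PsiData (Ps : Fn) : Prop where
  zero : Ps 0 = 0
  mono : StrictMonoOn Ps (Ici 0)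
  cont : Co Ps (Ici 0)
  smooth : ContDiffOn Re Tt Ps (Ioi 0)
  dpos : ∀ v, 0 < v → 0 < deriv Ps v
theorem barrier_le {f f' : Fn} {T M : Re} (hf : Co f (Icc 0 T))
    (hf' : ∀ t ∈ Ioo 0 T, Dv f (f' t) t) (h0 : f 0 ≤ M)
    (hd : ∀ t ∈ Ioo 0 T, M < f t → f' t ≤ 0) : ∀ t ∈ Icc 0 T, f t ≤ M := by
  intro t ht
  by_contra hlt
  push Not at hlt
  set A := {s | s ∈ Icc 0 t ∧ f s ≤ M} with hA
  have hne : A.Nonempty := ⟨0, ⟨Ad, ht.1⟩, h0⟩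
  have hcl : IsClosed A :=
    (hf.mono (Bf ht.2)).preimage_isClosed_of_isClosed isClosed_Icc isClosed_Iic
  have hbd : BddAbove A := ⟨t, fun s hs => hs.1.2⟩
  have hs := hcl.csSup_mem hne hbd
  set s := sSup A
  have hst : s ≤ t := hs.1.2
  have hanti : AntitoneOn f (Icc s t) := by
    refine antitoneOn_of_deriv_nonpos (convex_Icc s t)
      (hf.mono (Icc_subset_Icc hs.1.1 ht.2)) ?_ ?_
    · intro x hx
      rw [interior_Icc] at hx
      exact (hf' x ⟨hs.1.1.trans_lt hx.1, hx.2.trans_le ht.2⟩).differentiableAt.differentiableWithinAt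
    · intro x hx
      rw [interior_Icc] at hx
      have hx' : x ∈ Ioo 0 T := ⟨hs.1.1.trans_lt hx.1, hx.2.trans_le ht.2⟩
      rw [(hf' x hx').deriv]
      apply hd x hx'
      by_contra hle
      push Not at hle
      exact absurd (le_csSup hbd (show x ∈ A from ⟨⟨hx'.1.le, hx.2.le⟩, hle⟩)) (not_le.2 hx.1)
  exact absurd (hanti ⟨Ad, hst⟩ ⟨hst, Ad⟩ hst) (not_le.2 (hs.2.trans_lt hlt))
theorem PsiData.lip {Ps : Fn} (ab : PsiData Ps) {ac M : Re} (af : 0 < ac) :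
    ∃ C : NNReal, LipschitzOnWith C Ps (Icc ac M) := by
  have h1 : ContDiffOn Re 1 Ps (Icc ac M) :=
    (ab.smooth.of_le (by norm_cast)).mono fun x hx => af.trans_le hx.1
  exact h1.exists_lipschitzOnWith one_ne_zero (convex_Icc _ _) isCompact_Icc
structure DSol (Ps : Fn) (n : ℕ) (K ac M b0 b1 : Re) (s : ℕ → Re) (S v : ℕ → Fn) : Prop where
  cS : ∀ i ≤ n, Co (S i) (Icc 0 2)
  cv : ∀ i ≤ n, Co (v i) (Icc 0 2)
  S0 : ∀ i ≤ n, S i 0 = s i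
  mem : ∀ i ≤ n, ∀ t ∈ Jc, v i t ∈ Icc ac M
  vS : ∀ i, i + 1 < n → ∀ t, v i~ t = K * (S i~~ t - 2 * S i~ t + S i t)
  vl : ∀ t, v 0 t = b0
  vr : ∀ t, v n t = b1
  dS : ∀ i ≤ n, ∀ t ∈ Jo, Dv (S i) (Ps (v i t)) t
theorem ode_exists {m : ℕ} (f : (Fin m → Re) → (Fin m → Re)) (x0 : Fin m → Re) {C L : NNReal}
    (hl : LipschitzWith C f) (hb : ∀ x, ‖f x‖ ≤ L) :
    ∃ α : Re → (Fin m → Re), α 0 = x0 ∧ Co α (Icc 0 2) ∧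
      ∀ t ∈ Jo, Dv α (f (α t)) t := by
  have h := IsPicardLindelof.of_time_independent (f := f) (tmin := 0) (tmax := 2)
    (t₀ := ⟨0, Nn, Nn⟩) (x₀ := x0) (a := L * 2) (r := 0) (L := L) (K := C)
    (fun x _ => hb x) hl.lipschitzOnWith Si
  obtain ⟨α, h0, h1⟩ := h.exists_eq_forall_mem_Icc_hasDerivWithinAt₀
  refine ⟨α, h0, fun t ht => (h1 t ht).continuousWithinAt, fun t ht => ?_⟩
  exact (h1 t ⟨ht.1.le, ht.2.le⟩).hasDerivAt (Icc_mem_nhds ht.1 ht.2)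
theorem exists_DSol {Ps : Fn} (ab : PsiData Ps) (n : ℕ) {K ac M b0 b1 : Re} (s : ℕ → Re)
    (hn : 0 < n) (hK : 0 < K) (af : 0 < ac) (hM : ac ≤ M) (h0 : b0 ∈ Icc ac M) (h1 : b1 ∈ Icc ac M)
    (hs : ∀ i, i + 1 < n → K * (s i~~ - 2 * s i~ + s i) ∈ Icc ac M) :
    ∃ S v : ℕ → Fn, DSol Ps n K ac M b0 b1 s S v := by
  obtain ⟨C, hC⟩ := ab.lip (M := M) af
  set cl : Fn := fun x => (projIcc ac M hM x : Re) with hcl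
  have clmem : ∀ x, cl x ∈ Icc ac M := fun x => (projIcc ac M hM x).2
  have clid : ∀ x ∈ Icc ac M, cl x = x := fun x hx => by simp [hcl, projIcc_of_mem hM hx]
  have hlc : LipschitzWith C (fun x => Ps (cl x)) := by
    have h2 : LipschitzWith 1 cl := (LipschitzWith.projIcc hM)
    have := hC.comp (h2.lipschitzOnWith (s := univ)) (fun x _ => clmem x)
    rw [mul_one, lipschitzOnWith_univ] at this
    exact this
  have hzb : ∀ x, Ps (cl x) ∈ Icc (Ps ac) (Ps M) := fun x =>
    ⟨ab.mono.monotoneOn af.le (af.le.trans (clmem x).1) (clmem x).1,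
      ab.mono.monotoneOn (af.le.trans (clmem x).1) (af.le.trans hM) (clmem x).2⟩
  have ds : 0 < Ps ac := by
    have := ab.mono (show Oo ∈ Ici 0 from self_mem_Ici) (show ac ∈ Ici 0 from af.le) af
    rwa [ab.zero] at this
  set ex : (Fin n~ → Re) → ℕ → Re := fun x k => if h : k < n + 1 then x ⟨k, h⟩ else 0 with hex
  have exl : ∀ x y k, |ex x k - ex y k| ≤ dist x y := by
    intro x y k
    simp only [hex]
    split_ifs with h
    · rw [← Bb]; exact dist_le_pi_dist x y _
    · simp
  set bo : (Fin n~ → Re) → ℕ → Re := fun x i => if i = 0 then b0 else if i = n then b1 else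
    K * (ex x i~ - 2 * ex x i + ex x (i - 1)) with bs
  have cj : ∀ x y k, |bo x k - bo y k| ≤ 4 * K * dist x y := by
    intro x y k
    have hd : 0 ≤ 4 * K * dist x y := Po
    simp only [bs]
    split_ifs
    · simpa using hd
    · simpa using hd
    · have e1 := Ar.1 (exl x y k~)
      have e2 := Ar.1 (exl x y k)
      have e3 := Ar.1 (exl x y (k-1))
      rw [← mul_sub, abs_mul, Ag hK]
      rw [show 4 * K * dist x y = K * (4 * dist x y) by ring]
      apply Aa _ hK.le
      rw [Ar]; constructor <;> linarith [e1.1,e1.2,e2.1,e2.2,e3.1,e3.2]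
  obtain ⟨α, hα0, hαc, hαd⟩ := ode_exists (m := n+1) (fun x i => Ps (cl (bo x i)))
    (fun i => s i) (C := C * (4 * ⟨K, hK.le⟩)) (L := Real.toNNReal (Ps M))
    (by
      apply LipschitzWith.of_dist_le_mul
      intro x y
      rw [dist_pi_le_iff Po]
      intro i
      refine (hlc.dist_le_mul _ _).trans ?_
      have := cj x y i
      rw [Bb]
      push_cast
      rw [mul_assoc]
      gcongr
      exact this)
    (by
      intro x
      have hM0 : 0 ≤ Ps M := by have := (hzb 0).1.trans (hzb 0).2; linarith
      rw [Real.coe_toNNReal _ hM0, pi_norm_le_iff_of_nonneg hM0]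
      intro i
      rw [Bd, Ak (by linarith [(hzb (bo x i)).1])]
      exact (hzb (bo x i)).2)
  set S : ℕ → Fn := fun i t => ex (α t) i with hS
  set v : ℕ → Fn := fun i t => bo (α t) i with hv
  have cS : ∀ i, Co (S i) (Icc 0 2) := by
    intro i
    simp only [hS, hex]
    by_cases h : i < n + 1
    · simp only [h, dite_true]
      exact (continuous_apply _).comp_continuousOn hαc
    · simp only [h, dite_false]; exact continuousOn_const
  have dS : ∀ i ≤ n, ∀ t ∈ Jo, Dv (S i) (Ps (cl (v i t))) t := by
    intro i hi t ht
    have h := hasDerivAt_pi.1 (hαd t ht) ⟨i, Om⟩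
    simp only [hS, hex, show i < n + 1 by omega, dite_true]
    exact h
  have vS : ∀ i, i + 1 < n → ∀ t, v i~ t = K * (S i~~ t - 2 * S i~ t + S i t) := by
    intro i hi t
    simp only [hv, bs, hS]
    rw [if_neg Om, if_neg Om]
    simp
  have vl : ∀ t, v 0 t = b0 := fun t => by simp [hv, bs]
  have vr : ∀ t, v n t = b1 := fun t => by simp [hv, bs, hn.ne']
  have S0 : ∀ i ≤ n, S i 0 = s i := by
    intro i hi
    simp only [hS, hex, show i < n + 1 by omega, dite_true, hα0]
  have vS' : ∀ i, i + 1 < n → v i~ = fun t => K * (S i~~ t - 2 * S i~ t + S i t) :=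
    fun i hi => funext (vS i hi)
  have cv : ∀ i ≤ n, Co (v i) (Icc 0 2) := by
    intro i hi
    rcases i with _ | i
    · rw [show v 0 = fun _ => b0 from funext vl]; exact continuousOn_const
    · rcases (show i + 1 = n ∨ i + 1 < n by omega) with h | h
      · rw [h, show v n = fun _ => b1 from funext vr]; exact continuousOn_const
      · rw [vS' i h]
        exact continuousOn_const.mul (((cS _).sub (continuousOn_const.mul (cS _))).add (cS _))
  have dv : ∀ i, i + 1 < n → ∀ t ∈ Jo, Dv (v i~)
      (K * (Ps (cl (v i~~ t)) - 2 * Ps (cl (v i~ t)) + Ps (cl (v i t)))) t := by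
    intro i hi t ht
    have := (((dS i~~ Om t ht).sub ((dS i~ Om t ht).const_mul 2)).add
      (dS i Om t ht)).const_mul K
    exact this.congr_of_eventuallyEq (Ep (vS i hi))
  have mem : ∀ i ≤ n, ∀ t ∈ Jc, v i t ∈ Icc ac M := by
    intro i hi
    rcases i with _ | i
    · intro t _; rw [vl]; exact h0
    rcases (show i + 1 = n ∨ i + 1 < n by omega) with h | h
    · intro t _; rw [h, vr]; exact h1
    have hi0 : v i~ 0 ∈ Icc ac M := by
      rw [vS i h, S0 _ Om, S0 _ Om, S0 _ Om]; exact hs i h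
    have hA := barrier_le (cv i~ hi) (dv i h) hi0.2 (by
      intro t ht hlt
      have : cl (v i~ t) = M := by simp [hcl, projIcc_of_right_le hM hlt.le]
      rw [this]
      nlinarith [(hzb (v i~~ t)).2, (hzb (v i t)).2])
    have hB := barrier_le (f := fun t => - v i~ t) (M := -ac) (cv i~ hi).neg
      (fun t ht => (dv i h t ht).neg) (neg_le_neg hi0.1) (by
      intro t ht hlt
      have : cl (v i~ t) = ac := by simp [hcl, projIcc_of_le_left hM (neg_lt_neg_iff.1 hlt).le]
      rw [this]
      nlinarith [(hzb (v i~~ t)).1, (hzb (v i t)).1])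
    exact fun t ht => ⟨neg_le_neg_iff.1 (hB t ht), hA t ht⟩
  refine ⟨S, v, fun i _ => cS i, cv, S0, mem, vS, vl, vr, fun i hi t ht => ?_⟩
  have := dS i hi t ht
  rwa [clid _ (mem i hi t ⟨ht.1.le, ht.2.le⟩)] at this
theorem PsiData.monoOn {Ps : Fn} (ab : PsiData Ps) {a b : Re} (ha : 0 ≤ a) (hab : a ≤ b) : Ps a ≤ Ps b :=
  ab.mono.monotoneOn ha (ha.trans hab) hab
theorem PsiData.nonneg {Ps : Fn} (ab : PsiData Ps) {a : Re} (ha : 0 ≤ a) : 0 ≤ Ps a := by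
  have := ab.monoOn Ad ha; rwa [ab.zero] at this
theorem PsiData.pos {Ps : Fn} (ab : PsiData Ps) {a : Re} (ha : 0 < a) : 0 < Ps a := by
  have := ab.mono (show Oo ∈ Ici 0 from self_mem_Ici) (show a ∈ Ici 0 from ha.le) ha
  rwa [ab.zero] at this
theorem PsiData.hasDerivAt {Ps : Fn} (ab : PsiData Ps) {v : Re} (hv : 0 < v) :
    Dv Ps (deriv Ps v) v :=
  ((ab.smooth.contDiffAt (Cm hv)).differentiableAt Si).hasDerivAt
theorem hasDerivAt_maxsq (x : Re) : Dv (fun y : Re => (max y 0) ^ 2) (2 * max x 0) x := by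
  rcases lt_trichotomy x 0 with h | h | h
  · rw [Cg h.le, mul_zero]
    refine (De x Oo).congr_of_eventuallyEq ?_
    filter_upwards [Iio_mem_nhds h] with y hy
    simp [Cg (le_of_lt (mem_Iio.1 hy))]
  · subst h
    rw [max_self, mul_zero, Dk]
    simp only [max_self, sub_zero, smul_zero, ne_eq, OfNat.ofNat_ne_zero, not_false_eq_true, zero_pow]
    have h1 : (fun y : Re => (max y 0) ^ 2) =O[𝓝 0] fun y : Re => y ^ 2 := by
      apply Asymptotics.IsBigO.of_bound 1
      filter_upwards with y
      rw [one_mul, norm_pow, norm_pow]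
      apply Bm (norm_nonneg _)
      rcases Er y 0 with h | h
      · simp [Cg h]
      · simp [Fa h]
    exact h1.trans_isLittleO (by simpa using Asymptotics.isLittleO_pow_id (𝕜 := Re) (n := 2) Nn)
  · rw [Fa h.le]
    have := (hasDerivAt_pow 2 x)
    simp only [Nat.cast_ofNat, Nat.add_one_sub_one, pow_one] at this
    refine this.congr_of_eventuallyEq ?_
    filter_upwards [Cm h] with y hy
    simp [Fa (le_of_lt (mem_Ioi.1 hy))]
theorem gron_nonpos {f f' : Fn} {T L : Re} (hf : Co f (Icc 0 T))
    (hd : ∀ t ∈ Ioo 0 T, Dv f (f' t) t) (h0 : f 0 ≤ 0)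
    (hL : ∀ t ∈ Ioo 0 T, f' t ≤ L * f t) : ∀ t ∈ Icc 0 T, f t ≤ 0 := by
  intro t ht
  have := barrier_le (f := fun t => Real.exp (-L * t) * f t) (T := T) (M := 0)
    (f' := fun t => Real.exp (-L * t) * (f' t - L * f t))
    ((by fun_prop : Continuous fun t => Real.exp (-L * t)).continuousOn.mul hf)
    (by
      intro t ht
      have h1 : Dv (fun t => Real.exp (-L * t)) (Real.exp (-L * t) * (-L * 1)) t :=
        ((Af t).const_mul (-L)).exp
      have := h1.mul (hd t ht)
      refine this.congr_deriv ?_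
      ring) (Sx h0)
    (by
      intro t ht _
      exact mul_nonpos_of_nonneg_of_nonpos (Real.exp_pos _).le (by linarith [hL t ht])) t ht
  by_contra h
  push Not at h
  exact absurd this (not_le.2 (mul_pos (Real.exp_pos _) h))
theorem comparison {Ps : Fn} (ab : PsiData Ps) (n : ℕ) {K ac M T : Re} (hK : 0 < K) (af : 0 < ac)
    (p q : ℕ → Fn)
    (hp : ∀ i ≤ n, ∀ t ∈ Icc 0 T, p i t ∈ Icc ac M) (hq : ∀ i ≤ n, ∀ t ∈ Icc 0 T, q i t ∈ Icc ac M)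
    (cp : ∀ i ≤ n, Co (p i) (Icc 0 T)) (cq : ∀ i ≤ n, Co (q i) (Icc 0 T))
    (dp : ∀ i, i + 1 < n → ∀ t ∈ Ioo 0 T,
      Dv (p i~) (K * (Ps (p i~~ t) - 2 * Ps (p i~ t) + Ps (p i t))) t)
    (dq : ∀ i, i + 1 < n → ∀ t ∈ Ioo 0 T,
      Dv (q i~) (K * (Ps (q i~~ t) - 2 * Ps (q i~ t) + Ps (q i t))) t)
    (hi : ∀ i ≤ n, p i 0 ≤ q i 0) (hl : ∀ t ∈ Icc 0 T, p 0 t ≤ q 0 t)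
    (hr : ∀ t ∈ Icc 0 T, p n t ≤ q n t) :
    ∀ i ≤ n, ∀ t ∈ Icc 0 T, p i t ≤ q i t := by
  obtain ⟨C, hC⟩ := ab.lip (M := M) af
  set D : ℕ → Fn := fun i t => max (p i t - q i t) 0 with hD
  set m : Fn := fun t => ∑ i ∈ Fr (n - 1), (D i~ t) ^ 2 with hm
  have hCD : ∀ i ≤ n, ∀ t ∈ Icc 0 T, Ps (p i t) - Ps (q i t) ≤ C * D i t := by
    intro i hi t ht
    rcases Er (p i t) (q i t) with h | h
    · have : 0 ≤ C& * D i t := Bu C.2 (le_max_right _ _)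
      linarith [ab.monoOn (af.le.trans (hp i hi t ht).1) h]
    · have := hC.dist_le_mul _ (hp i hi t ht) _ (hq i hi t ht)
      rw [Bb, Bb, Ak (sub_nonneg.2 h)] at this
      simp only [hD, Fa (sub_nonneg.2 h)]
      exact (Cf _).trans this
  have hD0 : ∀ i t, 0 ≤ D i t := fun i t => le_max_right _ _
  have hDm : ∀ i ≤ n, ∀ t ∈ Icc 0 T, D i t ^ 2 ≤ m t := by
    intro i hi t ht
    have hm0 : 0 ≤ m t := Bl fun i _ => Be _
    rcases i with _ | i
    · simp only [hD, Cg (sub_nonpos.2 (hl t ht))]; simpa using hm0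
    rcases (show i + 1 = n ∨ i + 1 < n by omega) with h | h
    · simp only [hD, h, Cg (sub_nonpos.2 (hr t ht))]; simpa using hm0
    · exact Finset.single_le_sum (f := fun i => (D i~ t) ^ 2) (fun i _ => Be _)
        (Ba.2 Om)
  have key := gron_nonpos (f := m) (T := T) (L := (n - 1 : ℕ) * (4 * (K * C)))
    (f' := fun t => ∑ i ∈ Fr (n - 1), 2 * D i~ t *
      (K * (Ps (p i~~ t) - 2 * Ps (p i~ t) + Ps (p i t)) -
        K * (Ps (q i~~ t) - 2 * Ps (q i~ t) + Ps (q i t))))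
    (by
      apply continuousOn_finsetSum
      intro i hi
      rw [Ba] at hi
      exact (((cp i~ Om).sub (cq i~ Om)).sup continuousOn_const).pow 2)
    (by
      intro t ht
      apply Eu
      intro i hi
      rw [Ba] at hi
      exact (hasDerivAt_maxsq _).comp t ((dp i Om t ht).sub (dq i Om t ht)))
    (by
      apply le_of_eq
      apply Finset.sum_eq_zero
      intro i hi'
      rw [Ba] at hi'
      simp [hD, hi i~ Om])
    (by
      intro t ht
      have ht' : t ∈ Icc 0 T := ⟨ht.1.le, ht.2.le⟩
      have : ∀ i ∈ Fr (n - 1), 2 * D i~ t *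
        (K * (Ps (p i~~ t) - 2 * Ps (p i~ t) + Ps (p i t)) -
        K * (Ps (q i~~ t) - 2 * Ps (q i~ t) + Ps (q i t))) ≤ 4 * (K * C) * m t := by
        intro i hi
        rw [Ba] at hi
        have a1 := Aa (hCD i~~ Om t ht') (hD0 i~ t)
        have a2 := Aa (hCD i Om t ht') (hD0 i~ t)
        have a3 : 0 ≤ D i~ t * (Ps (p i~ t) - Ps (q i~ t)) := by
          rcases Er (p i~ t) (q i~ t) with h | h
          · simp [hD, Cg (sub_nonpos.2 h)]
          · exact Bu (hD0 _ _) (sub_nonneg.2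
              (ab.monoOn (af.le.trans (hq i~ Om t ht').1) h))
        have b1 := hDm i~ Om t ht'
        have b2 := hDm i~~ Om t ht'
        have b3 := hDm i Om t ht'
        have c1 : D i~ t * D i~~ t ≤ m t := by nlinarith [Be (D i~ t - D i~~ t)]
        have c2 : D i~ t * D i t ≤ m t := by nlinarith [Be (D i~ t - D i t)]
        have c1' := Aa c1 (Bu hK.le C.2)
        have c2' := Aa c2 (Bu hK.le C.2)
        have d1 := Aa a1 hK.le
        have d2 := Aa a2 hK.le
        have d3 := Bu hK.le a3
        change K * C& * _ ≤ K * C& * _ at c1'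
        change K * C& * _ ≤ K * C& * _ at c2'
        linarith
      refine (As this).trans ?_
      rw [Finset.sum_const, Finset.card_range, nsmul_eq_mul, ← mul_assoc])
  intro i hin t ht
  have h1 := (hDm i hin t ht).trans (key t ht)
  have h2 : D i t = 0 := by nlinarith [hD0 i t]
  have := le_max_left (p i t - q i t) 0
  rw [show max (p i t - q i t) 0 = 0 from h2] at this
  linarith
section
variable {Ps : Fn} {n : ℕ} {K ac M b0 b1 : Re} {s : ℕ → Re} {S v : ℕ → Fn}
theorem DSol.dv (h : DSol Ps n K ac M b0 b1 s S v) : ∀ i, i + 1 < n → ∀ t ∈ Jo,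
    Dv (v i~) (K * (Ps (v i~~ t) - 2 * Ps (v i~ t) + Ps (v i t))) t := by
  intro i hi t ht
  have := (((h.dS i~~ Om t ht).sub ((h.dS i~ Om t ht).const_mul 2)).add
      (h.dS i Om t ht)).const_mul K
  exact this.congr_of_eventuallyEq (Ep (h.vS i hi))
theorem DSol.smooth (h : DSol Ps n K ac M b0 b1 s S v) (ab : PsiData Ps) (af : 0 < ac) :
    ∀ i ≤ n, ContDiffOn Re Tt (v i) (Ioo 0 2) := by
  have key : ∀ k : ℕ, ∀ i ≤ n, ContDiffOn Re k (v i) (Ioo 0 2) := by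
    intro k
    induction k with
    | zero =>
      intro i hi
      exact contDiffOn_zero.2 ((h.cv i hi).mono Ai)
    | succ k ih =>
      intro i hi
      rcases i with _ | i
      · rw [show v 0 = fun _ => b0 from funext h.vl]; exact contDiffOn_const
      rcases (show i + 1 = n ∨ i + 1 < n by omega) with hn | hn
      · rw [hn, show v n = fun _ => b1 from funext h.vr]; exact contDiffOn_const
      have hz : ∀ j ≤ n, ContDiffOn Re k (fun t => Ps (v j t)) (Ioo 0 2) := fun j hj =>
        (ab.smooth.of_le (Ec le_top)).comp (ih j hj)
          fun t ht => af.trans_le (h.mem j hj t ⟨ht.1.le, ht.2.le⟩).1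
      rw [Nat.cast_succ, contDiffOn_succ_iff_deriv_of_isOpen Cn]
      refine ⟨fun t ht => (h.dv i hn t ht).differentiableAt.differentiableWithinAt, Si, ?_⟩
      refine ContDiffOn.congr (f := fun t => K * (Ps (v i~~ t) - 2 * Ps (v i~ t) + Ps (v i t))) ?_
        fun t ht => (h.dv i hn t ht).deriv
      exact contDiffOn_const.mul (((hz _ Om).sub
        (contDiffOn_const.mul (hz _ Om))).add (hz _ Om))
  exact fun i hi => contDiffOn_infty.2 fun k => key k i hi
end
theorem anti_hd {f f' : Fn} {a b : Re} (hf : Co f (Icc a b))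
    (hd : ∀ t ∈ Ioo a b, Dv f (f' t) t) (h : ∀ t ∈ Ioo a b, f' t ≤ 0) :
    AntitoneOn f (Icc a b) := by
  apply antitoneOn_of_deriv_nonpos (convex_Icc _ _) hf
  · intro t ht
    rw [interior_Icc] at ht
    exact (hd t ht).differentiableAt.differentiableWithinAt
  · intro t ht
    rw [interior_Icc] at ht
    rw [(hd t ht).deriv]
    exact h t ht
theorem sbp (f g : ℕ → Re) (m : ℕ) :
    ∑ i ∈ Fr m, f i~ * (g i~~ - 2 * g i~ + g i) =
      f m * (g m~ - g m) - f 0 * (g 1 - g 0)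
        - ∑ i ∈ Fr m, (f i~ - f i) * (g i~ - g i) := by
  induction m with
  | zero => simp
  | succ m ih => rw [Cs, Cs, ih]; ring
theorem sbp0 (f g : ℕ → Re) (m : ℕ) (h0 : f 0 = 0) (hm : f m = 0) :
    ∑ i ∈ Fr m, f i~ * (g i~~ - 2 * g i~ + g i) =
      - ∑ i ∈ Fr m, (f i~ - f i) * (g i~ - g i) := by
  rw [sbp, h0, hm]; ring
theorem cs_telescope (z : ℕ → Re) {i j : ℕ} (hij : i ≤ j) :
    (z j - z i) ^ 2 ≤ (j - i) * ∑ k ∈ Finset.Ico i j, (z k~ - z k) ^ 2 := by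
  have h1 : z j - z i = ∑ k ∈ Finset.Ico i j, (z k~ - z k) := (Finset.sum_Ico_sub z hij).symm
  rw [h1]
  have := sq_sum_le_card_mul_sum_sq (s := Finset.Ico i j) (f := fun k => z k~ - z k)
  rw [Nat.card_Ico, Dp hij] at this
  exact this
section
variable {Ps : Fn} {n : ℕ} {K ac M b0 b1 : Re} {s : ℕ → Re} {S v : ℕ → Fn}
theorem DSol.dz (h : DSol Ps n K ac M b0 b1 s S v) (ab : PsiData Ps) (af : 0 < ac) : ∀ i ≤ n,
    ∀ t ∈ Jo, Dv (fun t => Ps (v i t)) (deriv Ps (v i t) * deriv (v i) t) t := by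
  intro i hi t ht
  have h1 := ((h.smooth ab af i hi).contDiffAt (Bk ht.1 ht.2)).differentiableAt Si
  exact (ab.hasDerivAt (af.trans_le (h.mem i hi t ⟨ht.1.le, ht.2.le⟩).1)).comp t h1.hasDerivAt
theorem DSol.cz (h : DSol Ps n K ac M b0 b1 s S v) (ab : PsiData Ps) (af : 0 < ac) : ∀ i ≤ n,
    Co (fun t => Ps (v i t)) (Icc 0 2) := fun i hi =>
  ab.cont.comp (h.cv i hi) fun t ht => af.le.trans (h.mem i hi t ht).1
noncomputable def en (Ps : Fn) (n : ℕ) (v : ℕ → Fn) (t : Re) : Re :=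
  n * ∑ i ∈ Fr n, (Ps (v i~ t) - Ps (v i t)) ^ 2
theorem DSol.den (h : DSol Ps n (n ^ 2 : Re) ac M b0 b1 s S v) (ab : PsiData Ps) (af : 0 < ac)
    (hn : 0 < n) : ∀ t ∈ Jo, Dv (en Ps n v)
      (-(2 / n) * ∑ i ∈ Fr n, deriv Ps (v i~ t) * deriv (v i~) t ^ 2) t := by
  intro t ht
  have hn' : (n : Re) ≠ 0 := Po
  have h1 : Dv (en Ps n v) (n * ∑ i ∈ Fr n, 2 * (Ps (v i~ t) - Ps (v i t)) *
      (deriv Ps (v i~ t) * deriv (v i~) t - deriv Ps (v i t) * deriv (v i) t)) t := by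
    apply Fe
    apply Eu
    intro i hi
    rw [Ba] at hi
    have := ((h.dz ab af i~ Om t ht).sub (h.dz ab af i Om t ht)).pow 2
    exact this.congr_deriv Si
  refine h1.congr_deriv ?_
  have hv0 : deriv (v 0) t = 0 := by rw [show v 0 = fun _ => b0 from funext h.vl]; simp
  have hvn : deriv (v n) t = 0 := by rw [show v n = fun _ => b1 from funext h.vr]; simp
  have := sbp0 (fun i => deriv Ps (v i t) * deriv (v i) t) (fun i => Ps (v i t)) n
    (by simp [hv0]) (by simp [hvn])
  have e1 : ∑ i ∈ Fr n, 2 * (Ps (v i~ t) - Ps (v i t)) *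
      (deriv Ps (v i~ t) * deriv (v i~) t - deriv Ps (v i t) * deriv (v i) t)
      = -2 * ∑ i ∈ Fr n, deriv Ps (v i~ t) * deriv (v i~) t *
        (Ps (v i~~ t) - 2 * Ps (v i~ t) + Ps (v i t)) := by
    rw [this, mul_neg, neg_mul, neg_neg, An]
    apply Du rfl; intros; ring
  rw [e1, An, An, An]
  apply Du rfl
  intro i hi
  rw [Ba] at hi
  rcases (show i + 1 = n ∨ i + 1 < n by omega) with hh | hh
  · rw [hh, hvn]; simp
  · rw [(h.dv i hh t ht).deriv]; field_simp
theorem DSol.en_le (h : DSol Ps n (n ^ 2 : Re) ac M ac ac s S v) (ab : PsiData Ps) (af : 0 < ac)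
    (hn : 0 < n) (bc : ac ≤ M) : ∀ t ∈ Jc, t * en Ps n v t ≤ M * Ps M := by
  have hn' : Oo < n := Po
  set B : Fn := fun x => ∫ y in ac..x, (Ps y - Ps ac) with hB
  have hcon : Co (fun y => Ps y - Ps ac) (Ioi 0) :=
    (ab.cont.mono Eo).sub continuousOn_const
  have hBd : ∀ x, 0 < x → Dv B (Ps x - Ps ac) x := by
    intro x hx
    apply intervalIntegral.integral_hasDerivAt_right
    · apply (hcon.mono _).intervalIntegrable
      intro y hy
      exact (Eb af hx).trans_le hy.1
    · exact hcon.stronglyMeasurableAtFilter isOpen_Ioi x hx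
    · exact hcon.continuousAt (Cm hx)
  have hB0 : ∀ x ∈ Icc ac M, 0 ≤ B x ∧ B x ≤ M * Ps M := by
    intro x hx
    constructor
    · apply intervalIntegral.integral_nonneg hx.1
      intro y hy
      linarith [ab.monoOn af.le hy.1]
    · have h1 : B x ≤ ∫ y in ac..x, Ps M := by
        apply intervalIntegral.integral_mono_on hx.1
        · apply (hcon.mono _).intervalIntegrable
          intro y hy
          rw [uIcc_of_le hx.1] at hy
          exact af.trans_le hy.1
        · simp
        · intro y hy
          linarith [ab.monoOn (af.le.trans hy.1) (hy.2.trans hx.2), ab.nonneg af.le]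
      rw [intervalIntegral.integral_const, smul_eq_mul] at h1
      refine h1.trans (Ae (Lx hx.2) (ab.nonneg (af.le.trans bc)))
  set f : Fn := fun t => (1 / n) * ∑ i ∈ Fr n, B (v i~ t) with hf
  have hfd : ∀ t ∈ Jo, Dv f (- en Ps n v t) t := by
    intro t ht
    have h1 : Dv f ((1/n) * ∑ i ∈ Fr n,
        (Ps (v i~ t) - Ps ac) * deriv (v i~) t) t := by
      apply Fe
      apply Eu
      intro i hi
      rw [Ba] at hi
      have h1 := ((h.smooth ab af i~ Om).contDiffAt (Bk ht.1 ht.2)).differentiableAt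
        Si
      exact (hBd _ (af.trans_le (h.mem i~ Om t ⟨ht.1.le, ht.2.le⟩).1)).comp t h1.hasDerivAt
    refine h1.congr_deriv ?_
    have := sbp0 (fun i => Ps (v i t) - Ps ac) (fun i => Ps (v i t)) n (by simp [h.vl]) (by simp [h.vr])
    have e1 : ∑ i ∈ Fr n, (Ps (v i~ t) - Ps ac) * deriv (v i~) t =
        n ^ 2 * ∑ i ∈ Fr n, (Ps (v i~ t) - Ps ac) *
          (Ps (v i~~ t) - 2 * Ps (v i~ t) + Ps (v i t)) := by
      rw [An]
      apply Du rfl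
      intro i hi
      rw [Ba] at hi
      rcases (show i + 1 = n ∨ i + 1 < n by omega) with hh | hh
      · rw [hh, h.vr]; simp
      · rw [(h.dv i hh t ht).deriv]; ring
    rw [e1, this, en]
    have e2 : ∑ i ∈ Fr n, (Ps (v i~ t) - Ps ac - (Ps (v i t) - Ps ac)) * (Ps (v i~ t) - Ps (v i t))
        = ∑ i ∈ Fr n, (Ps (v i~ t) - Ps (v i t)) ^ 2 := by
      apply Du rfl; intros; ring
    rw [e2]; field_simp
  have hfb : ∀ t ∈ Jc, 0 ≤ f t ∧ f t ≤ M * Ps M := by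
    intro t ht
    constructor
    · apply Bu Po
      apply Bl
      intro i hi
      rw [Ba] at hi
      exact (hB0 _ (h.mem i~ Om t ht)).1
    · have : ∑ i ∈ Fr n, B (v i~ t) ≤ ∑ i ∈ Fr n, M * Ps M := by
        apply As
        intro i hi
        rw [Ba] at hi
        exact (hB0 _ (h.mem i~ Om t ht)).2
      rw [Finset.sum_const, Finset.card_range, nsmul_eq_mul] at this
      calc f t ≤ (1/n) * (n * (M * Ps M)) := Aa this Po
        _ = M * Ps M := by field_simp
  have cf : Co f (Icc 0 2) := by
    apply continuousOn_const.mul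
    apply continuousOn_finsetSum
    intro i hi t ht
    rw [Ba] at hi
    have h1 := hBd _ (af.trans_le (h.mem i~ Om t ht).1)
    exact h1.continuousAt.comp_continuousWithinAt (h.cv i~ Om t ht)
  have ce : Co (en Ps n v) (Icc 0 2) := by
    apply continuousOn_const.mul
    apply continuousOn_finsetSum
    intro i hi
    rw [Ba] at hi
    exact ((h.cz ab af i~ Om).sub (h.cz ab af i Om)).pow 2
  have hanti : AntitoneOn (fun t => f t + t * en Ps n v t) (Icc 0 2) := by
    have hdd : ∀ t ∈ Jo, Dv (fun t => f t + t * en Ps n v t)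
      (-en Ps n v t + (1 * en Ps n v t + t * (-(2 / n) * ∑ i ∈ Fr n, deriv Ps (v i~ t) * deriv (v i~) t ^ 2))) t :=
      fun t ht => (hfd t ht).add ((Af t).mul (h.den ab af hn t ht))
    refine anti_hd (cf.add (continuousOn_id.mul ce)) hdd ?_
    · intro t ht
      have : 0 ≤ ∑ i ∈ Fr n, deriv Ps (v i~ t) * deriv (v i~) t ^ 2 := by
        apply Bl
        intro i hi
        rw [Ba] at hi
        exact Bu (ab.dpos _ (af.trans_le (h.mem i~ Om t ⟨ht.1.le, ht.2.le⟩).1)).le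
          (Be _)
      have h3 : 0 ≤ t * ((2/n) * ∑ i ∈ Fr n, deriv Ps (v i~ t) * deriv (v i~) t ^ 2) :=
        Bu ht.1.le (Bu Po this)
      linarith
  intro t ht
  have := hanti ⟨Ad, Nn⟩ ht ht.1
  simp only [zero_mul, add_zero] at this
  linarith [(hfb t ht).1, (hfb 0 ⟨Ad, Nn⟩).2]
theorem DSol.holder (h : DSol Ps n (n ^ 2 : Re) ac M ac ac s S v) (ab : PsiData Ps) (af : 0 < ac)
    (hn : 0 < n) (bc : ac ≤ M) {t : Re} (ht : t ∈ Jc) {i j : ℕ} (hij : i ≤ j) (hj : j ≤ n) :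
    t * (Ps (v j t) - Ps (v i t)) ^ 2 ≤ ((j - i) / n) * (M * Ps M) := by
  have hn' : Oo < n := Po
  have h1 := cs_telescope (fun i => Ps (v i t)) hij
  have hji : Oo ≤ j - i := sub_nonneg.2 (Ec hij)
  have h2 : ∑ k ∈ Finset.Ico i j, (Ps (v k~ t) - Ps (v k t)) ^ 2 ≤
      ∑ k ∈ Fr n, (Ps (v k~ t) - Ps (v k t)) ^ 2 := by
    apply Finset.sum_le_sum_of_subset_of_nonneg
    · intro k hk
      rw [Finset.mem_Ico] at hk
      exact Ba.2 Om
    · intros; positivity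
  have h3 := h.en_le ab af hn bc t ht
  rw [en] at h3
  calc t * (Ps (v j t) - Ps (v i t)) ^ 2
      ≤ t * ((j - i) * ∑ k ∈ Fr n, (Ps (v k~ t) - Ps (v k t)) ^ 2) :=
        Aa (h1.trans (Aa h2 hji)) ht.1
    _ = ((j - i) / n) * (t * (n * ∑ k ∈ Fr n, (Ps (v k~ t) - Ps (v k t)) ^ 2)) := by
        field_simp
    _ ≤ _ := Aa h3 Po
end
theorem shift_le (q : ℕ → Re) (hq : ∀ i, 0 ≤ q i) (h0 : q 0 = 0) (n : ℕ) :
    ∑ i ∈ Fr n, q i ≤ ∑ i ∈ Fr n, q i~ := by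
  have := Cs q n
  have h2 := Em q n
  linarith [hq n]
theorem dsup_le (w : ℕ → Re) {n : ℕ} {h : Re} (hh : 0 < h) (hn : n * h ≤ 1) (h0 : w 0 = 0) {k : ℕ}
    (hk : k ≤ n) : w k ^ 2 ≤ (1 / h) * ∑ i ∈ Fr n, (w i~ - w i) ^ 2 := by
  have h1 := cs_telescope w (Nat.zero_le k)
  rw [h0, sub_zero, Nat.cast_zero, sub_zero] at h1
  have h2 : ∑ i ∈ Finset.Ico 0 k, (w i~ - w i) ^ 2 ≤ ∑ i ∈ Fr n, (w i~ - w i) ^ 2 := by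
    apply Finset.sum_le_sum_of_subset_of_nonneg
    · intro i hi
      rw [Finset.mem_Ico] at hi
      exact Ba.2 Om
    · intros; positivity
  have h3 : (k : Re) ≤ 1 / h := by
    rw [Ap hh]
    have : (k : Re) ≤ n := Ec hk
    nlinarith
  exact h1.trans (Dd h3 h2 (Bl fun i _ => Be _) Po)
set_option maxHeartbeats 800000 in
theorem est1 {n : ℕ} {h A B lam : Re} (hh : 0 < h) (hn : n * h ≤ 1) (hB : 0 ≤ B)
    (hl : 0 < lam) (a y yd ao aj F q : ℕ → Re) (G : Re)
    (ha0 : ∀ i, 0 ≤ a i) (ha1 : ∀ i, a i ≤ 1) (ha00 : a 0 = 0) (han : a n = 0)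
    (hda : ∀ i, |a i~ - a i| ≤ A * h) (hq : ∀ i, 0 ≤ q i) (hq0 : q 0 = 0)
    (hqa : ∀ i, (a i ≠ 0 ∨ a i~ ≠ 0) → q i = y i ^ 2 ∧ q i~ = y i~ ^ 2)
    (hG : h * ∑ i ∈ Fr n, q i~ ≤ G)
    (bf : ∀ i, a i~ ≠ 0 → lam ≤ ao i~)
    (db : ∀ i, a i~ ≠ 0 → |aj i~| ≤ B * (1 + |y i~|))
    (hF : ∀ i, a i~ ≠ 0 → |F i~| ≤ B * (1 + y i~ ^ 2))
    (heq : ∀ i, a i~ ≠ 0 → ao i~ * yd i~ = (y i~~ - 2 * y i~ + y i) / h ^ 2 + F i~) :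
    h * ∑ i ∈ Fr n, a i~ ^ 2 * (aj i~ * y i~ ^ 2 + 2 * (ao i~ * y i~ * yd i~))
      ≤ - ((1 / h) * ∑ i ∈ Fr n, (a i~ * y i~ - a i * y i) ^ 2)
        + (2 * A ^ 2 + 6 * B + 3 * B ^ 2 / lam) * (1 + G) *
          (1 + h * ∑ i ∈ Fr n, a i~ ^ 2 * ao i~ * y i~ ^ 2) := by
  set H := (1 / h) * ∑ i ∈ Fr n, (a i~ * y i~ - a i * y i) ^ 2 with hH
  set E := h * ∑ i ∈ Fr n, a i~ ^ 2 * ao i~ * y i~ ^ 2 with hE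
  have hH0 : 0 ≤ H := Bu Po (Bl fun i _ => Be _)
  have hG0 : 0 ≤ G := (Bu hh.le (Bl fun i _ => hq _)).trans hG
  set m := Real.sqrt H with hm
  have hm2 : m ^ 2 = H := Real.sq_sqrt hH0
  have hm0 : 0 ≤ m := Real.sqrt_nonneg _
  have hay : ∀ i < n, a i~ * |y i~| ≤ m := by
    intro i hi
    have := dsup_le (fun i => a i * y i) hh hn (by simp [ha00]) (k := i+1) Om
    apply Real.le_sqrt_of_sq_le
    rw [mul_pow, sq_abs, ← mul_pow]
    exact this
  set P := h * ∑ i ∈ Fr n, a i~ * y i~ ^ 2 with hP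
  set E2 := h * ∑ i ∈ Fr n, a i~ ^ 2 * y i~ ^ 2 with hE2
  have hE2E : lam * E2 ≤ E := by
    rw [hE2, hE, mul_left_comm, An]
    apply Aa _ hh.le
    apply As
    intro i _
    by_cases h0 : a i~ = 0
    · simp [h0]
    · have := Ae (bf i h0) (show 0 ≤ a i~ ^ 2 * y i~ ^ 2 by positivity)
      linarith
  have hE20 : 0 ≤ E2 := Bu hh.le (Bl fun i _ => by positivity)
  have hE0 : 0 ≤ E := (Bu hl.le hE20).trans hE2E
  have hE2G : E2 ≤ G := by
    refine le_trans (Aa (As fun i _ => ?_) hh.le) hG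
    by_cases h0 : a i~ = 0
    · simp [h0, hq]
    · rw [(hqa i (Or.inr h0)).2]
      have : a i~ ^ 2 ≤ 1 := Dr (ha0 _) (ha1 _)
      nlinarith [Be (y i~)]
  have hP0 : 0 ≤ P := Bu hh.le (Bl fun i _ => Bu (ha0 _) (Be _))
  have hP2 : P ^ 2 ≤ E2 * G := by
    have hcs := Finset.sum_mul_sq_le_sq_mul_sq (Fr n) (fun i => a i~ * |y i~|)
      (fun i => Real.sqrt (q i~))
    have e1 : ∑ i ∈ Fr n, a i~ * |y i~| * Real.sqrt (q i~) =
        ∑ i ∈ Fr n, a i~ * y i~ ^ 2 := by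
      apply Du rfl
      intro i _
      by_cases h0 : a i~ = 0
      · simp [h0]
      · rw [(hqa i (Or.inr h0)).2, Real.sqrt_sq_eq_abs, mul_assoc, abs_mul_abs_self, sq]
    have e2 : ∑ i ∈ Fr n, (a i~ * |y i~|) ^ 2 =
        ∑ i ∈ Fr n, a i~ ^ 2 * y i~ ^ 2 := by
      apply Du rfl
      intro i _
      rw [mul_pow, sq_abs]
    have e3 : ∑ i ∈ Fr n, Real.sqrt (q i~) ^ 2 = ∑ i ∈ Fr n, q i~ := by
      apply Du rfl
      intro i _
      rw [Real.sq_sqrt (hq _)]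
    rw [e1, e2, e3] at hcs
    calc P ^ 2 = h ^ 2 * (∑ i ∈ Fr n, a i~ * y i~ ^ 2) ^ 2 := by rw [hP]; ring
      _ ≤ h ^ 2 * ((∑ i ∈ Fr n, a i~ ^ 2 * y i~ ^ 2) * ∑ i ∈ Fr n, q i~) := by
        gcongr
      _ = E2 * (h * ∑ i ∈ Fr n, q i~) := by rw [hE2]; ring
      _ ≤ E2 * G := Aa hG hE20
  have hsbp := sbp0 (fun i => a i ^ 2 * y i) y n (by simp [ha00]) (by simp [han])
  have hx : ∀ i ∈ Fr n, h * (a i~ ^ 2 * (aj i~ * y i~ ^ 2 +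
      2 * (ao i~ * y i~ * yd i~))) ≤ 2 / h * ((a i~ ^ 2 * y i~) * (y i~~ - 2 * y i~ + y i))
      + 3 * B * (h * (a i~ ^ 2 * y i~ ^ 2)) + 2 * B * h + 3 * B * m * (h * (a i~ * y i~ ^ 2)) := by
    intro i hi
    rw [Ba] at hi
    by_cases h0 : a i~ = 0
    · simp [h0]; positivity
    have e1 : h * (a i~ ^ 2 * (aj i~ * y i~ ^ 2 + 2 * (ao i~ * y i~ * yd i~))) =
        2 / h * ((a i~ ^ 2 * y i~) * (y i~~ - 2 * y i~ + y i)) +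
        h * (a i~ ^ 2 * (aj i~ * y i~ ^ 2 + 2 * (y i~ * F i~))) := by
      rw [show ao i~ * y i~ * yd i~ = y i~ * (ao i~ * yd i~) by ring, heq i h0]
      field_simp
      ring
    rw [e1]
    set Y := |y i~| with hY
    have hY0 : 0 ≤ Y := abs_nonneg _
    have hY2 : y i~ ^ 2 = Y ^ 2 := (sq_abs _).symm
    have b1 : aj i~ * y i~ ^ 2 ≤ B * (1 + Y) * Y ^ 2 := by
      rw [hY2]; exact Ae ((Cf _).trans (db i h0)) (Be _)
    have b2 : y i~ * F i~ ≤ Y * (B * (1 + Y ^ 2)) := by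
      rw [← hY2]
      calc y i~ * F i~ ≤ |y i~ * F i~| := Cf _
        _ = Y * |F i~| := abs_mul _ _
        _ ≤ _ := Aa (hF i h0) hY0
    have b3 : aj i~ * y i~ ^ 2 + 2 * (y i~ * F i~) ≤ 3 * B * Y ^ 2 + 2 * B + 3 * B * Y ^ 3 := by
      linear_combination b1 + 2 * b2 + Bu hB (Be (Y - 1)) +
        Bu hB (show 0 ≤ Y ^ 2 + 1 by positivity)
    have b4 : a i~ ^ 2 * Y ^ 3 ≤ m * (a i~ * Y ^ 2) := by
      have := Ae (hay i hi) (show 0 ≤ a i~ * Y ^ 2 from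
        Bu (ha0 _) (Be _))
      linarith
    have b5 : a i~ ^ 2 ≤ 1 := Dr (ha0 _) (ha1 _)
    have b6 : a i~ ^ 2 * (aj i~ * y i~ ^ 2 + 2 * (y i~ * F i~)) ≤
        3 * B * (a i~ ^ 2 * Y ^ 2) + 2 * B + 3 * B * m * (a i~ * Y ^ 2) := by
      have c1 := Aa b3 (Be (a i~))
      have c2 := Aa b4 hB
      have c3 := Aa b5 hB
      linear_combination c1 + 3 * c2 + 2 * c3
    rw [hY2]
    rw [hY2] at b6
    have := Aa b6 hh.le
    linarith
  have hsum := As hx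
  rw [← An, Bg, Bg, Bg,
    ← An, ← An, ← An, ← An, ← An,
    ← An,
    Finset.sum_const, Finset.card_range, nsmul_eq_mul, hsbp, ← hE2, ← hP] at hsum
  have hK : 2 / h * -∑ i ∈ Fr n, (a i~ ^ 2 * y i~ - a i ^ 2 * y i) * (y i~ - y i)
      ≤ - 2 * H + 2 * A ^ 2 * G := by
    have p1 : ∀ i ∈ Fr n, -((a i~ ^ 2 * y i~ - a i ^ 2 * y i) * (y i~ - y i)) ≤
        -(a i~ * y i~ - a i * y i) ^ 2 + A ^ 2 * h ^ 2 * ((q i + q i~) / 2) := by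
      intro i _
      by_cases h0 : a i ≠ 0 ∨ a i~ ≠ 0
      · obtain ⟨q1, q2⟩ := hqa i h0
        rw [q1, q2]
        have d1 : (a i~ - a i) ^ 2 ≤ A ^ 2 * h ^ 2 := by
          rw [← mul_pow]; exact sq_le_sq' (by linarith [(Ar.1 (hda i)).1]) (Ar.1 (hda i)).2
        have d2 := Ae d1 (show 0 ≤ (y i ^ 2 + y i~ ^ 2) / 2 by positivity)
        have d3 := Bu (Be (a i~ - a i)) (Be (y i - y i~))
        linear_combination d2 + d3 / 2
      · push Not at h0
        rw [h0.1, h0.2]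
        have := hq i; have := hq i~
        simp; positivity
    have p2 := As p1
    rw [Bg, Finset.sum_neg_distrib, Finset.sum_neg_distrib, ← An,
      ← Finset.sum_div, Bg] at p2
    have p3 := shift_le q hq hq0 n
    have p4 : 2 / h * (A ^ 2 * h ^ 2 * ((∑ i ∈ Fr n, q i + ∑ i ∈ Fr n, q i~) / 2)) ≤
        2 * A ^ 2 * G := by
      calc 2 / h * (A ^ 2 * h ^ 2 * ((∑ i ∈ Fr n, q i + ∑ i ∈ Fr n, q i~) / 2))
          ≤ 2 / h * (A ^ 2 * h ^ 2 * (∑ i ∈ Fr n, q i~)) := by gcongr; linarith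
        _ = 2 * A ^ 2 * (h * ∑ i ∈ Fr n, q i~) := by field_simp
        _ ≤ _ := by gcongr
    have p5 := Aa p2 (show 0 ≤ 2 / h by positivity)
    have p6 : 2 / h * -∑ i ∈ Fr n, (a i~ * y i~ - a i * y i) ^ 2 = -2 * H := by
      rw [hH]; ring
    linarith
  have hC1 : 3 * B * m * P ≤ H + 3 * B ^ 2 / lam * (G * E) := by
    have : P ^ 2 ≤ E / lam * G := hP2.trans (Ae
      ((Ap hl).2 Li) hG0)
    have e : 3 * B ^ 2 / lam * (G * E) = 3 * (B ^ 2 * (E / lam * G)) := by field_simp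
    rw [e, ← hm2]
    have := Aa this (Be B)
    linear_combination Be (m - 3 / 2 * (B * P)) + 3 * this + 3 / 4 * Be (B * P)
  have hC2 : (n : Re) * (2 * B * h) ≤ 2 * B := by linear_combination (2 * B) * hn
  have hGE : 0 ≤ G * E := Bu hG0 hE0
  have hk : 0 ≤ 3 * B ^ 2 / lam := Po
  have hfin : 2 * A ^ 2 * G + 3 * B * G + 2 * B + 3 * B ^ 2 / lam * (G * E) ≤
      (2 * A ^ 2 + 6 * B + 3 * B ^ 2 / lam) * (1 + G) * (1 + E) := by
    have hA2 := Be A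
    set k := 3 * B ^ 2 / lam
    have h1 : 0 ≤ 2 * A ^ 2 * (1 + E + G * E) := Po
    have h2 : 0 ≤ B * (4 + 6 * E + 6 * (G * E) + 3 * G) := Po
    have h3 : 0 ≤ k * (1 + G + E) := Po
    linear_combination h1 + h2 + h3
  have := Aa hE2G (show 0 ≤ 3 * B by positivity)
  linarith
theorem abel0 (c x : ℕ → Re) (n : ℕ) (h0 : c 0 = 0) (hn : c n = 0) :
    ∑ i ∈ Fr n, c i * (x i~ - x i) = ∑ i ∈ Fr n, x i~ * (c i - c i~) := by
  have := Cs (fun i => c i * x i) n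
  have h2 := Em (fun i => c i * x i) n
  have h3 : ∑ i ∈ Fr n, c i * (x i~ - x i) - ∑ i ∈ Fr n, x i~ * (c i - c i~) =
    ∑ i ∈ Fr n, c i~ * x i~ - ∑ i ∈ Fr n, c i * x i := by
    rw [← Finset.sum_sub_distrib, ← Finset.sum_sub_distrib]
    exact Du rfl fun i _ => by ring
  simp only [h0, hn, zero_mul] at this h2
  linarith
theorem pbound {n : ℕ} {h A : Re} (hh : 0 < h)
    (a y q p : ℕ → Re) (G : Re)
    (hda : ∀ i, |a i~ - a i| ≤ A * h) (hq : ∀ i, 0 ≤ q i) (hq0 : q 0 = 0)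
    (hG : h * ∑ i ∈ Fr n, q i~ ≤ G)
    (hp : ∀ i, p i ≠ 0 → p i ≤ (y i~ - y i) ^ 2 ∧ 1 / 4 ≤ a i~ ∧ q i = y i ^ 2) :
    (1 / h) * ∑ i ∈ Fr n, p i ≤
      32 * ((1 / h) * ∑ i ∈ Fr n, (a i~ * y i~ - a i * y i) ^ 2) + 32 * A ^ 2 * G := by
  have p1 : ∀ i ∈ Fr n, p i ≤ 32 * (a i~ * y i~ - a i * y i) ^ 2 + 32 * A ^ 2 * h ^ 2 * q i := by
    intro i _
    by_cases h0 : p i = 0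
    · rw [h0]; have := hq i; positivity
    obtain ⟨e1, e2, e3⟩ := hp i h0
    rw [e3]
    have d1 : (a i~ - a i) ^ 2 ≤ A ^ 2 * h ^ 2 := by
      rw [← mul_pow]; exact sq_le_sq' (by linarith [(Ar.1 (hda i)).1]) (Ar.1 (hda i)).2
    have d2 := Ae d1 (Be (y i))
    have d3 : (1 / 4 : Re) ^ 2 * (y i~ - y i) ^ 2 ≤ a i~ ^ 2 * (y i~ - y i) ^ 2 :=
      Ae (Bm Nn e2 2) (Be _)
    linear_combination e1 + 16 * d3 + 32 * d2 +
      16 * Be (a i~ * y i~ - a i * y i + (a i~ - a i) * y i)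
  have p2 := As p1
  rw [Bg, ← An, ← An] at p2
  have p3 := shift_le q hq hq0 n
  have p4 := Aa p2 (show 0 ≤ 1 / h by positivity)
  have p5 : h * ∑ i ∈ Fr n, q i ≤ G := (Aa p3 hh.le).trans hG
  have p6 := Aa p5 (show 0 ≤ 32 * A ^ 2 by positivity)
  have e : 1 / h * (32 * A ^ 2 * h ^ 2 * ∑ i ∈ Fr n, q i) =
    32 * A ^ 2 * (h * ∑ i ∈ Fr n, q i) := by field_simp
  linarith
theorem est2 {n : ℕ} {h A lam : Re} (hh : 0 < h)
    (hl : 0 < lam) (b y yd ao F p : ℕ → Re) (Z J : Re)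
    (hb00 : b 0 = 0) (hbn : b n = 0)
    (hdb : ∀ i, |b i~ - b i| ≤ A * h)
    (hp0 : ∀ i, 0 ≤ p i) (hpn : p n = 0)
    (hp : ∀ i, (b i ≠ 0 ∨ b i~ ≠ 0) → p i = (y i~ - y i) ^ 2)
    (hZ : (1 / h) * ∑ i ∈ Fr n, p i ≤ Z)
    (hJ : h * ∑ i ∈ Fr n, b i~ ^ 2 * F i~ ^ 2 ≤ J)
    (bf : ∀ i, b i~ ≠ 0 → lam ≤ ao i~)
    (heq : ∀ i, b i~ ≠ 0 → ao i~ * yd i~ = (y i~~ - 2 * y i~ + y i) / h ^ 2 + F i~) :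
    (1 / h) * ∑ i ∈ Fr n, b i * b i~ * (2 * (y i~ - y i) * (yd i~ - yd i)) ≤
      - lam * (h * ∑ i ∈ Fr n, b i~ ^ 2 * yd i~ ^ 2) + 2 / lam * J + 8 * A ^ 2 / lam * Z := by
  have hab := abel0 (fun i => b i * b i~ * (2 * (y i~ - y i))) yd n (by simp [hb00]) (by simp [hbn])
  have e0 : ∑ i ∈ Fr n, b i * b i~ * (2 * (y i~ - y i) * (yd i~ - yd i)) =
      ∑ i ∈ Fr n, b i * b i~ * (2 * (y i~ - y i)) * (yd i~ - yd i) :=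
    Du rfl fun i _ => by ring
  rw [e0, hab]
  have p1 : ∀ i ∈ Fr n, 1 / h * (yd i~ * (b i * b i~ * (2 * (y i~ - y i)) -
      b i~ * b i~~ * (2 * (y i~~ - y i~)))) ≤
      - lam * h * (b i~ ^ 2 * yd i~ ^ 2) + 2 / lam * h * (b i~ ^ 2 * F i~ ^ 2) +
        4 * A ^ 2 / lam * (1 / h) * (p i + p i~) := by
    intro i _
    by_cases h0 : b i~ = 0
    · have := hp0 i; have := hp0 i~; simp [h0]; positivity
    have hp1 := hp i (Or.inr h0)
    have hp2 := hp i~ (Or.inl h0)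
    rw [hp1, hp2]
    have hd : y i~~ - 2 * y i~ + y i = h ^ 2 * (ao i~ * yd i~ - F i~) := by
      rw [heq i h0]; field_simp; ring
    set x := b i~ * yd i~ with hx
    set Q := (b i~~ - b i~) * (y i~~ - y i~) + (b i~ - b i) * (y i~ - y i) with hQ
    have e1 : 1 / h * (yd i~ * (b i * b i~ * (2 * (y i~ - y i)) -
      b i~ * b i~~ * (2 * (y i~~ - y i~)))) =
      - 2 * h * (ao i~ * x ^ 2) + 2 * h * (x * (b i~ * F i~)) - 2 / h * (x * Q) := by
      have : b i * b i~ * (2 * (y i~ - y i)) - b i~ * b i~~ * (2 * (y i~~ - y i~)) =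
        -2 * b i~ * (b i~ * (h ^ 2 * (ao i~ * yd i~ - F i~)) + Q) := by
        rw [← hd, hQ]; ring
      rw [this, hx]; field_simp; ring
    rw [e1]
    have hQ2 : Q ^ 2 ≤ 2 * A ^ 2 * h ^ 2 * ((y i~ - y i) ^ 2 + (y i~~ - y i~) ^ 2) := by
      have d1 : ∀ k, (b k~ - b k) ^ 2 ≤ A ^ 2 * h ^ 2 := fun k => by
        rw [← mul_pow]; exact sq_le_sq' (by linarith [(Ar.1 (hdb k)).1]) (Ar.1 (hdb k)).2
      have d2 := Ae (d1 i) (Be (y i~ - y i))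
      have d3 := Ae (d1 i~) (Be (y i~~ - y i~))
      rw [hQ]
      linear_combination 2 * d2 + 2 * d3 + Be ((b i~~ - b i~) * (y i~~ - y i~) -
        (b i~ - b i) * (y i~ - y i))
    have f1 : lam * x ^ 2 ≤ ao i~ * x ^ 2 := Ae (bf i h0) (Be _)
    have f2 : 2 * (x * (b i~ * F i~)) ≤ lam / 2 * x ^ 2 + 2 / lam * (b i~ ^ 2 * F i~ ^ 2) := by
      have := Bu (show 0 ≤ 1 / (2 * lam) by positivity) (Be (lam * x - 2 * (b i~ * F i~)))
      have e : 1 / (2 * lam) * (lam * x - 2 * (b i~ * F i~)) ^ 2 = lam / 2 * x ^ 2 +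
        2 / lam * (b i~ ^ 2 * F i~ ^ 2) - 2 * (x * (b i~ * F i~)) := by field_simp; ring
      linarith
    have f3 : - (2 / h * (x * Q)) ≤ lam / 2 * h * x ^ 2 + 2 / lam / h ^ 3 * Q ^ 2 := by
      have := Bu (show 0 ≤ 1 / (2 * lam * h ^ 3) by positivity) (Be (lam * h ^ 2 * x + 2 * Q))
      have e : 1 / (2 * lam * h ^ 3) * (lam * h ^ 2 * x + 2 * Q) ^ 2 = lam / 2 * h * x ^ 2 +
        2 / lam / h ^ 3 * Q ^ 2 + 2 / h * (x * Q) := by field_simp; ring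
      linarith
    have f4 := Aa hQ2 (show 0 ≤ 2 / lam / h ^ 3 by positivity)
    have e4 : 2 / lam / h ^ 3 * (2 * A ^ 2 * h ^ 2 * ((y i~ - y i) ^ 2 + (y i~~ - y i~) ^ 2)) =
      4 * A ^ 2 / lam * (1 / h) * ((y i~ - y i) ^ 2 + (y i~~ - y i~) ^ 2) := by field_simp; ring
    rw [e4] at f4
    have f5 := Aa f1 hh.le
    have f6 := Aa f2 hh.le
    have ex : x ^ 2 = b i~ ^ 2 * yd i~ ^ 2 := by rw [hx]; ring
    rw [← ex]
    linear_combination 2 * f5 + f6 + f3 + f4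
  have p2 := As p1
  rw [Bg, Bg, ← An, ← An, ← An,
    ← An, Bg] at p2
  have p3 : ∑ i ∈ Fr n, p i~ ≤ ∑ i ∈ Fr n, p i := by
    have := Cs p n
    have h2 := Em p n
    linarith [hp0 0]
  have g1 := Aa hJ (show 0 ≤ 2 / lam by positivity)
  have g2 := Aa hZ (show 0 ≤ 8 * A ^ 2 / lam by positivity)
  have g3 := Aa p3 (show 0 ≤ 4 * A ^ 2 / lam * (1 / h) by positivity)
  linear_combination p2 + g1 + g2 + g3
theorem jbound {n : ℕ} {h B lam : Re} (hh : 0 < h) (hn : n * h ≤ 1)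
    (hl : 0 < lam) (a b y ao F : ℕ → Re) (hb0 : ∀ i, 0 ≤ b i) (hb1 : ∀ i, b i ≤ 1) (ha00 : a 0 = 0)
    (hab : ∀ i, b i ≠ 0 → 1 / 4 ≤ a i)
    (bf : ∀ i, a i~ ≠ 0 → lam ≤ ao i~)
    (hF : ∀ i, b i~ ≠ 0 → |F i~| ≤ B * (1 + y i~ ^ 2)) :
    h * ∑ i ∈ Fr n, b i~ ^ 2 * F i~ ^ 2 ≤
      2 * B ^ 2 * (1 + 256 / lam * ((1 / h) * ∑ i ∈ Fr n, (a i~ * y i~ - a i * y i) ^ 2) *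
        (h * ∑ i ∈ Fr n, a i~ ^ 2 * ao i~ * y i~ ^ 2)) := by
  set H := (1 / h) * ∑ i ∈ Fr n, (a i~ * y i~ - a i * y i) ^ 2 with hH
  have hH0 : 0 ≤ H := Bu Po (Bl fun i _ => Be _)
  have p1 : ∀ i ∈ Fr n, b i~ ^ 2 * F i~ ^ 2 ≤
      2 * B ^ 2 + 2 * B ^ 2 * (256 / lam) * H * (a i~ ^ 2 * ao i~ * y i~ ^ 2) := by
    intro i hi
    have ht : 0 ≤ a i~ ^ 2 * ao i~ * y i~ ^ 2 := by
      by_cases h0 : a i~ = 0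
      · simp [h0]
      · have := hl.trans_le (bf i h0); positivity
    by_cases h0 : b i~ = 0
    · rw [h0]; have : 0 ≤ 256 / lam := Po
      simp; positivity
    have ha := hab _ h0
    have hg := bf i Li
    have f1 : F i~ ^ 2 ≤ (B * (1 + y i~ ^ 2)) ^ 2 := by
      rw [← sq_abs]; exact Bm (abs_nonneg _) (hF i h0) 2
    have f2 : b i~ ^ 2 * F i~ ^ 2 ≤ F i~ ^ 2 :=
      Eg (Be _) (Dr (hb0 _) (hb1 _))
    have f3 : (a i~ * y i~) ^ 2 ≤ H :=
      dsup_le (fun i => a i * y i) hh hn (by simp [ha00]) (k := i+1) (by simp at hi; omega)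
    have f4 : y i~ ^ 2 ≤ 16 * (a i~ * y i~) ^ 2 := by
      have := Ae (Bm Nn ha 2) (Be (y i~))
      linear_combination 16 * this
    have f5 : lam * y i~ ^ 2 ≤ 16 * (a i~ ^ 2 * ao i~ * y i~ ^ 2) := by
      have := Aa hg (Be (a i~ * y i~))
      have := Aa f4 hl.le
      linarith
    set Y := y i~ ^ 2
    have hY : 0 ≤ Y := Be _
    have f6 : lam * Y * Y ≤ 16 * (a i~ ^ 2 * ao i~ * Y) * (16 * H) :=
      Dd f5 Li hY Li
    have f7 : Y * Y ≤ 256 / lam * H * (a i~ ^ 2 * ao i~ * Y) := by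
      rw [Dm, Dm, Ap hl]; linarith
    have f8 := Aa f7 (Be B)
    linear_combination f1 + f2 + 2 * f8 + Bu (Be B) (Be (Y - 1))
  have p2 := Aa (As p1) hh.le
  rw [Bg, ← An, ← An, Finset.sum_const, Finset.card_range, nsmul_eq_mul] at p2
  have := Aa hn (Be B)
  linear_combination p2 + 2 * this
theorem cbound {n : ℕ} {h A lam : Re} (hh : 0 < h) (hn : n * h ≤ 1)
    (hl : 0 < lam) (a b c y ao : ℕ → Re) (hb0 : ∀ i, 0 ≤ b i) (hc0 : ∀ i, 0 ≤ c i) (hc1 : ∀ i, c i ≤ 1)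
    (hc00 : c 0 = 0) (ha00 : a 0 = 0)
    (hdc : ∀ i, |c i~ - c i| ≤ A * h)
    (hbc : ∀ i, (c i ≠ 0 ∨ c i~ ≠ 0) → 1 / 4 ≤ b i ∧ 1 / 4 ≤ b i~ ∧ 1 / 4 ≤ a i)
    (bf : ∀ i, a i ≠ 0 → lam ≤ ao i) {k : ℕ} (hk : k ≤ n) :
    (c k * y k) ^ 2 ≤
      32 * ((1 / h) * ∑ i ∈ Fr n, b i * b i~ * (y i~ - y i) ^ 2) +
        32 * A ^ 2 / lam * (h * ∑ i ∈ Fr n, a i~ ^ 2 * ao i~ * y i~ ^ 2) := by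
  have f3 := dsup_le (fun i => c i * y i) hh hn (by simp [hc00]) hk
  refine f3.trans ?_
  have ht : ∀ i, 0 ≤ a i ^ 2 * ao i * y i ^ 2 := by
    intro i
    by_cases h0 : a i = 0
    · simp [h0]
    · have := hl.trans_le (bf i h0); positivity
  have p1 : ∀ i ∈ Fr n, (c i~ * y i~ - c i * y i) ^ 2 ≤
      32 * (b i * b i~ * (y i~ - y i) ^ 2) + 32 * A ^ 2 / lam * h ^ 2 * (a i ^ 2 * ao i * y i ^ 2) := by
    intro i _
    by_cases h0 : c i ≠ 0 ∨ c i~ ≠ 0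
    · obtain ⟨g1, g2, g3⟩ := hbc i h0
      have d1 : (c i~ - c i) ^ 2 ≤ A ^ 2 * h ^ 2 := by
        rw [← mul_pow]; exact sq_le_sq' (by linarith [(Ar.1 (hdc i)).1]) (Ar.1 (hdc i)).2
      have d2 := Ae d1 (Be (y i))
      have d3 : c i~ ^ 2 * (y i~ - y i) ^ 2 ≤ (y i~ - y i) ^ 2 :=
        Eg (Be _) (Dr (hc0 _) (hc1 _))
      have d4 : 1 / 4 * (1 / 4) * (y i~ - y i) ^ 2 ≤ b i * b i~ * (y i~ - y i) ^ 2 :=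
        Ae (Dd g1 g2 Nn (hb0 _)) (Be _)
      have d5 : (1 / 4) ^ 2 * lam * y i ^ 2 ≤ a i ^ 2 * ao i * y i ^ 2 :=
        Ae (Dd (Bm Nn g3 2)
          (bf i Li) hl.le (Be _)) (Be _)
      have d6 : y i ^ 2 ≤ 16 / lam * (a i ^ 2 * ao i * y i ^ 2) := by
        rw [Dm, Ap hl]; linarith
      have d7 := Aa d6 (show 0 ≤ A ^ 2 * h ^ 2 by positivity)
      linear_combination 2 * d3 + 32 * d4 + 2 * d2 + 2 * d7 +
        Be (c i~ * (y i~ - y i) - (c i~ - c i) * y i)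
    · push Not at h0
      rw [h0.1, h0.2]
      have := ht i; have := hb0 i; have := hb0 i~
      simp; positivity
  have p2 := Aa (As p1) (show 0 ≤ 1 / h by positivity)
  rw [Bg, ← An, ← An] at p2
  have p3 := shift_le (fun i => a i ^ 2 * ao i * y i ^ 2) ht (by simp [ha00]) n
  have p4 := Aa p3 (show 0 ≤ 32 * A ^ 2 / lam * h by positivity)
  have e : 1 / h * (32 * A ^ 2 / lam * h ^ 2 * ∑ i ∈ Fr n, a i ^ 2 * ao i * y i ^ 2) =
    32 * A ^ 2 / lam * h * ∑ i ∈ Fr n, a i ^ 2 * ao i * y i ^ 2 := by field_simp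
  linarith
theorem time1 {C bt B : Re} (hC : 0 ≤ C) (du : 0 ≤ bt) (hB : 0 ≤ B) : ∃ Q : Re, 0 ≤ Q ∧
    ∀ (t1 t2 : Re) (E Ed H G ap : Fn), t1 ≤ t2 → t2 - t1 ≤ 2 →
    (∀ t ∈ Icc t1 t2, Dv E (Ed t) t ∧ Dv ap (G t) t ∧ |ap t| ≤ B ∧ 0 ≤ E t ∧ 0 ≤ H t ∧
      0 ≤ G t ∧ E t ≤ bt * G t ∧ Ed t ≤ - H t + C * (1 + G t) * (1 + E t)) →
    ∃ ai bb : Fn, ∀ t ∈ Icc t1 t2, (t - t1) * E t ≤ Q ∧ Dv ai (bb t) t ∧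
      (t - t1) * H t ≤ bb t ∧ |ai t| ≤ Q := by
  set C' := bt + 2 * C with hC'
  have hC'0 : 0 ≤ C' := Po
  set Q1 := Real.exp (C' * B) * Real.exp (C' * (2 + B)) with hQ1
  have hQ10 : 0 ≤ Q1 := Po
  refine ⟨C' * Q1 * (2 + B) + Q1, Po, ?_⟩
  intro t1 t2 E Ed H G ap h12 h2 hyp
  have hk : ∀ t ∈ Icc t1 t2, Dv (fun t => (t - t1) * E t) (E t + (t - t1) * Ed t) t := by
    intro t ht
    have := ((Af t).sub_const t1).mul (hyp t ht).1
    exact this.congr_deriv Si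
  have hkd : ∀ t ∈ Icc t1 t2, E t + (t - t1) * Ed t ≤ -((t - t1) * H t) + C' * (1 + G t) * (1 + (t - t1) * E t) := by
    intro t ht
    obtain ⟨-, -, -, hE, hH, hG, hEG, hd⟩ := hyp t ht
    have hs : 0 ≤ t - t1 := Lx ht.1
    have hs2 : t - t1 ≤ 2 := Lx ht.2
    set s := t - t1
    have f1 := Aa hd hs
    have f2 : 0 ≤ C * (1 + G t) * (2 - s) := Bu Po Li
    have f3 : 0 ≤ bt * (1 + (1 + G t) * (s * E t)) := Po
    have f4 : 0 ≤ C * (1 + G t) * (s * E t) := Po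
    rw [hC']
    linear_combination f1 + f2 + f3 + f4 + hEG
  have bp : ∀ t ∈ Icc t1 t2, Dv (fun t => t - t1 + ap t) (1 + G t) t := fun t ht =>
    ((Af t).sub_const t1).add (hyp t ht).2.1
  have hm : ∀ t ∈ Icc t1 t2, Dv (fun t => (1 + (t - t1) * E t) * Real.exp (-(C' * (t - t1 + ap t))))
      ((E t + (t - t1) * Ed t) * Real.exp (-(C' * (t - t1 + ap t))) +
       (1 + (t - t1) * E t) * (Real.exp (-(C' * (t - t1 + ap t))) * (-(C' * (1 + G t))))) t := by
    intro t ht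
    exact ((hk t ht).const_add 1).mul ((((bp t ht).const_mul C').neg).exp)
  have hmanti : AntitoneOn (fun t => (1 + (t - t1) * E t) * Real.exp (-(C' * (t - t1 + ap t)))) (Icc t1 t2) := by
    apply anti_hd (fun t ht => (hm t ht).continuousAt.continuousWithinAt)
      (fun t ht => hm t (Ai ht))
    intro t ht
    have ht' := Ai ht
    have h1 := hkd t ht'
    have hH := Bu (show 0 ≤ t - t1 by linarith [ht'.1]) (hyp t ht').2.2.2.2.1
    have := Bu (Real.exp_pos (-(C' * (t - t1 + ap t)))).le (show 0 ≤ C' * (1 + G t) * (1 + (t - t1) * E t) - (E t + (t - t1) * Ed t) by linarith)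
    linarith
  have hkQ : ∀ t ∈ Icc t1 t2, 1 + (t - t1) * E t ≤ Q1 := by
    intro t ht
    have h1 := hmanti (Cd.2 h12) ht ht.1
    simp only [sub_self, zero_mul, add_zero, zero_add, one_mul] at h1
    have b1 := Ar.1 (hyp t1 (Cd.2 h12)).2.2.1
    have b2 := Ar.1 (hyp t ht).2.2.1
    have h3 : Real.exp (-(C' * ap t1)) ≤ Real.exp (C' * B) := by
      rw [Real.exp_le_exp]; nlinarith
    have h4 : Real.exp (C' * (t - t1 + ap t)) ≤ Real.exp (C' * (2 + B)) := by
      rw [Real.exp_le_exp]; apply Aa _ hC'0; linarith [ht.2]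
    calc 1 + (t - t1) * E t = (1 + (t - t1) * E t) * Real.exp (-(C' * (t - t1 + ap t))) * Real.exp (C' * (t - t1 + ap t)) := by
          rw [mul_assoc, ← Real.exp_add]; simp
      _ ≤ Q1 := Dd (h1.trans h3) h4 (Real.exp_pos _).le (Real.exp_pos _).le
  refine ⟨fun t => C' * Q1 * (t - t1 + ap t) - (t - t1) * E t,
    fun t => C' * Q1 * (1 + G t) - (E t + (t - t1) * Ed t), fun t ht => ⟨?_, ?_, ?_, ?_⟩⟩
  · have := hkQ t ht
    have : 0 ≤ C' * Q1 * (2 + B) := Po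
    linarith
  · exact ((bp t ht).const_mul _).sub (hk t ht)
  · have h1 := hkd t ht
    have h2 := Aa (hkQ t ht) (show 0 ≤ C' * (1 + G t) from
      Bu hC'0 (by linarith [(hyp t ht).2.2.2.2.2.1]))
    linarith
  · have b2 := Ar.1 (hyp t ht).2.2.1
    have h1 := hkQ t ht
    have h0 : 0 ≤ (t - t1) * E t := Bu (Lx ht.1) (hyp t ht).2.2.2.1
    have hc := Bu hC'0 hQ10
    have u1 := Aa (show t - t1 + ap t ≤ 2 + B by linarith [ht.2]) hc
    have u2 := Aa (show -(2 + B) ≤ t - t1 + ap t by linarith [ht.1]) hc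
    rw [Ar]
    constructor <;> linarith
theorem time2 {C2 C3 Q B ae lam : Re} (hC2 : 0 ≤ C2) (hC3 : 0 ≤ C3) (hQ : 0 ≤ Q) (hB : 0 ≤ B) (aq : 0 < ae)
    (hl : 0 < lam) : ∃ C : Re, 0 ≤ C ∧
    ∀ (t1 t2 : Re) (E H G ap ai bb W Wd P : Fn), t1 + ae ≤ t2 → t2 - t1 ≤ 2 →
    (∀ t ∈ Icc t1 t2, Dv W (Wd t) t ∧ Dv ap (G t) t ∧ Dv ai (bb t) t ∧
      |ap t| ≤ B ∧ |ai t| ≤ Q ∧ 0 ≤ E t ∧ 0 ≤ H t ∧ 0 ≤ G t ∧ 0 ≤ W t ∧ 0 ≤ P t ∧ (t - t1) * E t ≤ Q ∧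
      (t - t1) * H t ≤ bb t ∧ W t ≤ C3 * (H t + G t) ∧
      Wd t ≤ - lam * P t + C2 * (1 + G t + H t) * (1 + E t)) →
    ∃ bg bh : Fn, ∀ t ∈ Icc (t1 + 2 * ae) t2, W t ≤ C ∧ Dv bg (bh t) t ∧
      P t ≤ bh t ∧ |bg t| ≤ C := by
  set C4 := C3 + 2 * (C2 * (1 + Q / ae)) with hC4
  have dx : 0 ≤ Q / ae := Po
  have hC40 : 0 ≤ C4 := Po
  set D := C4 * (2 + 2 * (Q / ae) + 2 * B) with hD
  have hD0 : 0 ≤ D := Po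
  refine ⟨D / ae + 2 * D / (ae * lam), Po, ?_⟩
  intro t1 t2 E H G ap ai bb W Wd P h12 h2 hyp
  have sub : Icc (t1 + ae) t2 ⊆ Icc t1 t2 := Icc_subset_Icc_left Li
  have hk : ∀ t ∈ Icc t1 t2, Dv (fun t => (t - (t1 + ae)) * W t) (W t + (t - (t1 + ae)) * Wd t) t := by
    intro t ht
    exact (((Af t).sub_const (t1 + ae)).mul (hyp t ht).1).congr_deriv Si
  have bi : ∀ t ∈ Icc t1 t2, Dv (fun t => C4 * (t - t1 + ai t / ae + ap t))
      (C4 * (1 + bb t / ae + G t)) t := by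
    intro t ht
    obtain ⟨-, h3, h4, -⟩ := hyp t ht
    exact (((((Af t).sub_const t1).add (h4.div_const ae)).add h3).const_mul C4)
  have hkd : ∀ t ∈ Icc (t1 + ae) t2, W t + (t - (t1 + ae)) * Wd t ≤
      - ((t - (t1 + ae)) * (lam * P t)) + C4 * (1 + bb t / ae + G t) := by
    intro t ht
    obtain ⟨-, -, -, -, -, hE, hH, hG, hW, hP, hEQ, hHd, hWH, hWd⟩ := hyp t (sub ht)
    have hE' : E t ≤ Q / ae := by
      rw [Ap aq]
      have := Ae (show ae ≤ t - t1 by linarith [ht.1]) hE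
      linarith
    have hH' : H t ≤ bb t / ae := by
      rw [Ap aq]
      have := Ae (show ae ≤ t - t1 by linarith [ht.1]) hH
      linarith
    have hs : 0 ≤ t - (t1 + ae) := Lx ht.1
    have hs2 : t - (t1 + ae) ≤ 2 := Lx ht.2
    set s := t - (t1 + ae)
    have f1 := Aa hWd hs
    have f2 : C2 * (1 + G t + H t) * (1 + E t) ≤ C2 * (1 + G t + H t) * (1 + Q / ae) := by gcongr
    have f3 : s * (C2 * (1 + G t + H t) * (1 + E t)) ≤ 2 * (C2 * (1 + G t + H t) * (1 + Q / ae)) :=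
      Dd hs2 f2 Po Nn
    have f4 := Aa hH' hC40
    rw [hC4] at f4 ⊢
    linear_combination f1 + f3 + f4 + hWH + hC3
  have hanti : AntitoneOn (fun t => (t - (t1 + ae)) * W t - C4 * (t - t1 + ai t / ae + ap t)) (Icc (t1 + ae) t2) := by
    apply anti_hd (fun t ht => ((hk t (sub ht)).sub (bi t (sub ht))).continuousAt.continuousWithinAt)
      (fun t ht => (hk t (sub (Ai ht))).sub (bi t (sub (Ai ht))))
    intro t ht
    have ht' := Ai ht
    have h1 := hkd t ht'
    have : 0 ≤ (t - (t1 + ae)) * (lam * P t) := Bu (Lx ht.1)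
      (Bu hl.le (hyp t (sub ht')).2.2.2.2.2.2.2.2.2.1)
    linarith
  have bv : ∀ t ∈ Icc t1 t2, |ai t / ae + ap t| ≤ Q / ae + B := by
    intro t ht
    refine (abs_add_le _ _).trans (add_le_add ?_ (hyp t ht).2.2.2.1)
    rw [abs_div, Ag aq]
    exact Cl (hyp t ht).2.2.2.2.1 aq.le
  have hkD : ∀ t ∈ Icc (t1 + ae) t2, (t - (t1 + ae)) * W t ≤ D := by
    intro t ht
    have h1 := hanti (Cd.2 h12) ht ht.1
    simp only [sub_self, zero_mul] at h1
    have b1 := Ar.1 (bv _ (sub (Cd.2 h12)))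
    have b2 := Ar.1 (bv t (sub ht))
    have := Aa (show (t - t1 + ai t / ae + ap t) - (t1 + ae - t1 + ai (t1 + ae) / ae + ap (t1 + ae))
      ≤ 2 + 2 * (Q / ae) + 2 * B by linarith [ht.2]) hC40
    linarith
  refine ⟨fun t => (C4 * (t - t1 + ai t / ae + ap t) - (t - (t1 + ae)) * W t) / (ae * lam),
    fun t => (C4 * (1 + bb t / ae + G t) - (W t + (t - (t1 + ae)) * Wd t)) / (ae * lam), fun t ht => ?_⟩
  have ht' : t ∈ Icc (t1 + ae) t2 := ⟨Lx ht.1, ht.2⟩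
  have hs : ae ≤ t - (t1 + ae) := Lx ht.1
  have hW := (hyp t (sub ht')).2.2.2.2.2.2.2.2.1
  have hP := (hyp t (sub ht')).2.2.2.2.2.2.2.2.2.1
  refine ⟨?_, ?_, ?_, ?_⟩
  · have h1 : W t ≤ D / ae := by
      rw [Ap aq]
      have := Ae hs hW
      linarith [hkD t ht']
    have : 0 ≤ 2 * D / (ae * lam) := Po
    linarith
  · exact ((bi t (sub ht')).sub (hk t (sub ht'))).div_const _
  · rw [Ap Po]
    have := Ae hs (show 0 ≤ lam * P t by positivity)
    linarith [hkd t ht']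
  · rw [abs_div, Ag (show 0 < ae * lam by positivity)]
    have : |C4 * (t - t1 + ai t / ae + ap t) - (t - (t1 + ae)) * W t| ≤ 2 * D := by
      have b2 := Ar.1 (bv t (sub ht'))
      have h0 : 0 ≤ (t - (t1 + ae)) * W t := Bu Li hW
      have hk := hkD t ht'
      have u1 := Aa (show t - t1 + ai t / ae + ap t ≤ 2 + 2 * (Q / ae) + 2 * B by linarith [ht.2]) hC40
      have u2 := Aa (show -(2 + 2 * (Q / ae) + 2 * B) ≤ t - t1 + ai t / ae + ap t by linarith [ht.1]) hC40
      rw [Ar]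
      constructor <;> linarith
    have h3 := Cl this (show 0 ≤ ae * lam by positivity)
    have : 0 ≤ D / ae := Po
    linarith
def nd (j : ℕ) (h : Re) (i : ℕ) : Re := |(i : Re) - j| * h
noncomputable def tent (j : ℕ) (h ag : Re) (i : ℕ) : Re := max 0 (1 - nd j h i / ag)
theorem nd_succ (j : ℕ) {h : Re} (hh : 0 < h) (i : ℕ) : |nd j h i~ - nd j h i| ≤ h := by
  unfold nd
  rw [← sub_mul, abs_mul, Ag hh]
  have := abs_abs_sub_abs_le (((i+1 : ℕ) : Re) - j) ((i : Re) - j)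
  have e : (((i+1 : ℕ) : Re) - j) - ((i : Re) - j) = 1 := by push_cast; ring
  rw [e, abs_one] at this
  nlinarith
theorem tent_nonneg (j : ℕ) (h ag : Re) (i : ℕ) : 0 ≤ tent j h ag i := le_max_left _ _
theorem tent_le_one (j : ℕ) {h ag : Re} (hh : 0 < h) (ba : 0 < ag) (i : ℕ) : tent j h ag i ≤ 1 := by
  apply max_le Nn
  have : 0 ≤ nd j h i / ag := by unfold nd; positivity
  linarith
theorem tent_lip (j : ℕ) {h ag A : Re} (hh : 0 < h) (ba : 0 < ag) (hA : 1 / ag ≤ A) (i : ℕ) :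
    |tent j h ag i~ - tent j h ag i| ≤ A * h := by
  have h1 := abs_max_sub_max_le_abs (1 - nd j h i~ / ag) (1 - nd j h i / ag) 0
  have h2 : |(1 - nd j h i~ / ag) - (1 - nd j h i / ag)| ≤ 1 / ag * h := by
    rw [show (1 - nd j h i~ / ag) - (1 - nd j h i / ag) = -((nd j h i~ - nd j h i) / ag) by ring, abs_neg,
      abs_div, Ag ba, Db]
    exact Cl (nd_succ j hh i) ba.le
  unfold tent
  rw [max_comm 0, max_comm 0]
  exact h1.trans (h2.trans (Ae hA hh.le))
theorem tent_ne {j : ℕ} {h ag : Re} (ba : 0 < ag) {i : ℕ} (hne : tent j h ag i ≠ 0) : nd j h i < ag := by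
  by_contra hc
  push Not at hc
  apply hne
  apply Fa
  have := (one_le_div ba).2 hc
  linarith
theorem tent_ge {j : ℕ} {h ag x c : Re} (ba : 0 < ag) {i : ℕ} (hx : nd j h i ≤ x) (hc : x ≤ (1 - c) * ag) :
    c ≤ tent j h ag i := by
  refine le_trans ?_ (le_max_right _ _)
  have : nd j h i / ag ≤ 1 - c := by rw [Ci ba]; linarith
  linarith
structure RegHyp (R lam Lam B : Re) (n : ℕ) (h : Re) (j : ℕ) (t1 t2 : Re)
    (y yd ao aj F : ℕ → Fn) (ap au : Fn) : Prop where
  hh : 0 < h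
  hn : n * h ≤ 1
  hR : h ≤ R / 16
  h0 : R < j * h
  h1 : j * h + R < n * h
  h2 : t2 - t1 ≤ 2
  dy : ∀ i, nd j h i ≤ R → ∀ t ∈ Icc t1 t2, Dv (y i) (yd i t) t
  dc : ∀ i, nd j h i ≤ R → ∀ t ∈ Icc t1 t2, Dv (ao i) (aj i t) t
  bq : ∀ i, nd j h i ≤ R → ∀ t ∈ Icc t1 t2, lam ≤ ao i t ∧ ao i t ≤ Lam
  eq : ∀ i, nd j h i~ ≤ R → ∀ t ∈ Icc t1 t2,
    ao i~ t * yd i~ t = (y i~~ t - 2 * y i~ t + y i t) / h ^ 2 + F i~ t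
  de : ∀ i, nd j h i ≤ R → ∀ t ∈ Icc t1 t2, |aj i t| ≤ B * (1 + |y i t|)
  Fb : ∀ i, nd j h i ≤ R → ∀ t ∈ Icc t1 t2, |F i t| ≤ B * (1 + y i t ^ 2)
  ch : ∀ t ∈ Icc t1 t2, Dv ap (au t) t
  ck : ∀ t ∈ Icc t1 t2, |ap t| ≤ B
  bu : ∀ t ∈ Icc t1 t2, h * ∑ i ∈ Fr n, (if nd j h i~ ≤ R then y i~ t ^ 2 else 0) ≤ au t
theorem regStep {R lam Lam B ae : Re} (hR : 0 < R) (hl : 0 < lam) (hL : 0 ≤ Lam) (hB : 0 ≤ B) (aq : 0 < ae) :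
    ∃ C : Re, 0 ≤ C ∧ ∀ n h j t1 t2 y yd ao aj F ap au, t1 + ae ≤ t2 →
      RegHyp R lam Lam B n h j t1 t2 y yd ao aj F ap au →
      (∀ i, nd j h i ≤ R / 16 → ∀ t ∈ Icc (t1 + 2 * ae) t2, |y i t| ≤ C) ∧
      ∃ bg bh : Fn, ∀ t ∈ Icc (t1 + 2 * ae) t2, Dv bg (bh t) t ∧ |bg t| ≤ C ∧
        h * ∑ i ∈ Fr n, (if nd j h i~ ≤ R / 16 then yd i~ t ^ 2 else 0) ≤ bh t := by
  set A := 8 / R with hA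
  obtain ⟨Q, hQ, H1⟩ := time1 (C := 2 * A ^ 2 + 6 * B + 3 * B ^ 2 / lam) Po hL hB
  obtain ⟨C, hC, H2⟩ := time2 (C2 := 4 * B ^ 2 / lam * (1 + 256 / lam) + 8 * A ^ 2 / lam * (32 + 32 * A ^ 2))
    (C3 := 32 + 32 * A ^ 2) Po Po hQ hB aq hl
  refine ⟨128 * C + 128 * A ^ 2 / lam * (Q / ae) + 1, Po, ?_⟩
  intro n h j t1 t2 y yd ao aj F ap au cm D
  have hh := D.hh
  have hR16 := D.hR
  have nds := fun i => Ar.1 (nd_succ j hh i)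
  set a := tent j h (R / 2) with ha
  set b := tent j h (R / 4) with hb
  set c := tent j h (R / 8) with hc
  have nd0 : R < nd j h 0 := by simp [nd]; exact D.h0
  have hjn : (j : Re) < n := by
    have := D.h1
    by_contra hcon; push Not at hcon
    nlinarith [Ae hcon hh.le]
  have ndn : R < nd j h n := by
    unfold nd; rw [Ag Li]; linarith [D.h1]
  have ndn1 : R < nd j h n~ := by
    unfold nd; push_cast; rw [Ag Li]; linarith [D.h1]
  have a0 : ∀ i, 0 ≤ a i := tent_nonneg _ _ _
  have b0 : ∀ i, 0 ≤ b i := tent_nonneg _ _ _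
  have c0 : ∀ i, 0 ≤ c i := tent_nonneg _ _ _
  have a1 : ∀ i, a i ≤ 1 := tent_le_one _ hh Po
  have b1 : ∀ i, b i ≤ 1 := tent_le_one _ hh Po
  have c1 : ∀ i, c i ≤ 1 := tent_le_one _ hh Po
  have hinv : ∀ x : Re, x = 2 ∨ x = 4 ∨ x = 8 → 1 / (R / x) ≤ A := by
    intro x hx
    rw [one_div_div, hA]
    apply Cl _ hR.le
    rcases hx with rfl | rfl | rfl <;> norm_num
  have al : ∀ i, |a i~ - a i| ≤ A * h := tent_lip _ hh Po (hinv 2 Si)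
  have bl : ∀ i, |b i~ - b i| ≤ A * h := tent_lip _ hh Po (hinv 4 Si)
  have cl : ∀ i, |c i~ - c i| ≤ A * h := tent_lip _ hh Po (hinv 8 Si)
  have an : ∀ i, a i ≠ 0 → nd j h i < R / 2 := fun i => tent_ne Po
  have bn : ∀ i, b i ≠ 0 → nd j h i < R / 4 := fun i => tent_ne Po
  have cn : ∀ i, c i ≠ 0 → nd j h i < R / 8 := fun i => tent_ne Po
  have az : ∀ i, R < nd j h i → a i = 0 := fun i hi => by by_contra h0; linarith [an i h0]
  have bz : ∀ i, R < nd j h i → b i = 0 := fun i hi => by by_contra h0; linarith [bn i h0]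
  have cz : ∀ i, R < nd j h i → c i = 0 := fun i hi => by by_contra h0; linarith [cn i h0]
  have aR : ∀ i, a i ≠ 0 → nd j h i ≤ R := fun i hi => by linarith [an i hi]
  have bR : ∀ i, b i ≠ 0 → nd j h i ≤ R := fun i hi => by linarith [bn i hi]
  have aR2 : ∀ i, (a i ≠ 0 ∨ a i~ ≠ 0) → nd j h i ≤ R ∧ nd j h i~ ≤ R := by
    rintro i (hi | hi)
    · exact ⟨by linarith [an _ hi], by linarith [an _ hi, (nds i).2]⟩
    · exact ⟨by linarith [an _ hi, (nds i).1], by linarith [an _ hi]⟩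
  have bR2 : ∀ i, (b i ≠ 0 ∨ b i~ ≠ 0) → nd j h i ≤ 5 / 16 * R ∧ nd j h i~ ≤ 5 / 16 * R := by
    rintro i (hi | hi)
    · exact ⟨by linarith [bn _ hi], by linarith [bn _ hi, (nds i).2]⟩
    · exact ⟨by linarith [bn _ hi, (nds i).1], by linarith [bn _ hi]⟩
  have cR2 : ∀ i, (c i ≠ 0 ∨ c i~ ≠ 0) → nd j h i ≤ 3 / 16 * R ∧ nd j h i~ ≤ 3 / 16 * R := by
    rintro i (hi | hi)
    · exact ⟨by linarith [cn _ hi], by linarith [cn _ hi, (nds i).2]⟩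
    · exact ⟨by linarith [cn _ hi, (nds i).1], by linarith [cn _ hi]⟩
  have a4 : ∀ i, nd j h i ≤ 5 / 16 * R → 1 / 4 ≤ a i := fun i hi => tent_ge Po hi Li
  have b4 : ∀ i, nd j h i ≤ 3 / 16 * R → 1 / 4 ≤ b i := fun i hi => tent_ge Po hi Li
  have b2 : ∀ i, nd j h i ≤ R / 16 → 1 / 2 ≤ b i := fun i hi => tent_ge Po hi Li
  have c2 : ∀ i, nd j h i ≤ R / 16 → 1 / 2 ≤ c i := fun i hi => tent_ge Po hi Li
  set q : Re → ℕ → Re := fun t i => if nd j h i ≤ R then y i t ^ 2 else 0 with hq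
  have q0 : ∀ t i, 0 ≤ q t i := fun t i => by simp only [hq]; split_ifs <;> positivity
  have q00 : ∀ t, q t 0 = 0 := fun t => by simp only [hq]; rw [if_neg (not_le.2 nd0)]
  have qe : ∀ t i, nd j h i ≤ R → q t i = y i t ^ 2 := fun t i hi => by simp only [hq]; rw [if_pos hi]
  set E : Fn := fun t => h * ∑ i ∈ Fr n, a i~ ^ 2 * ao i~ t * y i~ t ^ 2 with hE
  set Ed : Fn := fun t => h * ∑ i ∈ Fr n, a i~ ^ 2 * (aj i~ t * y i~ t ^ 2 +
    2 * (ao i~ t * y i~ t * yd i~ t)) with hEd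
  set H : Fn := fun t => (1 / h) * ∑ i ∈ Fr n, (a i~ * y i~ t - a i * y i t) ^ 2 with hH
  set W : Fn := fun t => (1 / h) * ∑ i ∈ Fr n, b i * b i~ * (y i~ t - y i t) ^ 2 with hW
  set Wd : Fn := fun t => (1 / h) * ∑ i ∈ Fr n, b i * b i~ *
    (2 * (y i~ t - y i t) * (yd i~ t - yd i t)) with hWd
  set P : Fn := fun t => h * ∑ i ∈ Fr n, b i~ ^ 2 * yd i~ t ^ 2 with hP
  have tE : ∀ t ∈ Icc t1 t2, ∀ i, 0 ≤ a i ^ 2 * ao i t * y i t ^ 2 := by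
    intro t ht i
    by_cases h0 : a i = 0
    · simp [h0]
    · have := hl.trans_le (D.bq i (aR i h0) t ht).1; positivity
  have E0 : ∀ t ∈ Icc t1 t2, 0 ≤ E t := fun t ht =>
    Bu hh.le (Bl fun i _ => tE t ht _)
  have H0 : ∀ t, 0 ≤ H t := fun t => Bu Po (Bl fun i _ => Be _)
  have W0 : ∀ t, 0 ≤ W t := fun t => Bu Po (Bl fun i _ =>
    Bu (Bu (b0 _) (b0 _)) (Be _))
  have P0 : ∀ t, 0 ≤ P t := fun t => Bu hh.le (Bl fun i _ => by positivity)
  have G0 : ∀ t ∈ Icc t1 t2, 0 ≤ au t := fun t ht =>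
    (Bu hh.le (Bl fun i _ => q0 t i~)).trans (D.bu t ht)
  have dE : ∀ t ∈ Icc t1 t2, Dv E (Ed t) t := by
    intro t ht
    apply Fe
    apply Eu
    intro i _
    by_cases h0 : a i~ = 0
    · simp [h0, De]
    · have hi := aR _ h0
      exact (((D.dc _ hi t ht).const_mul (a i~ ^ 2)).mul ((D.dy _ hi t ht).pow 2)).congr_deriv
        (by simp; ring)
  have dW : ∀ t ∈ Icc t1 t2, Dv W (Wd t) t := by
    intro t ht
    apply Fe
    apply Eu
    intro i _
    by_cases h0 : b i = 0
    · simp [h0, De]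
    · have hi := bR2 i (Or.inl h0)
      exact ((((D.dy i~ Li t ht).sub (D.dy i Li t ht)).pow 2).const_mul
        (b i * b i~)).congr_deriv Si
  have EG : ∀ t ∈ Icc t1 t2, E t ≤ Lam * au t := by
    intro t ht
    refine le_trans ?_ (Aa (D.bu t ht) hL)
    rw [hE, mul_left_comm, An]
    apply Aa _ hh.le
    apply As
    intro i _
    by_cases h0 : a i~ = 0
    · have := Bu hL (q0 t i~); rw [h0]; simpa only [ne_eq, OfNat.ofNat_ne_zero, not_false_eq_true, zero_pow, zero_mul] using this
    · have hi := aR _ h0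
      rw [if_pos hi]
      apply Ae _ (Be _)
      have := (D.bq _ hi t ht)
      calc a i~ ^ 2 * ao i~ t ≤ 1 * ao i~ t := Ae
            (Dr (a0 _) (a1 _)) Li
        _ ≤ Lam := Li
  obtain ⟨ai, bb, T1⟩ := H1 t1 t2 E Ed H au ap Li D.h2 (fun t ht => ⟨dE t ht, D.ch t ht, D.ck t ht,
    E0 t ht, H0 t, G0 t ht, EG t ht, est1 hh D.hn hB hl a (y · t) (yd · t) (ao · t) (aj · t) (F · t) (q t) (au t)
      a0 a1 (az _ nd0) (az _ ndn) al (q0 t) (q00 t) (fun i hi => ⟨qe t i (aR2 i hi).1, qe t _ (aR2 i hi).2⟩)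
      (D.bu t ht) (fun i hi => (D.bq _ (aR _ hi) t ht).1) (fun i hi => D.de _ (aR _ hi) t ht)
      (fun i hi => D.Fb _ (aR _ hi) t ht) (fun i hi => D.eq _ (aR _ hi) t ht)⟩)
  set p : Re → ℕ → Re := fun t i => if b i ≠ 0 ∨ b i~ ≠ 0 then (y i~ t - y i t) ^ 2 else 0 with hp
  have p0 : ∀ t i, 0 ≤ p t i := fun t i => by simp only [hp]; split_ifs <;> positivity
  have pe : ∀ t i, (b i ≠ 0 ∨ b i~ ≠ 0) → p t i = (y i~ t - y i t) ^ 2 := fun t i hi => by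
    simp only [hp]; rw [if_pos hi]
  have pn : ∀ t, p t n = 0 := fun t => by simp [hp, bz _ ndn, bz _ ndn1]
  have Zb : ∀ t ∈ Icc t1 t2, (1 / h) * ∑ i ∈ Fr n, p t i ≤ 32 * H t + 32 * A ^ 2 * au t := by
    intro t ht
    apply pbound hh a (y · t) (q t) (p t) (au t) al (q0 t) (q00 t) (D.bu t ht)
    intro i hi
    have hbi : b i ≠ 0 ∨ b i~ ≠ 0 := by
      by_contra hcon; exact hi (by simp only [hp]; rw [if_neg hcon])
    obtain ⟨e1, e2⟩ := bR2 i hbi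
    exact ⟨(pe t i hbi).le, a4 _ e2, qe t i Li⟩
  have WH : ∀ t ∈ Icc t1 t2, W t ≤ (32 + 32 * A ^ 2) * (H t + au t) := by
    intro t ht
    have h1 : W t ≤ (1 / h) * ∑ i ∈ Fr n, p t i := by
      apply Aa _ Po
      apply As
      intro i _
      by_cases h0 : b i ≠ 0 ∨ b i~ ≠ 0
      · rw [pe t i h0]
        exact Eg (Be _) (mul_le_one₀ (b1 _) (b0 _) (b1 _))
      · have := p0 t i
        push Not at h0; simp [h0.1, this]
    have := H0 t
    have h3 := G0 t ht
    have h4 : 0 ≤ A ^ 2 * H t := Po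
    linarith [Zb t ht]
  have WD : ∀ t ∈ Icc t1 t2, Wd t ≤ - lam * P t + (4 * B ^ 2 / lam * (1 + 256 / lam) +
      8 * A ^ 2 / lam * (32 + 32 * A ^ 2)) * (1 + au t + H t) * (1 + E t) := by
    intro t ht
    have J := jbound hh D.hn hl a b (y · t) (ao · t) (F · t) b0 b1 (az _ nd0)
      (fun i hi => a4 i (by linarith [bn i hi])) (fun i hi => (D.bq _ (aR _ hi) t ht).1)
      (fun i hi => D.Fb _ (bR _ hi) t ht)
    have := est2 hh hl b (y · t) (yd · t) (ao · t) (F · t) (p t) _ _ (bz _ nd0) (bz _ ndn) bl (p0 t) (pn t)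
      (pe t) (Zb t ht) J (fun i hi => (D.bq _ (bR _ hi) t ht).1) (fun i hi => D.eq _ (bR _ hi) t ht)
    refine this.trans ?_
    have e1 := E0 t ht
    have e2 := H0 t
    have e3 := G0 t ht
    change - lam * P t + 2 / lam * (2 * B ^ 2 * (1 + 256 / lam * H t * E t)) +
      8 * A ^ 2 / lam * (32 * H t + 32 * A ^ 2 * au t) ≤ _
    have m : 0 < 256 / lam := Po
    set k := 256 / lam
    have f1 : 1 + k * H t * E t ≤ (1 + k) * (1 + au t + H t) * (1 + E t) := by
      have : 0 ≤ k * (1 + au t + H t + E t + au t * E t) := Po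
      have : 0 ≤ au t + H t + E t + au t * E t + H t * E t := Po
      linarith
    have f2 : 32 * H t + 32 * A ^ 2 * au t ≤ (32 + 32 * A ^ 2) * (1 + au t + H t) * (1 + E t) := by
      have : 0 ≤ 32 * (1 + au t) + 32 * A ^ 2 * (1 + H t) +
        (32 + 32 * A ^ 2) * (1 + au t + H t) * E t := Po
      linarith
    have g1 := Aa f1 (show 0 ≤ 4 * B ^ 2 / lam by positivity)
    have g2 := Aa f2 (show 0 ≤ 8 * A ^ 2 / lam by positivity)
    linear_combination g1 + g2
  obtain ⟨bg, bh, T2⟩ := H2 t1 t2 E H au ap ai bb W Wd P cm D.h2 (fun t ht => ⟨dW t ht, D.ch t ht,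
    (T1 t ht).2.1, D.ck t ht, (T1 t ht).2.2.2, E0 t ht, H0 t, G0 t ht, W0 t, P0 t, (T1 t ht).1, (T1 t ht).2.2.1,
    WH t ht, WD t ht⟩)
  have sub : Icc (t1 + 2 * ae) t2 ⊆ Icc t1 t2 := Icc_subset_Icc_left Li
  constructor
  · intro i hi t ht
    have hin : i ≤ n := by
      by_contra hcon
      push Not at hcon
      have h5 : (n : Re) ≤ i := Ec hcon.le
      unfold nd at hi ndn
      rw [Ag Li] at hi ndn
      nlinarith [Ae h5 hh.le]
    have := cbound hh D.hn hl a b c (y · t) (ao · t) b0 c0 c1 (cz _ nd0) (az _ nd0) cl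
      (fun i hi => ⟨b4 _ (cR2 i hi).1, b4 _ (cR2 i hi).2, a4 _ (by linarith [(cR2 i hi).1])⟩)
      (fun i hi => (D.bq _ (aR _ hi) t (sub ht)).1) hin
    have hEQ : E t ≤ Q / ae := by
      rw [Ap aq]
      have := Ae (show ae ≤ t - t1 by linarith [ht.1]) (E0 t (sub ht))
      linarith [(T1 t (sub ht)).1]
    have hWC := (T2 t ht).1
    change (c i * y i t) ^ 2 ≤ 32 * W t + 32 * A ^ 2 / lam * E t at this
    have f1 := Aa hEQ (show 0 ≤ 32 * A ^ 2 / lam by positivity)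
    have f2 := Ae (Bm Nn (c2 i hi) 2) (Be (y i t))
    have f3 : y i t ^ 2 ≤ 128 * C + 128 * A ^ 2 / lam * (Q / ae) := by
      linear_combination 4 * f2 + 4 * this + 4 * f1 + 128 * hWC
    set K := 128 * C + 128 * A ^ 2 / lam * (Q / ae) with hK
    apply abs_le_of_sq_le_sq
    · have : 0 ≤ K := (Be _).trans f3
      nlinarith
    · have : 0 ≤ K := (Be _).trans f3
      positivity
  · refine ⟨fun t => 4 * bg t, fun t => 4 * bh t, fun t ht => ⟨(T2 t ht).2.1.const_mul 4, ?_, ?_⟩⟩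
    · rw [abs_mul, Ag (by norm_num : Oo < 4)]
      have := (T2 t ht).2.2.2
      have : 0 ≤ 128 * A ^ 2 / lam * (Q / ae) := Po
      linarith
    · refine le_trans ?_ (Aa (T2 t ht).2.2.1 (by norm_num : Oo ≤ 4))
      rw [hP, mul_left_comm, An _ _ (4:Re)]
      apply Aa _ hh.le
      apply As
      intro i _
      split_ifs with h0
      · have f2 := Ae (Bm Nn (b2 _ h0) 2) (Be (yd i~ t))
        linarith
      · positivity
theorem iter_cont {g : Fn} {O : Set Re} (hO : IsOpen O) (hg : ContDiffOn Re Tt g O) (i : ℕ) :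
    ContDiffOn Re Tt (iteratedDeriv i g) O := by
  induction i with
  | zero => simpa using hg
  | succ i ih =>
    rw [iteratedDeriv_succ]
    exact ih.deriv_of_isOpen hO Si
theorem comp_bd {g : Fn} {O K : Set Re} (hO : IsOpen O) (hg : ContDiffOn Re Tt g O)
    (hK : IsCompact K) (hKO : K ⊆ O) (n : ℕ) : ∃ C : Re, 0 ≤ C ∧ ∀ (z : Fn) (U : Set Re) (t D : Re),
    IsOpen U → t ∈ U → ContDiffOn Re Tt z U → MapsTo z U O → z t ∈ K →
    (∀ i, 1 ≤ i → i ≤ n → |iteratedDeriv i z t| ≤ D ^ i) →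
    ∀ i ≤ n, 0 ≤ D → |iteratedDeriv i (g ∘ z) t| ≤ C * D ^ i := by
  have h1 : ∀ i : ℕ, ∃ A, ∀ x ∈ K, |iteratedDeriv i g x| ≤ A := fun i =>
    hK.exists_bound_of_continuousOn ((iter_cont hO hg i).continuousOn.mono hKO)
  choose A hA using h1
  set B := ∑ i ∈ Fr n~, |A i|
  have hB0 : 0 ≤ B := Bl fun i _ => abs_nonneg _
  have hB : ∀ i ≤ n, ∀ x ∈ K, |iteratedDeriv i g x| ≤ B := fun i hi x hx =>
    (hA i x hx).trans ((Cf _).trans (Finset.single_le_sum (f := fun i => |A i|)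
      (fun i _ => abs_nonneg _) (Ba.2 Om)))
  refine ⟨n.factorial * B, Po, ?_⟩
  intro z U t D hU ht hz hm hzK hD i hi hD0
  have key := norm_iteratedFDerivWithin_comp_le (n := i) (x := t) (C := B) (D := D) hg hz (Ec le_top) hO.uniqueDiffOn
    hU.uniqueDiffOn hm ht (by
      intro m hmi
      rw [iteratedFDerivWithin_of_isOpen m hO (hKO hzK), Dt]
      exact hB m Om _ hzK) (by
      intro m h1m hmi
      rw [iteratedFDerivWithin_of_isOpen m hU ht, Dt]
      exact hD m h1m Om)
  rw [iteratedFDerivWithin_of_isOpen i hU ht, Dt] at key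
  refine key.trans ?_
  have : (i.factorial : Re) ≤ n.factorial := by exact_mod_cast Nat.factorial_le hi
  gcongr
theorem comp_rem {g : Fn} {O K : Set Re} (hO : IsOpen O) (hg : ContDiffOn Re Tt g O)
    (hK : IsCompact K) (hKO : K ⊆ O) {k : ℕ} (hk : 1 ≤ k) {C : Re} (hC : 0 ≤ C) :
    ∃ C' : Re, 0 ≤ C' ∧ ∀ (z : Fn) (U : Set Re) (t : Re),
    IsOpen U → t ∈ U → ContDiffOn Re Tt z U → MapsTo z U O → z t ∈ K →
    (∀ i, 1 ≤ i → i < k → |iteratedDeriv i z t| ≤ C) →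
    |iteratedDeriv k~ (g ∘ z) t - deriv g (z t) * iteratedDeriv k~ z t|
      ≤ C' * (1 + (iteratedDeriv k z t)^2) := by
  have hg1 : ContDiffOn Re Tt (deriv g) O := hg.deriv_of_isOpen hO Si
  obtain ⟨A, hA0, hA⟩ := comp_bd hO hg1 hK hKO k
  set B := ∑ i ∈ Fr k, (k.choose i~ : Re)
  have hB : 0 ≤ B := Bl fun i _ => by positivity
  refine ⟨B * A * ((1+C)^(2*k) * 2), Po, ?_⟩
  intro z U t hU ht hz hm hzK hb
  set y := iteratedDeriv k z t
  obtain ⟨D, hD1, hDk⟩ : ∃ D : Re, 1 + C ≤ D ∧ D ^ k = (1+C)^k * (1+|y|) := by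
    refine ⟨(1+C) * (1+|y|)^(k&⁻¹), ?_, ?_⟩
    · have := Real.one_le_rpow (x := 1+|y|) (z := k&⁻¹) Si Po
      nlinarith
    · rw [mul_pow, Real.rpow_inv_natCast_pow Po Om]
  have hD0 : 0 ≤ D := Li
  have hDm : ∀ i, 1 ≤ i → i ≤ k → |iteratedDeriv i z t| ≤ D ^ i := by
    intro i h1 h2
    rcases h2.lt_or_eq with h | rfl
    · refine (hb i h1 h).trans (le_trans Li (le_self_pow₀ (by linarith : 1 ≤ D) Om))
    · rw [hDk]
      have : 1 ≤ (1+C)^i := one_le_pow₀ Li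
      have h3 : |iteratedDeriv i z t| = |y| := rfl
      rw [h3]; nlinarith [abs_nonneg y]
  have hcz := hA z U t D hU ht hz hm hzK hDm
  have hzt : ContDiffAt Re Tt z t := hz.contDiffAt (hU.mem_nhds ht)
  have hgt : ContDiffAt Re Tt (deriv g) (z t) := hg1.contDiffAt (hO.mem_nhds (hKO hzK))
  have e1 : deriv (g ∘ z) =ᶠ[𝓝 t] (deriv g ∘ z) * deriv z := by
    filter_upwards [hU.mem_nhds ht] with s hs
    have hgd : DifferentiableAt Re g (z s) := (hg.contDiffAt (hO.mem_nhds (hm hs))).differentiableAt Si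
    have hzd : DifferentiableAt Re z s := (hz.contDiffAt (hU.mem_nhds hs)).differentiableAt Si
    simpa using deriv_comp s hgd hzd
  have e2 : iteratedDeriv k~ (g ∘ z) t = ∑ i ∈ Fr k~, (k.choose i : Re) *
      iteratedDeriv i (deriv g ∘ z) t * iteratedDeriv (k - i) (deriv z) t := by
    rw [iteratedDeriv_succ', e1.iteratedDeriv_eq]
    apply iteratedDeriv_mul
    · exact (hgt.comp t hzt).of_le (Ec le_top)
    · exact ((hz.deriv_of_isOpen hU (m := (⊤:ℕ∞)) Si).contDiffAt (hU.mem_nhds ht)).of_le (Ec le_top)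
  rw [e2, Em, Nat.choose_zero_right, iteratedDeriv_zero, Nat.sub_zero, ← iteratedDeriv_succ']
  simp only [Nat.cast_one, one_mul, Function.comp_apply, add_sub_cancel_right]
  refine (Finset.abs_sum_le_sum_abs _ _).trans ?_
  have e3 : ∀ i ∈ Fr k, |(k.choose i~ : Re) * iteratedDeriv i~ (deriv g ∘ z) t *
      iteratedDeriv (k - i~) (deriv z) t| ≤ k.choose i~ * (A * D^(2*k)) := by
    intro i hi
    have hi := Ba.1 hi
    rw [abs_mul, abs_mul, Nat.abs_cast, mul_assoc, ← iteratedDeriv_succ']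
    refine Aa ?_ Po
    refine (Dd (hcz i~ Om hD0) (hDm (k-i~+1) Om Om) (abs_nonneg _) Po).trans ?_
    rw [mul_assoc, ← pow_add]
    gcongr
    · linarith
    · omega
  refine (As e3).trans ?_
  rw [← Finset.sum_mul, mul_assoc, mul_assoc]
  have : D^(2*k) = (1+C)^(2*k) * (1+|y|)^2 := by
    rw [mul_comm 2 k, pow_mul, hDk, pow_mul]; ring
  rw [this]
  have h5 : (1+|y|)^2 ≤ 2 * (1+y^2) := by nlinarith [Be (1-|y|), sq_abs y]
  have h6 : (1+C)^(2*k) * (1+|y|)^2 ≤ (1+C)^(2*k) * (2 * (1+y^2)) := by gcongr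
  calc _ ≤ B * (A * ((1+C)^(2*k) * (2 * (1+y^2)))) := by gcongr
    _ = _ := Rg
theorem PsiData.inv {Ps : Fn} (ab : PsiData Ps) : ∃ G : Fn, IsOpen (Ps '' Ioi 0) ∧
    ContDiffOn Re Tt G (Ps '' Ioi 0) ∧ (∀ v, 0 < v → G (Ps v) = v) ∧
    ∀ v, 0 < v → deriv G (Ps v) = 1 / deriv Ps v := by
  have hinj : InjOn Ps (Ioi 0) := (ab.mono.mono Eo).injOn
  have hs : ∀ v, 0 < v → ContDiffAt Re (⊤:ℕ∞) Ps v := fun v hv => ab.smooth.contDiffAt (Cm hv)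
  have hst : ∀ v, 0 < v → HasStrictDerivAt Ps (deriv Ps v) v := fun v hv =>
    (hs v hv).hasStrictDerivAt Si
  have ho : IsOpen (Ps '' Ioi 0) := by
    rw [isOpen_iff_mem_nhds]
    rintro _ ⟨v, hv, rfl⟩
    rw [← (hst v hv).map_nhds_eq (ab.dpos v hv).ne']
    exact image_mem_map (Cm hv)
  have hG : ∀ v, 0 < v → Function.invFunOn Ps (Ioi 0) (Ps v) = v := fun v hv =>
    hinj.leftInvOn_invFunOn hv
  have hc : ContDiffOn Re Tt (Function.invFunOn Ps (Ioi 0)) (Ps '' Ioi 0) := by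
    rintro _ ⟨v, hv, rfl⟩
    have hd := (hst v hv).hasStrictFDerivAt_equiv (ab.dpos v hv).ne'
    have h1 := (hs v hv).to_localInverse hd.hasFDerivAt Si
    refine (h1.congr_of_eventuallyEq ?_).contDiffWithinAt
    have h2 := (hs v hv).hasStrictFDerivAt' hd.hasFDerivAt Si
    have h3 : ∀ᶠ y in 𝓝 (Ps v), (h2.localInverse Ps _ v) y ∈ Ioi 0 := by
      have := h2.localInverse_continuousAt
      exact this.eventually (by rw [h2.localInverse_apply_image]; exact Cm hv)
    filter_upwards [h2.eventually_right_inverse, h3] with y hy hy2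
    have := hG _ hy2
    rw [hy] at this
    exact this
  refine ⟨_, ho, hc, hG, fun v hv => ?_⟩
  have h1 : Dv (Function.invFunOn Ps (Ioi 0)) (deriv (Function.invFunOn Ps (Ioi 0)) (Ps v)) (Ps v) :=
    ((hc.contDiffAt (ho.mem_nhds ⟨v, hv, rfl⟩)).differentiableAt Si).hasDerivAt
  have h2 := h1.comp v (ab.hasDerivAt hv)
  have h3 : Dv (Function.invFunOn Ps (Ioi 0) ∘ Ps) 1 v := by
    refine (Af v).congr_of_eventuallyEq ?_
    filter_upwards [Cm hv] with w hw using hG w hw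
  have := h2.unique h3
  field_simp [(ab.dpos v hv).ne']
  linarith
theorem iter_lin {f g h : Fn} {U : Set Re} (hU : IsOpen U) (hf : ContDiffOn Re Tt f U)
    (hg : ContDiffOn Re Tt g U) (hh : ContDiffOn Re Tt h U) (c : Re) (k : ℕ) : ∀ t ∈ U,
    iteratedDeriv k (fun t => c * (f t - 2 * g t + h t)) t =
      c * (iteratedDeriv k f t - 2 * iteratedDeriv k g t + iteratedDeriv k h t) := by
  induction k with
  | zero => simp
  | succ k ih =>
    intro t ht
    have e : iteratedDeriv k (fun t => c * (f t - 2 * g t + h t)) =ᶠ[𝓝 t] fun t =>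
      c * (iteratedDeriv k f t - 2 * iteratedDeriv k g t + iteratedDeriv k h t) := by
      filter_upwards [hU.mem_nhds ht] with s hs using ih s hs
    rw [iteratedDeriv_succ, e.deriv_eq, iteratedDeriv_succ, iteratedDeriv_succ, iteratedDeriv_succ]
    have d : ∀ {f : Fn}, ContDiffOn Re Tt f U → Dv (iteratedDeriv k f) (deriv (iteratedDeriv k f) t) t :=
      fun hf => (((iter_cont hU hf k).contDiffAt (hU.mem_nhds ht)).differentiableAt Si).hasDerivAt
    exact ((((d hf).sub ((d hg).const_mul 2)).add (d hh)).const_mul c).deriv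
noncomputable def Yk (Ps : Fn) (v : ℕ → Fn) (k i : ℕ) (t : Re) : Re := iteratedDeriv k (fun t => Ps (v i t)) t
section
variable {Ps : Fn} {n : ℕ} {K ac M b0 b1 : Re} {s : ℕ → Re} {S v : ℕ → Fn}
theorem DSol.zsmooth (h : DSol Ps n K ac M b0 b1 s S v) (ab : PsiData Ps) (af : 0 < ac) :
    ∀ i ≤ n, ContDiffOn Re Tt (fun t => Ps (v i t)) (Ioo 0 2) := fun i hi =>
  ab.smooth.comp (h.smooth ab af i hi) fun t ht => af.trans_le (h.mem i hi t ⟨ht.1.le, ht.2.le⟩).1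
theorem DSol.dYk (h : DSol Ps n K ac M b0 b1 s S v) (ab : PsiData Ps) (af : 0 < ac) (k : ℕ) {i : ℕ} (hi : i ≤ n)
    {t : Re} (ht : t ∈ Jo) : Dv (Yk Ps v k i) (Yk Ps v k~ i t) t := by
  have := (((iter_cont Cn (h.zsmooth ab af i hi) k).contDiffAt (Bk ht.1 ht.2)).differentiableAt
    Si).hasDerivAt
  unfold Yk
  rw [iteratedDeriv_succ]
  exact this
theorem DSol.dVk (h : DSol Ps n K ac M b0 b1 s S v) (ab : PsiData Ps) (af : 0 < ac) (k : ℕ) {i : ℕ} (hi : i + 1 < n)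
    {t : Re} (ht : t ∈ Jo) : iteratedDeriv k~ (v i~) t =
      K * (Yk Ps v k i~~ t - 2 * Yk Ps v k i~ t + Yk Ps v k i t) := by
  have e : deriv (v i~) =ᶠ[𝓝 t] fun t => K * (Ps (v i~~ t) - 2 * Ps (v i~ t) + Ps (v i t)) := by
    filter_upwards [Bk ht.1 ht.2] with s hs using (h.dv i hi s hs).deriv
  rw [iteratedDeriv_succ', e.iteratedDeriv_eq]
  exact iter_lin Cn (h.zsmooth ab af _ Om) (h.zsmooth ab af _ Om)
    (h.zsmooth ab af _ Om) K k t ht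
end
structure RD (Ps : Fn) (M R ah t0 : Re) (N : ℕ) (ac : Re) (s : ℕ → Re) (S v : ℕ → Fn) (j : ℕ) (t1 t2 : Re) : Prop where
  sol : DSol Ps N (N ^ 2 : Re) ac M ac ac s S v
  af : 0 < ac
  bc : ac ≤ M
  hN : 0 < N
  h0 : R < j * (1 / N)
  h1 : j * (1 / N) + R < 1
  ht1 : t0 ≤ t1
  ht2 : t2 < 2
  low : ∀ i, nd j (1 / N) i ≤ R → ∀ t ∈ Icc t1 t2, ah ≤ v i t
theorem RD.lt {Ps M R ah t0 N ac s S v j t1 t2} (D : RD Ps M R ah t0 N ac s S v j t1 t2) {i : ℕ} (hi : nd j (1 / N) i ≤ R) :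
    0 < i ∧ i < N := by
  have hN : Oo < N := Ec D.hN
  have h1 := D.h1
  have h0 := D.h0
  have e : nd j (1 / N) i = |i * (1/N&) - j * (1/N&)| := by
    rw [nd, ← sub_mul, abs_mul, Ag (by positivity : 0 < 1/N&)]
  rw [e, Ar] at hi
  have h2 : 0 < i * (1/N&) := Li
  have h3 : i * (1/N&) < 1 := Li
  constructor
  · by_contra hc
    have : i = 0 := Om
    simp [this] at h2
  · rw [mul_one_div, div_lt_one hN] at h3
    exact_mod_cast h3
theorem regAll {Ps : Fn} (ab : PsiData Ps) {M R ah t0 ae : Re} (hM : 0 < M) (hR : 0 < R) (ay : 0 < ah) (ht0 : 0 < t0) (aq : 0 < ae)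
    (k : ℕ) : ∃ C : Re, 0 ≤ C ∧ ∀ N ac s S v j t1 t2, RD Ps M R ah t0 N ac s S v j t1 t2 →
      1 / N& ≤ R / 16 ^ k → t1 + 2 * k * ae ≤ t2 →
      (∀ m, 1 ≤ m → m ≤ k → ∀ i, nd j (1/N) i ≤ R / 16 ^ k → ∀ t ∈ Icc (t1 + 2 * k * ae) t2, |Yk Ps v m i t| ≤ C) ∧
      ∃ ap au : Fn, ∀ t ∈ Icc (t1 + 2 * k * ae) t2, Dv ap (au t) t ∧ |ap t| ≤ C ∧
        (1/N&) * ∑ i ∈ Fr N, (if nd j (1/N) i~ ≤ R / 16 ^ k then Yk Ps v k~ i~ t ^ 2 else 0) ≤ au t := by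
  obtain ⟨G, hO, hG, hGi, hGd⟩ := ab.inv
  set O := Ps '' Ioi 0
  set KK := Ps '' Icc ah M
  have hpos : Icc ah M ⊆ Ioi 0 := fun x hx => ay.trans_le hx.1
  have hKc : IsCompact KK := isCompact_Icc.image_of_continuousOn (ab.cont.mono (hpos.trans Eo))
  have hKO : KK ⊆ O := image_mono hpos
  have hG1 : ContDiffOn Re Tt (deriv G) O := hG.deriv_of_isOpen hO Si
  have hG2 : ContDiffOn Re Tt (deriv (deriv G)) O := hG1.deriv_of_isOpen hO Si
  have hG1p : ∀ x ∈ O, 0 < deriv G x := by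
    rintro _ ⟨v, hv, rfl⟩
    rw [hGd v hv]; exact Ct.2 (ab.dpos v hv)
  obtain ⟨Lam, hLam⟩ := hKc.exists_bound_of_continuousOn (hG1.continuousOn.mono hKO)
  obtain ⟨B1, hB1⟩ := hKc.exists_bound_of_continuousOn (hG2.continuousOn.mono hKO)
  obtain ⟨A, hA⟩ := hKc.exists_bound_of_continuousOn ((hG1.continuousOn.mono hKO).inv₀ fun x hx => (hG1p x (hKO hx)).ne')
  simp only [Bd] at hLam hB1 hA
  set lam := 1 / (|A| + 1) with hlam
  have hl : 0 < lam := Po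
  have hlow : ∀ x ∈ KK, lam ≤ deriv G x := by
    intro x hx
    have h1 := hA x hx
    have hp := hG1p x (hKO hx)
    rw [Pi.inv_apply, Ag (inv_pos.2 hp), inv_le_comm₀ hp (lt_of_lt_of_le (inv_pos.2 hp) (by simpa [Ag hp] using h1))] at h1
    refine le_trans ?_ h1
    rw [hlam, one_div]
    apply inv_anti₀
    · have := hA x hx
      rw [Pi.inv_apply, Ag (inv_pos.2 hp)] at this
      exact lt_of_lt_of_le (inv_pos.2 hp) this
    · linarith [Cf A]
  induction k with
  | zero =>
    refine ⟨1 / (2 * lam) * (M * Ps M / t0), by have := ab.nonneg hM.le; positivity, ?_⟩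
    intro N ac s S v j t1 t2 D _ h12
    have hN : Oo < N := Ec D.hN
    simp only [CharP.cast_eq_zero, mul_zero, zero_mul, add_zero, pow_zero, div_one]
    have htt : ∀ t ∈ Icc t1 t2, t0 ≤ t ∧ t ∈ Jo := fun t ht =>
      ⟨D.ht1.trans ht.1, by linarith [D.ht1, ht.1], lt_of_le_of_lt ht.2 D.ht2⟩
    refine ⟨fun m h1 h2 => Om, fun t => -(1 / (2 * lam)) * en Ps N v t, _, fun t ht =>
      ⟨(D.sol.den ab D.af D.hN t (htt t ht).2).const_mul _, ?_, ?_⟩⟩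
    · obtain ⟨h1, h2⟩ := htt t ht
      have h3 := D.sol.en_le ab D.af D.hN D.bc t ⟨h2.1.le, h2.2.le⟩
      have h4 : 0 ≤ en Ps N v t := Bu Po (Bl fun i _ => Be _)
      rw [abs_mul, abs_neg, Ag (by positivity : 0 < 1 / (2 * lam)), Ak h4]
      gcongr
      rw [Ap ht0]
      nlinarith
    · have e : -(1 / (2 * lam)) * (-(2 / N&) * ∑ i ∈ Fr N, deriv Ps (v i~ t) * deriv (v i~) t ^ 2)
        = 1 / N * ∑ i ∈ Fr N, 1 / lam * (deriv Ps (v i~ t) * deriv (v i~) t ^ 2) := by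
        rw [← An]; field_simp
      rw [e]
      gcongr with i hi
      obtain ⟨h1, h2⟩ := htt t ht
      have hi := Ba.1 hi
      have hvp := D.af.trans_le (D.sol.mem i~ Om t ⟨h2.1.le, h2.2.le⟩).1
      have hdp := ab.dpos _ hvp
      split_ifs with hc
      · have hK1 : Ps (v i~ t) ∈ KK := ⟨_, ⟨D.low _ hc t ht, (D.sol.mem i~ Om t ⟨h2.1.le, h2.2.le⟩).2⟩, rfl⟩
        have h5 := hlow _ hK1
        rw [hGd _ hvp, Ap hdp] at h5
        have h6 : Yk Ps v (0+1) i~ t = deriv Ps (v i~ t) * deriv (v i~) t := by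
          unfold Yk; rw [zero_add, iteratedDeriv_one]
          exact (D.sol.dz ab D.af i~ Om t h2).deriv
        have h7 : deriv Ps (v i~ t) ≤ 1 / lam := by rw [Ap hl]; linarith
        rw [h6, mul_pow, sq (deriv Ps _), mul_assoc]
        gcongr
      · positivity
  | succ k ih =>
    obtain ⟨C, hC, ih⟩ := ih
    obtain ⟨C1, hC1, hrem⟩ := comp_rem hO hG hKc hKO (k := k+1) Om hC
    set B := |B1| * (1 + C) + C1 + C with hB
    obtain ⟨C2, hC2, hreg⟩ := regStep (R := R / 16^k) (lam := lam) (Lam := |Lam|) (B := B) (ae := ae) Po hl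
      (abs_nonneg _) Po aq
    refine ⟨C + C2, Po, ?_⟩
    intro N ac s S v j t1 t2 D hN16 h12
    have hNp : Oo < N := Ec D.hN
    push_cast at h12
    have hk16 : R / 16 ^ k~ = R / 16 ^ k / 16 := by rw [pow_succ]; field_simp
    have hkR : R / 16 ^ k ≤ R := div_le_self hR.le (one_le_pow₀ Nn)
    obtain ⟨hm, ap, au, bj⟩ := ih N ac s S v j t1 t2 D (hN16.trans (by rw [hk16]; linarith [show 0 < R/16^k by positivity])) (by nlinarith)
    have htt : ∀ t ∈ Icc (t1 + 2 * k * ae) t2, t ∈ Icc t1 t2 ∧ t ∈ Jo := by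
      intro t ht
      have h1 : t1 ≤ t := le_trans (by have : Oo ≤ 2 * k * ae := Po
                                       linarith) ht.1
      exact ⟨⟨h1, ht.2⟩, Lx D.ht1, lt_of_le_of_lt ht.2 D.ht2⟩
    have hzK : ∀ i, nd j (1/N) i ≤ R / 16^k → ∀ t ∈ Icc (t1 + 2 * k * ae) t2, Ps (v i t) ∈ KK := by
      intro i hi t ht
      obtain ⟨h1, h2⟩ := htt t ht
      exact ⟨v i t, ⟨D.low i (hi.trans hkR) t h1, (D.sol.mem i (D.lt (hi.trans hkR)).2.le t ⟨h2.1.le, h2.2.le⟩).2⟩, rfl⟩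
    have hmaps : ∀ i ≤ N, MapsTo (fun t => Ps (v i t)) (Ioo 0 2) O := fun i hi t ht =>
      ⟨v i t, D.af.trans_le (D.sol.mem i hi t ⟨ht.1.le, ht.2.le⟩).1, rfl⟩
    have hv : ∀ i ≤ N, ∀ t ∈ Jo, G (Ps (v i t)) = v i t := fun i hi t ht =>
      hGi _ (D.af.trans_le (D.sol.mem i hi t ⟨ht.1.le, ht.2.le⟩).1)
    have hr := hreg N (1/N) j (t1 + 2 * k * ae) t2 (Yk Ps v k~) (Yk Ps v k~~) (fun i t => deriv G (Ps (v i t)))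
      (fun i t => deriv (deriv G) (Ps (v i t)) * Yk Ps v 1 i t)
      (fun i t => deriv G (Ps (v i t)) * Yk Ps v k~~ i t - iteratedDeriv k~~ (G ∘ fun t => Ps (v i t)) t) ap au
      Li (by
      constructor
      · positivity
      · field_simp; exact Ad
      · rw [← hk16]; exact hN16
      · exact hkR.trans_lt D.h0
      · rw [mul_one_div_cancel hNp.ne']; linarith [D.h1]
      · have := D.ht1
        have := D.ht2
        have : Oo ≤ 2 * k * ae := Po
        linarith
      · intro i hi t ht
        exact D.sol.dYk ab D.af k~ (D.lt (hi.trans hkR)).2.le (htt t ht).2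
      · intro i hi t ht
        have h1 := D.sol.dYk ab D.af 0 (D.lt (hi.trans hkR)).2.le (htt t ht).2
        have h2 : Dv (deriv G) (deriv (deriv G) (Ps (v i t))) (Ps (v i t)) :=
          ((hG1.contDiffAt (hO.mem_nhds (hKO (hzK i hi t ht)))).differentiableAt Si).hasDerivAt
        have e : Yk Ps v 0 i = fun t => Ps (v i t) := by unfold Yk; ext; simp
        rw [e] at h1
        exact h2.comp t h1
      · intro i hi t ht
        have h1 := hzK i hi t ht
        exact ⟨hlow _ h1, (Cf _).trans ((hLam _ h1).trans (Cf _))⟩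
      · intro i hi t ht
        obtain ⟨h1, h2⟩ := D.lt (hi.trans hkR)
        have e : iteratedDeriv k~~ (G ∘ fun t => Ps (v i~ t)) t = iteratedDeriv k~~ (v i~) t := by
          apply EventuallyEq.iteratedDeriv_eq
          filter_upwards [Bk (htt t ht).2.1 (htt t ht).2.2] with s hs using hv _ h2.le s hs
        have e2 := D.sol.dVk ab D.af k~ h2 (htt t ht).2
        rw [e, e2]
        field_simp
        ring
      · intro i hi t ht
        have hb := hB1 _ (hzK i hi t ht)
        have hY : |Yk Ps v 1 i t| ≤ (1 + C) * (1 + |Yk Ps v k~ i t|) := by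
          rcases Dn k with h0 | h0
          · subst h0
            nlinarith [abs_nonneg (Yk Ps v (0+1) i t)]
          · have := hm 1 Ad h0 i hi t ht
            nlinarith [abs_nonneg (Yk Ps v k~ i t)]
        rw [abs_mul]
        calc _ ≤ |B1| * ((1 + C) * (1 + |Yk Ps v k~ i t|)) := by
              exact Dd (hb.trans (Cf _)) hY (abs_nonneg _) (abs_nonneg _)
          _ ≤ _ := by rw [← mul_assoc]; gcongr; rw [hB]; linarith
      · intro i hi t ht
        have hiN := (D.lt (hi.trans hkR)).2.le
        have := hrem (fun t => Ps (v i t)) (Ioo 0 2) t Cn (htt t ht).2 (D.sol.zsmooth ab D.af i hiN) (hmaps i hiN)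
          (hzK i hi t ht) (fun m h1 h2 => hm m h1 Om i hi t ht)
        rw [Br]
        refine this.trans ?_
        change _ ≤ B * (1 + (iteratedDeriv k~ (fun t => Ps (v i t)) t) ^ 2)
        gcongr
        rw [hB]; have : 0 ≤ |B1| * (1 + C) := Po
        linarith
      · exact fun t ht => (bj t ht).1
      · exact fun t ht => (bj t ht).2.1.trans (by rw [hB]; have : 0 ≤ |B1| * (1 + C) := Po
                                                  linarith)
      · exact fun t ht => (bj t ht).2.2)
    have et : t1 + 2 * ((k + 1 : ℕ):Re) * ae = t1 + 2 * k * ae + 2 * ae := by push_cast; ring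
    rw [et, hk16]
    refine ⟨?_, ?_⟩
    · intro m h1 h2 i hi t ht
      rcases Cb k m with h | h
      · have : m = k+1 := Om
        subst this
        exact (hr.1 i hi t ht).trans Li
      · exact (hm m h1 h i (hi.trans (by linarith [show 0 < R/16^k by positivity])) t ⟨by linarith [ht.1], ht.2⟩).trans Li
    · obtain ⟨bg, bh, h⟩ := hr.2
      exact ⟨bg, bh, fun t ht => ⟨(h t ht).1, (h t ht).2.1.trans Li, (h t ht).2.2⟩⟩
theorem PsiData.modulus {Ps : Fn} (ab : PsiData Ps) {M tol : Re} (hM : 0 ≤ M) (ht : 0 < tol) :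
    ∃ bk > 0, ∀ a ∈ Icc 0 M, ∀ b ∈ Icc 0 M, |Ps a - Ps b| < bk → |a - b| < tol := by
  have hc : Co (fun a => Ps (a + tol) - Ps a) (Icc 0 M) := by
    apply ContinuousOn.sub
    · exact ab.cont.comp Fu fun a ha => by simp only [mem_Ici]; linarith [ha.1]
    · exact ab.cont.mono fun a ha => ha.1
  obtain ⟨a0, ha0, hmin⟩ := isCompact_Icc.exists_isMinOn ⟨0, Cd.2 hM⟩ hc
  refine ⟨Ps (a0 + tol) - Ps a0, sub_pos.2 (ab.mono ha0.1 (by simp only [mem_Ici]; linarith [ha0.1]) Li), ?_⟩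
  have key : ∀ a ∈ Icc 0 M, ∀ b ∈ Icc 0 M, a + tol ≤ b → Ps (a0 + tol) - Ps a0 ≤ Ps b - Ps a := by
    intro a ha b hb hab
    have h1 := isMinOn_iff.1 hmin a ha
    have h2 := ab.monoOn (Lx ha.1) hab
    linarith
  intro a ha b hb h
  by_contra hc
  rw [not_lt] at hc
  rcases le_abs'.1 hc with h1 | h1
  · have := key a ha b hb Li
    linarith [abs_lt.1 h]
  · have := key b hb a ha Li
    linarith [abs_lt.1 h]
theorem window {f : ℕ → Re} {c e : Re} {m : ℕ} (h0 : f 0 = 0) (h1 : f 1 ≤ c + e)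
    (h2 : ∀ l, l + 2 ≤ m → f l~~ - 2 * f l~ + f l ≤ 2 * (c + e)) : ∀ l, l + 1 ≤ m →
    f l~ - f l ≤ (2 * l + 1) * (c + e) ∧ f l~ ≤ l~^2 * (c + e) := by
  intro l
  induction l with
  | zero => intro _; simp [h0, h1]
  | succ l ih =>
    intro hl
    obtain ⟨i1, i2⟩ := ih Om
    have := h2 l hl
    push_cast
    constructor
    · linarith
    · nlinarith
section
variable {Ps : Fn} {N : ℕ} {ac M : Re} {s : ℕ → Re} {S v : ℕ → Fn}
theorem DSol.window (h : DSol Ps N (N ^ 2 : Re) ac M ac ac s S v) (hN : 0 < N) {t tol : Re} {i m : ℕ} (hm : 1 ≤ m)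
    (h1 : m ≤ i) (h2 : i + m ≤ N) (hv : ∀ k, i ≤ k + m → k ≤ i + m → |v k t - v i t| ≤ tol) :
    |N&^2 * (S (i+m) t - 2 * S i t + S (i-m) t) - m^2 * v i t| ≤ m^2 * tol := by
  have hNp : Oo < N := Ec hN
  set f : ℕ → Re := fun l => N&^2 * (S (i+l) t - 2 * S i t + S (i-l) t) with hf
  have f0 : f 0 = 0 := by simp [hf]; right; ring
  have vS : ∀ k, 1 ≤ k → k < N → v k t = N&^2 * (S k~ t - 2 * S k t + S (k-1) t) := by
    intro k hk1 hk2
    obtain ⟨k, rfl⟩ := Nat.exists_eq_add_of_le' hk1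
    exact h.vS k hk2 t
  have f1 : f 1 = v i t := by rw [vS i Om Om]
  have f2 : ∀ l, l + 2 ≤ m → f l~~ - 2 * f l~ + f l = v (i + l~) t + v (i - l~) t := by
    intro l hl
    rw [vS (i+l~) Om Om, vS (i-l~) Om Om]
    have e1 : i - l~ + 1 = i - l := Om
    have e2 : i - l~ - 1 = i - l~~ := Om
    have e3 : i + l~ + 1 = i + l~~ := Om
    have e4 : i + l~ - 1 = i + l := Om
    simp only [hf, e1, e2, e3, e4]
    ring
  have hb : ∀ l, l + 2 ≤ m → |v (i + l~) t + v (i - l~) t - 2 * v i t| ≤ 2 * tol := by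
    intro l hl
    have a1 := Ar.1 (hv (i+l~) Om Om)
    have a2 := Ar.1 (hv (i-l~) Om Om)
    rw [Ar]; constructor <;> linarith
  have ht : 0 ≤ tol := (abs_nonneg _).trans (hv i Om Om)
  obtain ⟨l, rfl⟩ := Nat.exists_eq_add_of_le' hm
  have up := (_root_.window (m := l+1) (c := v i t) (e := tol) f0 (by rw [f1]; linarith) (fun k hk => by
    rw [f2 k hk]; linarith [Ar.1 (hb k hk)]) l Ad).2
  have lo := (_root_.window (f := fun l => - f l) (m := l+1) (c := - v i t) (e := tol) (by simp [f0]) (by rw [f1]; linarith) (fun k hk => by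
    have := f2 k hk
    linarith [Ar.1 (hb k hk)]) l Ad).2
  push_cast
  have e : N&^2 * (S (i+l~) t - 2 * S i t + S (i-l~) t) = f l~ := rfl
  rw [e, Ar]
  constructor <;> linarith
end
theorem DSol.sp {Ps : Fn} (ab : PsiData Ps) {M t0 tol : Re} (hM : 0 < M) (ht0 : 0 < t0) (htol : 0 < tol) :
    ∃ ad : Re, 0 < ad ∧ ∀ (N : ℕ) ac s S v, DSol Ps N (N ^ 2 : Re) ac M ac ac s S v → 0 < ac → ac ≤ M → 0 < N →
    ∀ i ≤ N, ∀ j ≤ N, |i& - j| ≤ ad * N& → ∀ t ∈ Icc t0 2, |v i t - v j t| < tol := by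
  obtain ⟨bk, ca, hmod⟩ := ab.modulus hM.le htol
  have hP := ab.pos hM
  refine ⟨t0 * bk^2 / (2 * (M * Ps M)), Po, ?_⟩
  intro N ac s S v D af bc hN
  have hNp : Oo < N := Ec hN
  have key : ∀ i j, i ≤ j → j ≤ N → |i& - j| ≤ t0 * bk^2 / (2 * (M * Ps M)) * N → ∀ t ∈ Icc t0 2, |v i t - v j t| < tol := by
    intro i j hij hj hd t ht
    have htI : t ∈ Jc := ⟨Lx ht.1, ht.2⟩
    have h1 := D.holder ab af hN bc htI hij hj
    have hij' : i& ≤ j := Ec hij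
    rw [abs_of_nonpos Li] at hd
    have h2 : (j& - i) / N * (M * Ps M) ≤ t0 * bk^2 / 2 := by
      calc _ ≤ (t0 * bk^2 / (2 * (M * Ps M)) * N) / N * (M * Ps M) := by gcongr; linarith
        _ = _ := by field_simp
    have h3 : (Ps (v j t) - Ps (v i t))^2 < bk^2 := by
      have : t0 * (Ps (v j t) - Ps (v i t))^2 ≤ t0 * (bk^2/2) :=
        le_trans (by gcongr; exact ht.1) (h1.trans (h2.trans_eq Rg))
      have := Ca this ht0
      nlinarith
    have h4 := abs_lt_of_sq_lt_sq h3 ca.le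
    have m1 := D.mem i (hij.trans hj) t htI
    have m2 := D.mem j hj t htI
    exact hmod _ ⟨af.le.trans m1.1, m1.2⟩ _ ⟨af.le.trans m2.1, m2.2⟩ (by rw [Br]; exact h4)
  intro i hi j hj hd t ht
  rcases Er i j with h | h
  · exact key i j h hj hd t ht
  · rw [Br]; exact key j i h hi (by rwa [Br]) t ht
theorem DSol.S_lip {Ps : Fn} (ab : PsiData Ps) {N : ℕ} {K ac M b0 b1 : Re} {s : ℕ → Re} {S v : ℕ → Fn}
    (D : DSol Ps N K ac M b0 b1 s S v) (af : 0 < ac) {i : ℕ} (hi : i ≤ N) {t t' : Re} (ht : t ∈ Jc) (ht' : t' ∈ Jc)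
    (htt : t ≤ t') : 0 ≤ S i t' - S i t ∧ S i t' - S i t ≤ Ps M * (t' - t) := by
  have hsub : Icc t t' ⊆ Icc 0 2 := Icc_subset_Icc ht.1 ht'.2
  have hsub2 : Ioo t t' ⊆ Ioo 0 2 := Ioo_subset_Ioo ht.1 ht'.2
  have hz : ∀ r ∈ Ioo t t', 0 ≤ Ps (v i r) ∧ Ps (v i r) ≤ Ps M := fun r hr => by
    have := D.mem i hi r (hsub (Ai hr))
    exact ⟨ab.nonneg (af.le.trans this.1), ab.monoOn (af.le.trans this.1) this.2⟩
  have a1 : AntitoneOn (fun r => - S i r) (Icc t t') := anti_hd ((D.cS i hi).mono hsub).neg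
    (fun r hr => (D.dS i hi r (hsub2 hr)).neg) (fun r hr => by linarith [(hz r hr).1])
  have a2 : AntitoneOn (fun r => S i r - Ps M * r) (Icc t t') := anti_hd (((D.cS i hi).mono hsub).sub Fu)
    (fun r hr => (D.dS i hi r (hsub2 hr)).sub ((Af r).const_mul (Ps M))) (fun r hr => by linarith [(hz r hr).2])
  have b1 := a1 (Cd.2 htt) (Ef.2 htt) htt
  have b2 := a2 (Cd.2 htt) (Ef.2 htt) htt
  simp only at b1 b2
  constructor <;> linarith
theorem DSol.equi {Ps : Fn} (ab : PsiData Ps) {M t0 tol : Re} (hM : 0 < M) (ht0 : 0 < t0) (htol : 0 < tol) :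
    ∃ ad : Re, 0 < ad ∧ ∀ (N : ℕ) ac s S v, DSol Ps N (N ^ 2 : Re) ac M ac ac s S v → 0 < ac → ac ≤ M → 1 ≤ ad * N& →
    ∀ i ≤ N, ∀ j ≤ N, |i& - j| ≤ ad * N& → ∀ t ∈ Icc t0 2, ∀ t' ∈ Icc t0 2, |t - t'| ≤ ad → |v i t - v j t'| < tol := by
  obtain ⟨ad, ak, hsp⟩ := DSol.sp ab hM ht0 (tol := tol / 8) Po
  set av := min ad (1/4) with df
  have di : 0 < av := Po
  have hP := ab.pos hM
  set br := min (av/2) (tol * av^2 / (64 * Ps M)) with dj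
  have dg : 0 < br := Po
  refine ⟨br, dg, ?_⟩
  intro N ac s S v D af bc hN
  have hNp' : 0 < N := by
    rcases Dn N with h | h
    · subst h; norm_num at hN
    · exact h
  have hNp : Oo < N := Ec hNp'
  have hsp := hsp N ac s S v D af bc hNp'
  have hd1 : av ≤ 1/4 := Al _ _
  have hd1' : av ≤ ad := Am _ _
  have hd2 : br ≤ av/2 := Am _ _
  have hd3 : br ≤ tol * av^2 / (64 * Ps M) := Al _ _
  set m := ⌊av * N⌋₊ with hm
  have hm1 : m& ≤ av * N := Nat.floor_le Po
  have hm2 : av * N / 2 ≤ m := by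
    have := Nat.lt_floor_add_one (av * N)
    have h2 : 2 ≤ av * N := by nlinarith
    linarith
  have hm0 : 1 ≤ m := Nat.one_le_floor_iff _ |>.2 (by nlinarith)
  have hmN : 4 * m ≤ N := by
    have : (4 * m : Re) ≤ N := by nlinarith
    exact_mod_cast this
  have key : ∀ i, m ≤ i → i + m ≤ N → ∀ t ∈ Icc t0 2, ∀ t' ∈ Icc t0 2, t ≤ t' → t' - t ≤ br →
      |v i t - v i t'| ≤ 3 * tol / 8 := by
    intro i h1 h2 t ht t' ht' htt hd
    have hI : ∀ {r}, r ∈ Icc t0 2 → r ∈ Jc := fun hr => ⟨Lx hr.1, hr.2⟩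
    have W : ∀ r ∈ Icc t0 2, |N&^2 * (S (i+m) r - 2 * S i r + S (i-m) r) - m^2 * v i r| ≤ m^2 * (tol/8) := by
      intro r hr
      apply D.window hNp' hm0 h1 h2
      intro k hk1 hk2
      refine (hsp k Om i Om ?_ r hr).le
      refine le_trans ?_ (hm1.trans (by gcongr))
      have a1 : i& ≤ k + m := Ec hk1
      have a2 : k& ≤ i + m := Ec hk2
      rw [Ar]; constructor <;> linarith
    have w1 := Ar.1 (W t ht)
    have w2 := Ar.1 (W t' ht')
    have s1 := D.S_lip ab af (i := i+m) h2 (hI ht) (hI ht') htt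
    have s2 := D.S_lip ab af (i := i) Om (hI ht) (hI ht') htt
    have s3 := D.S_lip ab af (i := i-m) Om (hI ht) (hI ht') htt
    have hq : N&^2 * (2 * (Ps M * (t' - t))) ≤ m^2 * (tol / 8) := by
      have h5 : Ps M * (t' - t) ≤ tol * av^2 / 64 := by
        calc Ps M * (t' - t) ≤ Ps M * (tol * av^2 / (64 * Ps M)) := by gcongr; linarith
          _ = _ := by field_simp
      have h6 : (av * N / 2)^2 ≤ m&^2 := by gcongr
      calc N&^2 * (2 * (Ps M * (t' - t))) ≤ N&^2 * (2 * (tol * av^2 / 64)) := by gcongr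
        _ = (av * N / 2)^2 * (tol / 8) := Rg
        _ ≤ _ := by gcongr
    have hmp : Oo < m&^2 := Po
    have n1 : N&^2 * ((S (i+m) t' - S (i+m) t) + (S (i-m) t' - S (i-m) t)) ≤ N&^2 * (2 * (Ps M * (t' - t))) := by
      gcongr; linarith
    have n2 : N&^2 * (2 * (S i t' - S i t)) ≤ N&^2 * (2 * (Ps M * (t' - t))) := by gcongr; linarith
    have n3 : 0 ≤ N&^2 * ((S (i+m) t' - S (i+m) t) + (S (i-m) t' - S (i-m) t)) := Bu Po Li
    have n4 : 0 ≤ N&^2 * (2 * (S i t' - S i t)) := Bu Po Li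
    have c1 : m&^2 * (v i t - v i t') ≤ m^2 * (3 * tol / 8) := Li
    have c2 : m&^2 * (v i t' - v i t) ≤ m^2 * (3 * tol / 8) := Li
    have := Ca c1 hmp
    have := Ca c2 hmp
    rw [Ar]; constructor <;> linarith
  intro i hi j hj hij t ht t' ht' htt
  obtain ⟨c, hc1, hc2, hc3⟩ : ∃ c, m ≤ c ∧ c + m ≤ N ∧ |i& - c| ≤ m := by
    rcases Cb i m with h | h
    · refine ⟨m, Ad, Om, ?_⟩
      have : i& < m := Ec h
      rw [Ar]; constructor <;> linarith [(Nat.cast_nonneg i : Oo ≤ i)]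
    · rcases Cb N (i+m) with h' | h'
      · refine ⟨N - m, Om, Om, ?_⟩
        rw [Dp Om]
        have : N& < i + m := Ec h'
        have : i& ≤ N := Ec hi
        rw [Ar]; constructor <;> linarith
      · exact ⟨i, h, h', Si⟩
  have hx1 := hsp i hi c Om (hc3.trans (hm1.trans (by gcongr))) t ht
  have hx2 := hsp i hi c Om (hc3.trans (hm1.trans (by gcongr))) t' ht'
  have hx3 := hsp i hi j hj (hij.trans (by gcongr; linarith)) t' ht'
  have hx4 : |v c t - v c t'| ≤ 3 * tol / 8 := by
    rcases Er t t' with h | h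
    · exact key c hc1 hc2 t ht t' ht' h (by linarith [Ar.1 htt])
    · rw [Br]; exact key c hc1 hc2 t' ht' t ht h (by linarith [Ar.1 htt])
  have := abs_lt.1 hx1
  have := abs_lt.1 hx2
  have := abs_lt.1 hx3
  have := Ar.1 hx4
  rw [abs_lt]; constructor <;> linarith
noncomputable def ar : Ultrafilter ℕ := hyperfilter ℕ
theorem U_ev {p : ℕ → Prop} (h : ∀ᶠ N in atTop, p N) : ∀ᶠ N in ar, p N :=
  Nat.hyperfilter_le_atTop h
noncomputable def ul (f : ℕ → Re) : Re := limUnder (ar : Filter ℕ) f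
theorem ul_lim {f : ℕ → Re} (C : Re) (h : ∀ᶠ N in ar, |f N| ≤ C) : Tendsto f ar (𝓝 (ul f)) := by
  apply tendsto_nhds_limUnder
  have hc : IsCompact (Icc (-C) C) := isCompact_Icc
  obtain ⟨x, _, hx⟩ := hc.ultrafilter_le_nhds (ar.map f) (by
    rw [le_principal_iff, Ultrafilter.coe_map, mem_map]
    filter_upwards [h] with N hN
    exact Ar.1 hN)
  exact ⟨x, hx⟩
noncomputable def ix (N : ℕ) (u : Re) : ℕ := min ⌊u * N⌋₊ (N - 1)
theorem ix_lt {N : ℕ} (hN : 1 ≤ N) (u : Re) : ix N u < N := by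
  unfold ix; have := Al ⌊u * N⌋₊ (N-1); omega
theorem ix_abs {N : ℕ} (hN : 1 ≤ N) {u : Re} (hu : u ∈ I) : |(ix N u : Re) / N - u| ≤ 1 / N := by
  have hNp : Oo < N := Ec hN
  have h1 : (ix N u : Re) ≤ u * N := by
    refine le_trans ?_ (Nat.floor_le (Bu hu.1 hNp.le))
    exact_mod_cast Am _ _
  have h2 : u * N ≤ ix N u + 1 := by
    unfold ix
    rcases min_cases ⌊u * N⌋₊ (N-1) with h | h
    · rw [h.1]; exact (Nat.lt_floor_add_one _).le
    · rw [h.1, Dp hN]; push_cast; nlinarith [hu.2]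
  have e : (ix N u : Re) / N - u = (ix N u - u * N) / N := by field_simp
  rw [e, abs_div, Ag hNp]
  gcongr
  rw [Ar]; constructor <;> linarith
theorem ix_lim {u : Re} (hu : u ∈ I) : Tendsto (fun N : ℕ => (ix N u : Re) / N) ar (𝓝 u) := by
  have h0 : Tendsto (fun N : ℕ => 1 / N&) ar (𝓝 0) := tendsto_one_div_atTop_nhds_zero_nat.mono_left Nat.hyperfilter_le_atTop
  rw [tendsto_iff_dist_tendsto_zero]
  refine squeeze_zero' (Ep fun _ => dist_nonneg) ?_ h0
  filter_upwards [U_ev (Ao 1)] with N hN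
  exact ix_abs hN hu
theorem N_lim : Tendsto (fun N : ℕ => 1 / N&) ar (𝓝 0) :=
  tendsto_one_div_atTop_nhds_zero_nat.mono_left Nat.hyperfilter_le_atTop
theorem disc_taylor {f g : ℕ → Re} {N : Re} (hN : 0 < N) {i j : ℕ} {e c : Re}
    (hf : ∀ k, min i j ≤ k → k < max i j → f k~ - f k = g k / N)
    (hg : ∀ k, min i j ≤ k → k < max i j → |g k - c| ≤ e) :
    |f j - f i - (j& - i) / N * c| ≤ e * |(j& - i) / N| := by
  have key : ∀ a m : ℕ, (∀ k, a ≤ k → k < a + m → f k~ - f k = g k / N) →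
      (∀ k, a ≤ k → k < a + m → |g k - c| ≤ e) → |f (a+m) - f a - m / N * c| ≤ e * (m/N) := by
    intro a m
    induction m with
    | zero => intro _ _; simp
    | succ m ih =>
      intro h1 h2
      have i1 := Ar.1 (ih (fun k hk hk' => h1 k hk Om) (fun k hk hk' => h2 k hk Om))
      have i2 := h1 (a+m) Om Om
      have i3 := Ar.1 (h2 (a+m) Om Om)
      have e1 : g (a+m) / N ≤ (e + c) / N := by gcongr; linarith
      have e2 : (c - e) / N ≤ g (a+m) / N := by gcongr; linarith
      push_cast
      have e3 : (m&+1)/N * c = m/N * c + c / N := Rg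
      have e4 : e * ((m&+1)/N) = e * (m/N) + e / N := Rg
      rw [e3, e4, Ar]
      rw [add_div] at e1; rw [sub_div] at e2
      rw [← add_assoc]
      constructor <;> linarith
  rcases Er i j with h | h
  · obtain ⟨m, rfl⟩ := Cu h
    rw [min_eq_left h, Cg h] at hf hg
    have := key i m hf hg
    push_cast
    rw [show (i& + m - i) = m by ring, Ak (a := m&/N) Po]
    exact this
  · obtain ⟨m, rfl⟩ := Cu h
    rw [min_eq_right h, Fa h] at hf hg
    have := key j m hf hg
    push_cast at this ⊢
    rw [show (j& - (j + m)) / N = - (m/N) by ring, abs_neg, Ak (a := m&/N) Po]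
    rw [← abs_neg]
    refine le_trans (le_of_eq ?_) this
    congr 1; ring
theorem DSol.mono_M {Ps : Fn} {n : ℕ} {K ac M M' b0 b1 : Re} {s S v} (h : DSol Ps n K ac M b0 b1 s S v) (hM : M ≤ M') :
    DSol Ps n K ac M' b0 b1 s S v :=
  { h with mem := fun i hi t ht => ⟨(h.mem i hi t ht).1, (h.mem i hi t ht).2.trans hM⟩ }
def Xd (S : ℕ → ℕ → Fn) (N i : ℕ) (t : Re) : Re := N * (S N i~ t - S N i t)
structure ASeq (Ps : Fn) (M : Re) (X0 : Fn) (S v : ℕ → ℕ → Fn) : Prop where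
  psi : PsiData Ps
  hM : 0 < M
  sol : ∀ N, 1 ≤ N → ∃ s, DSol Ps N (N&^2) (1/N) M~ (1/N) (1/N) s (S N) (v N)
  up : ∀ N, 1 ≤ N → ∀ i ≤ N, ∀ t ∈ Jc, v N i t ≤ M + 1/N
  init : ∀ N, 1 ≤ N → ∀ i < N, Xd S N i 0 = X0 (i/N) + 1/N * (i/N)
  S00 : ∀ N, 1 ≤ N → S N 0 0 = 0
  X0b : ∀ x ∈ I, ∀ y ∈ I, x ≤ y → 0 ≤ X0 y - X0 x ∧ X0 y - X0 x ≤ M * (y - x)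
theorem exists_ASeq {Ps : Fn} (ab : PsiData Ps) {M : Re} (hM : 0 < M) (X0 : Fn)
    (h0 : ∀ x ∈ I, ∀ y ∈ I, x ≤ y → 0 ≤ X0 y - X0 x ∧ X0 y - X0 x ≤ M * (y - x)) :
    ∃ S v, ASeq Ps M X0 S v := by
  have key : ∀ N : ℕ, ∃ S v, 1 ≤ N → ∃ s : ℕ → Re, DSol Ps N (N&^2) (1/N) (M+1/N) (1/N) (1/N) s S v ∧ s 0 = 0 ∧
      ∀ i, N& * (s i~ - s i) = X0 (i/N) + 1/N * (i/N) := by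
    intro N
    rcases Cb N 1 with hN | hN
    · exact ⟨fun _ _ => 0, fun _ _ => 0, fun h => Om⟩
    have hNp : Oo < N := Ec hN
    set s : ℕ → Re := fun i => (1/N&) * ∑ j ∈ Fr i, (X0 (j/N) + 1/N * (j/N)) with hs
    have hs1 : ∀ i, N& * (s i~ - s i) = X0 (i/N) + 1/N * (i/N) := by
      intro i
      simp only [hs, Cs]
      field_simp
      ring
    have h1 : Oo < 1 / N := Po
    obtain ⟨S, v, D⟩ := exists_DSol ab N (K := N&^2) (ac := 1/N) (M := M + 1/N) (b0 := 1/N) (b1 := 1/N) s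
      hN Po h1 Li ⟨Ad, Li⟩ ⟨Ad, Li⟩ (by
        intro i hi
        have e : N&^2 * (s i~~ - 2 * s i~ + s i) = N * (X0 ((i+1:ℕ)/N) - X0 (i/N)) + 1/N := by
          have a1 := hs1 i
          have a2 := hs1 i~
          have : N&^2 * (s i~~ - 2 * s i~ + s i) = N * (N * (s (i+1+1) - s i~) - N * (s i~ - s i)) := Rg
          rw [this, a1, a2]; push_cast; field_simp; ring
        have hi' : i& + 1 < N := Ec hi
        have hx := h0 (i/N) ⟨Po, by rw [Ck hNp]; linarith⟩ ((i+1:ℕ)/N)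
          ⟨Po, by rw [Ck hNp]; push_cast; linarith⟩ (by gcongr; linarith)
        rw [e]
        constructor
        · have := Bu hNp.le hx.1; linarith
        · have := Aa hx.2 hNp.le
          have e2 : N& * (M * ((i+1:ℕ)/N - i/N)) = M := by push_cast; field_simp; ring
          linarith)
    exact ⟨S, v, fun _ => ⟨s, D, by simp [hs], hs1⟩⟩
  choose S v h using key
  refine ⟨S, v, ab, hM, ?_, ?_, ?_, ?_, h0⟩
  · intro N hN
    obtain ⟨s, D, _, _⟩ := h N hN
    refine ⟨s, D.mono_M ?_⟩
    have : (1:Re) / N ≤ 1 := by rw [Ck (Ec hN)]; exact_mod_cast hN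
    linarith
  · intro N hN i hi t ht
    obtain ⟨s, D, _, _⟩ := h N hN
    exact (D.mem i hi t ht).2
  · intro N hN i hi
    obtain ⟨s, D, _, h3⟩ := h N hN
    unfold Xd; rw [D.S0 _ hi, D.S0 _ hi.le]; exact h3 i
  · intro N hN
    obtain ⟨s, D, h2, _⟩ := h N hN
    rw [D.S0 _ Om, h2]
noncomputable def lS (S : ℕ → ℕ → Fn) (u t : Re) : Re := ul fun N => S N (ix N u) t
noncomputable def lX (S : ℕ → ℕ → Fn) (u t : Re) : Re := ul fun N => Xd S N (ix N u) t
theorem ix_mono {N : ℕ} {u u' : Re} (h : u ≤ u') : ix N u ≤ ix N u' := by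
  unfold ix
  have : ⌊u * N⌋₊ ≤ ⌊u' * N⌋₊ := Nat.floor_mono (by gcongr)
  omega
section
variable {Ps X0 : Fn} {M : Re} {S v : ℕ → ℕ → Fn} (H : ASeq Ps M X0 S v)
include H
theorem ASeq.Xstep {N i : ℕ} (hN : 1 ≤ N) (hi : i + 1 < N) (t : Re) : Xd S N i~ t - Xd S N i t = v N i~ t / N := by
  obtain ⟨s, D⟩ := H.sol N hN
  have hNp : Oo < N := Ec hN
  rw [D.vS i hi t]; unfold Xd; field_simp; ring
theorem ASeq.vmem {N i : ℕ} (hN : 1 ≤ N) (hi : i ≤ N) {t : Re} (ht : t ∈ Jc) : 0 ≤ v N i t ∧ v N i t ≤ M + 1 / N := by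
  obtain ⟨s, D⟩ := H.sol N hN
  have h1 : Oo ≤ 1 / N := Po
  exact ⟨h1.trans (D.mem i hi t ht).1, H.up N hN i hi t ht⟩
theorem ASeq.oneN {N : ℕ} (hN : 1 ≤ N) : (1:Re) / N ≤ 1 := by
  rw [Ck (Ec hN)]; exact_mod_cast hN
theorem ASeq.Xmono {N i j : ℕ} (hN : 1 ≤ N) (hij : i ≤ j) (hj : j < N) {t : Re} (ht : t ∈ Jc) :
    0 ≤ Xd S N j t - Xd S N i t ∧ Xd S N j t - Xd S N i t ≤ (M + 1 / N) * ((j& - i) / N) := by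
  obtain ⟨m, rfl⟩ := Cu hij
  clear hij
  have hNp : Oo < N := Ec hN
  induction m with
  | zero => simp
  | succ m ih =>
    obtain ⟨i1, i2⟩ := ih Om
    have h1 := H.Xstep hN (i := i + m) hj t
    obtain ⟨h2, h3⟩ := H.vmem hN (i := i + m + 1) Om ht
    have h4 : 0 ≤ v N (i+m+1) t / N := Po
    have h5 : v N (i+m+1) t / N ≤ (M + 1/N) / N := by gcongr
    rw [← add_assoc]
    push_cast at i2 ⊢
    have e : (M + 1 / N) * ((i& + m + 1 - i) / N) = (M + 1/N) * ((i + m - i)/N) + (M + 1/N)/N := Rg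
    rw [e]
    constructor <;> linarith
theorem ASeq.Staylor {N i j : ℕ} (hN : 1 ≤ N) (hi : i < N) (hj : j < N) {t : Re} (ht : t ∈ Jc) :
    |S N j t - S N i t - (j& - i) / N * Xd S N i t| ≤ M~ * |(j& - i) / N| * |(j& - i) / N| := by
  have hNp : Oo < N := Ec hN
  have hM := H.hM
  have h1 := H.oneN hN
  apply disc_taylor (f := fun k => S N k t) (g := fun k => Xd S N k t) hNp
  · intro k _ _; unfold Xd; field_simp
  · intro k hk1 hk2
    rcases Er i k with h | h
    · have a := H.Xmono hN h Om ht
      rw [Ak a.1]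
      refine a.2.trans ?_
      have : k& ≤ j := by exact_mod_cast (by omega : k ≤ j)
      have : i& ≤ k := Ec h
      rw [Ak (div_nonneg Li hNp.le)]
      have : Oo ≤ k - i := Li
      gcongr
    · have a := H.Xmono hN h hi ht
      rw [Br, Ak a.1]
      refine a.2.trans ?_
      rcases h.eq_or_lt with rfl | h'
      · simp; positivity
      have : j& ≤ k := by exact_mod_cast (by omega : j ≤ k)
      have : k& ≤ i := Ec h
      rw [abs_of_nonpos (div_nonpos_of_nonpos_of_nonneg Li hNp.le), ← neg_div, neg_sub]
      have : Oo ≤ i - k := Li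
      gcongr
theorem ASeq.Sbd : ∃ C, 0 ≤ C ∧ ∀ N, 1 ≤ N → ∀ i ≤ N, ∀ t ∈ Jc, |S N i t| ≤ C := by
  have hM := H.hM
  have hP := H.psi.pos (show 0 < M + 1 by linarith)
  set B := |X0 0| + M + 1 with hB
  refine ⟨B + Ps M~ * 2, Po, ?_⟩
  intro N hN i hi t ht
  have hNp : Oo < N := Ec hN
  have h1 := H.oneN hN
  have h0 : ∀ i ≤ N, |S N i 0| ≤ B * (i / N) := by
    intro i
    induction i with
    | zero => intro _; simp [H.S00 N hN]
    | succ i ih =>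
      intro hi
      have i1 := ih Om
      have i2 := H.init N hN i Om
      have hi' : i& + 1 ≤ N := Ec hi
      have hx1 : i&/N ≤ 1 := by rw [Ck hNp]; linarith
      have hx0 : 0 ≤ i&/N := Po
      have i3 := H.X0b 0 ⟨Ad, Bo⟩ (i/N) ⟨hx0, hx1⟩ hx0
      have i4 : |Xd S N i 0| ≤ B := by
        rw [i2]
        have : 1/N& * (i/N) ≤ 1 := by nlinarith
        have : 0 ≤ 1/N& * (i/N) := Po
        have := neg_abs_le (X0 0)
        have := Cf (X0 0)
        have : M * (i&/N - 0) ≤ M := by nlinarith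
        rw [Ar]; constructor <;> linarith
      have i5 : S N i~ 0 = S N i 0 + Xd S N i 0 / N := by unfold Xd; field_simp; ring
      rw [i5]
      refine (abs_add_le _ _).trans ?_
      rw [abs_div, Ag hNp]
      have : |Xd S N i 0| / N ≤ B / N := by gcongr
      push_cast
      calc _ ≤ B * (i/N) + B / N := add_le_add i1 this
        _ = _ := Rg
  obtain ⟨s, D⟩ := H.sol N hN
  have h2 := D.S_lip H.psi Po hi ⟨Ad, Nn⟩ ht ht.1
  have h3 := h0 i hi
  have h4 : i&/N ≤ 1 := by rw [Ck hNp]; exact_mod_cast hi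
  have h5 : B * (i/N) ≤ B := by nlinarith [show 0 ≤ B by positivity]
  have h6 : Ps M~ * (t - 0) ≤ Ps M~ * 2 := by gcongr; linarith [ht.2]
  have := Ar.1 h3
  rw [Ar]; constructor <;> linarith
theorem ASeq.Xbd : ∃ C, 0 ≤ C ∧ ∀ N, 4 ≤ N → ∀ i < N, ∀ t ∈ Jc, |Xd S N i t| ≤ C := by
  obtain ⟨C, hC, hS⟩ := H.Sbd
  have hM := H.hM
  refine ⟨4 * (2 * C + M~), Po, ?_⟩
  intro N hN i hi t ht
  have hNp : Oo < N := by exact_mod_cast (by omega : 0 < N)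
  obtain ⟨j, hj, hd⟩ : ∃ j < N, 1/4 ≤ |(j& - i)/N| := by
    rw [show (1:Re)/4 = |(1:Re)/4| by norm_num]
    rcases Cb (2*i) N with h | h
    · refine ⟨N - 1, Om, ?_⟩
      rw [Dp Om]
      have : 2 * i& + 1 ≤ N := Ec h
      have : (4:Re) ≤ N := Ec hN
      apply abs_le_abs_of_nonneg Nn
      rw [Ap hNp]; push_cast; linarith
    · refine ⟨0, Om, ?_⟩
      have : N& ≤ 2 * i := Ec h
      rw [← abs_neg ((((0:ℕ):Re) - i)/N)]
      apply abs_le_abs_of_nonneg Nn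
      rw [← neg_div, Ap hNp]; push_cast; linarith
  have h1 := H.Staylor Om hi hj ht
  have h2 := hS N Om i hi.le t ht
  have h3 := hS N Om j hj.le t ht
  set d := (j& - i)/N with hdd
  have hd1 : |d| ≤ 1 := by
    rw [hdd, abs_div, Ag hNp, Ck hNp]
    have : i& < N := Ec hi
    have : j& < N := Ec hj
    have : Oo ≤ i := Po
    have : Oo ≤ j := Po
    rw [Ar]; constructor <;> linarith
  have h4 : |d * Xd S N i t| ≤ 2 * C + M~ := by
    have : M~ * |d| * |d| ≤ M + 1 := by
      calc _ ≤ M~ * 1 * 1 := by gcongr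
        _ = _ := Rg
    have := Ar.1 h1
    have := Ar.1 h2
    have := Ar.1 h3
    rw [Ar]; constructor <;> linarith
  rw [abs_mul] at h4
  have h5 : 1/4 * |Xd S N i t| ≤ |d| * |Xd S N i t| := by gcongr
  linarith
end
noncomputable def lv (v : ℕ → ℕ → Fn) (u t : Re) : Re := ul fun N => v N (ix N u) t
section
variable {Ps X0 : Fn} {M : Re} {S v : ℕ → ℕ → Fn} (H : ASeq Ps M X0 S v)
include H
theorem ASeq.tS {t : Re} (ht : t ∈ Jc) (u : Re) : Tendsto (fun N => S N (ix N u) t) ar (𝓝 (lS S u t)) := by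
  obtain ⟨C, _, h⟩ := H.Sbd
  exact ul_lim C (U_ev ((Ao 1).mono fun N hN => h N hN _ (ix_lt hN u).le t ht))
theorem ASeq.tX {t : Re} (ht : t ∈ Jc) (u : Re) : Tendsto (fun N => Xd S N (ix N u) t) ar (𝓝 (lX S u t)) := by
  obtain ⟨C, _, h⟩ := H.Xbd
  exact ul_lim C (U_ev ((Ao 4).mono fun N hN => h N hN _ (ix_lt Om u) t ht))
theorem ASeq.tv {t : Re} (ht : t ∈ Jc) (u : Re) : Tendsto (fun N => v N (ix N u) t) ar (𝓝 (lv v u t)) := by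
  refine ul_lim M~ (U_ev ((Ao 1).mono fun N hN => ?_))
  have h := H.vmem hN (ix_lt hN u).le ht
  have := H.oneN hN
  rw [Ar]; constructor <;> linarith [H.hM]
theorem ASeq.lv_mem {t : Re} (ht : t ∈ Jc) (u : Re) : 0 ≤ lv v u t ∧ lv v u t ≤ M := by
  refine ⟨Dl (H.tv ht u) (U_ev ((Ao 1).mono fun N hN => (H.vmem hN (ix_lt hN u).le ht).1)), ?_⟩
  have h2 : Tendsto (fun N : ℕ => M + 1 / N&) ar (𝓝 (M + 0)) := N_lim.const_add M
  rw [add_zero] at h2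
  exact Bp (H.tv ht u) h2 (U_ev ((Ao 1).mono fun N hN => (H.vmem hN (ix_lt hN u).le ht).2))
theorem ASeq.lX0 {u : Re} (hu : u ∈ I) : lX S u 0 = X0 u := by
  have hM := H.hM
  have hc : Co X0 (Icc 0 1) := by
    apply LipschitzOnWith.continuousOn (K := ⟨M, hM.le⟩)
    apply LipschitzOnWith.of_dist_le_mul
    intro x hx y hy
    rw [Bb, Bb]
    show _ ≤ M * _
    rcases Er x y with h | h
    · have := H.X0b x hx y hy h
      rw [Br, Ak this.1, Br, Ak Li]; exact this.2
    · have := H.X0b y hy x hx h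
      rw [Ak this.1, Ak Li]; exact this.2
  have h1 : Tendsto (fun N : ℕ => (ix N u : Re) / N) ar (𝓝[Icc 0 1] u) := by
    rw [Bt]
    refine ⟨ix_lim hu, U_ev ((Ao 1).mono fun N hN => ⟨Po, ?_⟩)⟩
    rw [Ck (Ec hN)]; exact_mod_cast (ix_lt hN u).le
  have h2 : Tendsto (fun N : ℕ => X0 ((ix N u : Re) / N) + 1 / N * ((ix N u : Re) / N)) ar (𝓝 (X0 u + 0 * u)) :=
    ((hc u hu).tendsto.comp h1).add (N_lim.mul (ix_lim hu))
  rw [zero_mul, add_zero] at h2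
  refine tendsto_nhds_unique (H.tX ⟨Ad, Nn⟩ u) (h2.congr' ?_)
  exact U_ev ((Ao 1).mono fun N hN => (H.init N hN _ (ix_lt hN u)).symm)
theorem ASeq.dix {u u' : Re} (hu : u ∈ I) (hu' : u' ∈ I) :
    Tendsto (fun N : ℕ => ((ix N u' : Re) - ix N u) / N) ar (𝓝 (u' - u)) := by
  simp only [sub_div]
  exact (ix_lim hu').sub (ix_lim hu)
theorem ASeq.lX_mono {t : Re} (ht : t ∈ Jc) {u u' : Re} (hu : u ∈ I) (hu' : u' ∈ I) (h : u ≤ u') :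
    0 ≤ lX S u' t - lX S u t ∧ lX S u' t - lX S u t ≤ M * (u' - u) := by
  have h1 := (H.tX ht u').sub (H.tX ht u)
  have h2 : Tendsto (fun N : ℕ => (M + 1 / N&) * (((ix N u' : Re) - ix N u) / N)) ar (𝓝 ((M + 0) * (u' - u))) :=
    (N_lim.const_add M).mul (H.dix hu hu')
  rw [add_zero] at h2
  exact ⟨Dl h1 (U_ev ((Ao 1).mono fun N hN => (H.Xmono hN (ix_mono h) (ix_lt hN _) ht).1)),
   Bp h1 h2 (U_ev ((Ao 1).mono fun N hN => (H.Xmono hN (ix_mono h) (ix_lt hN _) ht).2))⟩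
theorem ASeq.lS_taylor {t : Re} (ht : t ∈ Jc) {u u' : Re} (hu : u ∈ I) (hu' : u' ∈ I) :
    |lS S u' t - lS S u t - (u' - u) * lX S u t| ≤ M~ * |u' - u| * |u' - u| := by
  have h1 := (((H.tS ht u').sub (H.tS ht u)).sub ((H.dix hu hu').mul (H.tX ht u))).abs
  have h2 := ((H.dix hu hu').abs.const_mul M~).mul (H.dix hu hu').abs
  exact Bp h1 h2 (U_ev ((Ao 1).mono fun N hN => H.Staylor hN (ix_lt hN _) (ix_lt hN _) ht))
theorem ASeq.lS_time {t t' : Re} (ht : t ∈ Jc) (ht' : t' ∈ Jc) (h : t ≤ t') (u : Re) :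
    0 ≤ lS S u t' - lS S u t ∧ lS S u t' - lS S u t ≤ Ps M~ * (t' - t) := by
  have h1 := (H.tS ht' u).sub (H.tS ht u)
  have h2 : ∀ᶠ N in ar, 0 ≤ S N (ix N u) t' - S N (ix N u) t ∧ S N (ix N u) t' - S N (ix N u) t ≤ Ps M~ * (t' - t) := by
    refine U_ev ((Ao 1).mono fun N hN => ?_)
    obtain ⟨s, D⟩ := H.sol N hN
    exact D.S_lip H.psi Po (ix_lt hN u).le ht ht' h
  exact ⟨Dl h1 (h2.mono fun _ h => h.1), le_of_tendsto h1 (h2.mono fun _ h => h.2)⟩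
theorem ASeq.equi {t0 tol : Re} (ht0 : 0 < t0) (htol : 0 < tol) :
    ∃ ad : Re, 0 < ad ∧ ∀ᶠ N : ℕ in ar, ∀ i ≤ N, ∀ j ≤ N, |(i& - j) / N| ≤ ad → ∀ t ∈ Icc t0 2, ∀ t' ∈ Icc t0 2,
      |t - t'| ≤ ad → |v N i t - v N j t'| < tol := by
  have hM := H.hM
  obtain ⟨ad, ak, h⟩ := DSol.equi H.psi (M := M + 1) Li ht0 htol
  refine ⟨ad, ak, U_ev ?_⟩
  filter_upwards [Ao 1, tendsto_natCast_atTop_atTop.eventually_ge_atTop (1/ad)] with N hN hN'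
  obtain ⟨s, D⟩ := H.sol N hN
  have hNp : Oo < N := Ec hN
  intro i hi j hj hij
  refine h N _ s _ _ D Po (by linarith [H.oneN hN]) ?_ i hi j hj ?_
  · rw [Ci ak] at hN'; linarith
  · rwa [abs_div, Ag hNp, Ci hNp] at hij
theorem ASeq.lv_equi {t0 tol : Re} (ht0 : 0 < t0) (htol : 0 < tol) :
    ∃ ad : Re, 0 < ad ∧ ∀ u ∈ I, ∀ u' ∈ I, |u - u'| < ad → ∀ t ∈ Icc t0 2, ∀ t' ∈ Icc t0 2,
      |t - t'| ≤ ad → |lv v u t - lv v u' t'| ≤ tol := by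
  obtain ⟨ad, ak, h⟩ := H.equi ht0 htol
  refine ⟨ad, ak, fun u hu u' hu' huu t ht t' ht' htt => ?_⟩
  have hI : ∀ {r}, r ∈ Icc t0 2 → r ∈ Jc := fun hr => ⟨Lx hr.1, hr.2⟩
  refine le_of_tendsto ((H.tv (hI ht) u).sub (H.tv (hI ht') u')).abs ?_
  filter_upwards [h, U_ev (Ao 1), (H.dix hu' hu).abs.eventually (Ce huu)] with N h hN h2
  exact (h _ (ix_lt hN u).le _ (ix_lt hN u').le h2.le t ht t' ht' htt).le
theorem ASeq.lv_bdry {t : Re} (ht : t ∈ Ioc Oo 2) : lv v 0 t = 0 ∧ lv v 1 t = 0 := by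
  have hI : t ∈ Jc := ⟨ht.1.le, ht.2⟩
  have key : ∀ u ∈ I, ∀ b : ℕ → ℕ, Tendsto (fun N : ℕ => (b N : Re) / N) ar (𝓝 u) →
      (∀ N, 1 ≤ N → b N ≤ N ∧ v N (b N) t = 1 / N) → lv v u t = 0 := by
    intro u hu b hb hb2
    refine le_antisymm (Ek fun tol htol => ?_) (H.lv_mem hI u).1
    obtain ⟨ad, ak, h⟩ := H.equi ht.1 htol
    have h3 : Tendsto (fun N : ℕ => |((ix N u : Re) - b N) / N|) ar (𝓝 |u - u|) := by
      simp only [sub_div]; exact ((ix_lim hu).sub hb).abs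
    rw [sub_self, abs_zero] at h3
    refine Bp (H.tv hI u) (N_lim.add_const tol) ?_
    filter_upwards [h, U_ev (Ao 1), h3.eventually (Ce ak)] with N h hN h2
    have := h _ (ix_lt hN u).le _ (hb2 N hN).1 h2.le t ⟨Ad, ht.2⟩ t ⟨Ad, ht.2⟩ (by simp [ak.le])
    rw [(hb2 N hN).2] at this
    linarith [abs_lt.1 this]
  constructor
  · refine key 0 ⟨Ad, Bo⟩ (fun _ => 0) Si fun N hN => ?_
    obtain ⟨s, D⟩ := H.sol N hN
    exact ⟨Om, D.vl t⟩
  · refine key 1 ⟨Bo, Ad⟩ (fun N => N) ?_ fun N hN => ?_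
    · refine tendsto_const_nhds.congr' (U_ev ((Ao 1).mono fun N hN => ?_))
      exact (div_self Po).symm
    · obtain ⟨s, D⟩ := H.sol N hN
      exact ⟨Ad, D.vr t⟩
theorem ASeq.lX_taylor {t0 tol : Re} (ht0 : 0 < t0) (htol : 0 < tol) :
    ∃ ad : Re, 0 < ad ∧ ∀ u ∈ I, ∀ u' ∈ I, |u' - u| < ad → ∀ t ∈ Icc t0 2,
      |lX S u' t - lX S u t - (u' - u) * lv v u t| ≤ tol * |u' - u| := by
  obtain ⟨ad, ak, h⟩ := H.equi ht0 (half_pos htol)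
  refine ⟨ad/2, half_pos ak, fun u hu u' hu' huu t ht => ?_⟩
  have hI : t ∈ Jc := ⟨Lx ht.1, ht.2⟩
  refine Bp (((H.tX hI u').sub (H.tX hI u)).sub ((H.dix hu hu').mul (H.tv hI u))).abs
    ((H.dix hu hu').abs.const_mul tol) ?_
  filter_upwards [h, U_ev (Ao 1), (H.dix hu hu').abs.eventually (Ce huu),
    N_lim.eventually (Ce (half_pos ak))] with N h hN h2 h3
  have hNp : Oo < N := Ec hN
  set i := ix N u
  set j := ix N u'
  have hi : i < N := ix_lt hN u
  have hj : j < N := ix_lt hN u'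
  rw [abs_div, Ag hNp, div_lt_iff₀ hNp] at h2
  rw [div_lt_iff₀ hNp] at h3
  have hv : ∀ k ≤ N, |k& - i| ≤ |j& - i| + 1 → |v N k t - v N i t| < tol / 2 := by
    intro k hk hki
    refine h k hk i hi.le ?_ t ht t ht (by simp [ak.le])
    rw [abs_div, Ag hNp, Ci hNp]; linarith
  have hij : ∀ k, min i j ≤ k → k < max i j → |((k+1:ℕ):Re) - i| ≤ |j& - i| + 1 ∧ k + 1 < N := by
    intro k h1 h2
    refine ⟨?_, Om⟩
    rcases Er i j with h | h
    · have a1 : k& < j := by exact_mod_cast (by omega : k < j)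
      have a2 : i& ≤ k := by exact_mod_cast (by omega : i ≤ k)
      push_cast
      rw [Ak Li, Ak Li]; linarith
    · have a1 : k& + 1 ≤ i := by exact_mod_cast (by omega : k < i)
      have a2 : j& ≤ k := by exact_mod_cast (by omega : j ≤ k)
      push_cast
      rw [abs_of_nonpos Li, abs_of_nonpos Li]; linarith
  exact disc_taylor (f := fun k => Xd S N k t) (g := fun k => v N k~ t) hNp (fun k h1 h2 => H.Xstep hN (hij k h1 h2).2 t)
    (fun k h1 h2 => by linarith [hv k~ (hij k h1 h2).2.le (hij k h1 h2).1])
theorem ASeq.lS_taylor_time {t0 tol : Re} (ht0 : 0 < t0) (htol : 0 < tol) :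
    ∃ ad : Re, 0 < ad ∧ ∀ u ∈ I, ∀ t ∈ Ico t0 2, ∀ t' ∈ Ico t0 2, |t' - t| < ad →
      |lS S u t' - lS S u t - (t' - t) * Ps (lv v u t)| ≤ tol * |t' - t| := by
  have hM := H.hM
  have huc := isCompact_Icc.uniformContinuousOn_of_continuous (H.psi.cont.mono (Icc_subset_Ici_self : Icc 0 M~ ⊆ _))
  obtain ⟨bk, ca, huc⟩ := Metric.uniformContinuousOn_iff.1 huc tol htol
  obtain ⟨ad, ak, h⟩ := H.equi ht0 ca
  refine ⟨ad, ak, fun u hu t ht t' ht' htt => ?_⟩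
  have hI : ∀ {r}, r ∈ Ico t0 2 → r ∈ Jc := fun hr => ⟨Lx hr.1, hr.2.le⟩
  have hlv := H.lv_mem (hI ht) u
  have hz : Tendsto (fun N => Ps (v N (ix N u) t)) ar (𝓝 (Ps (lv v u t))) := by
    refine (H.psi.cont _ hlv.1).tendsto.comp (Bt.2 ⟨H.tv (hI ht) u, ?_⟩)
    exact U_ev ((Ao 1).mono fun N hN => (H.vmem hN (ix_lt hN u).le (hI ht)).1)
  refine le_of_tendsto (((H.tS (hI ht') u).sub (H.tS (hI ht) u)).sub (hz.const_mul (t' - t))).abs ?_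
  filter_upwards [h, U_ev (Ao 1)] with N h hN
  obtain ⟨s, D⟩ := H.sol N hN
  have hi := (ix_lt hN u).le
  set i := ix N u
  have hsub : uIcc t t' ⊆ Ico t0 2 := ordConnected_Ico.uIcc_subset ht ht'
  have hm : ∀ r ∈ uIcc t t', v N i r ∈ Icc 0 M~ := fun r hr => by
    have := H.vmem hN hi (hI (hsub hr)); exact ⟨this.1, by linarith [H.oneN hN]⟩
  have := (convex_uIcc t t').norm_image_sub_le_of_norm_hasDerivWithin_le (f := fun r => S N i r - r * Ps (v N i t))
    (f' := fun r => Ps (v N i r) - Ps (v N i t)) (C := tol) (fun r hr => by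
      refine ((D.dS i hi r ⟨by linarith [(hsub hr).1], (hsub hr).2⟩).sub ?_).hasDerivWithinAt
      simpa using (Af r).mul_const (Ps (v N i t))) (fun r hr => by
      refine (huc _ (hm r hr) _ (hm t Ea) ?_).le
      refine h i hi i hi (by simp [ak.le]) r ⟨(hsub hr).1, (hsub hr).2.le⟩ t ⟨ht.1, ht.2.le⟩ ?_
      exact (Ei hr).trans htt.le) Ea right_mem_uIcc
  refine le_trans (le_of_eq ?_) this
  rw [Bd]; congr 1; ring
end
section
variable {Ps X0 : Fn} {M : Re} {S v : ℕ → ℕ → Fn} (H : ASeq Ps M X0 S v)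
include H
theorem ASeq.loc {u0 ts : Re} (hu : u0 ∈ Io) (ht : ts ∈ Jo) (hv : 0 < lv v u0 ts) (K : ℕ) :
    ∃ ag > 0, ∃ C, 0 ≤ C ∧ ∃ ah > 0, ag < u0 ∧ u0 + ag < 1 ∧ ag < ts ∧ ts + ag < 2 ∧ ∀ᶠ N : ℕ in ar, 1 ≤ N ∧ ∀ i : ℕ, |i&/N - u0| ≤ ag →
      0 < i ∧ i < N ∧ ∀ t, |t - ts| ≤ ag → ah ≤ v N i t ∧ ∀ k ≤ K, |Yk Ps (v N) k i t| ≤ C ∧ |iteratedDeriv k (v N i) t| ≤ C := by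
  obtain ⟨hu1, hu2⟩ := hu
  obtain ⟨ht1, ht2⟩ := ht
  have ab := H.psi
  have hM := H.hM
  have hPM := ab.pos (show 0 < M + 1 by linarith)
  set ah := lv v u0 ts / 3 with ay
  have bw : 0 < ah := Po
  obtain ⟨ad, ak, heq⟩ := H.equi (half_pos ht1) bw
  set R := min ad (min (u0/3) ((1-u0)/3)) with hR
  have hRp : 0 < R := Eb ak (Eb Li Li)
  have hR1 : R ≤ ad := Am _ _
  have hR2 : R ≤ u0/3 := (Al _ _).trans (Am _ _)
  have hR3 : R ≤ (1-u0)/3 := (Al _ _).trans (Al _ _)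
  set d := min ad (min (ts/2) ((2-ts)/2)) with hd
  have hdp : 0 < d := Eb ak (Eb Li Li)
  have hd1 : d ≤ ad := Am _ _
  have hd2 : d ≤ ts/2 := (Al _ _).trans (Am _ _)
  have hd3 : d ≤ (2-ts)/2 := (Al _ _).trans (Al _ _)
  set ae := d / (4 * K~) with aq
  have dh : 0 < ae := Po
  have cm : 2 * K * ae ≤ d / 2 := by
    rw [aq, mul_div_assoc', Ci Po]; nlinarith
  obtain ⟨C1, hC1, hreg⟩ := regAll ab (M := M+1) (R := R) (ah := ah) (t0 := ts/2) (ae := ae) Li hRp bw (half_pos ht1) dh K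
  obtain ⟨G, hO, hG, hGi, hGd⟩ := ab.inv
  have hpos : Icc ah M~ ⊆ Ioi 0 := fun x hx => bw.trans_le hx.1
  have hKc : IsCompact (Ps '' Icc ah M~) := isCompact_Icc.image_of_continuousOn (ab.cont.mono (hpos.trans Eo))
  obtain ⟨C2, hC2, hcomp⟩ := comp_bd hO hG hKc (image_mono hpos) K
  set D := C1 + 1
  have hRK : 0 < R / 16^K := Po
  have hRK1 : R / 16^K ≤ R := div_le_self hRp.le (one_le_pow₀ Nn)
  have hDK : 0 ≤ D ^ K := Po
  refine ⟨min (R / 16^K / 2) (d/2), Po, C1 + Ps M~ + C2 * D ^ K, Po, ah, bw, ?_, ?_, ?_, ?_, ?_⟩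
  · linarith [Am (R / 16^K / 2) (d/2)]
  · linarith [Am (R / 16^K / 2) (d/2)]
  · linarith [Al (R / 16^K / 2) (d/2)]
  · linarith [Al (R / 16^K / 2) (d/2)]
  have hI : ts ∈ Jc := ⟨ht1.le, ht2.le⟩
  have huI : u0 ∈ I := ⟨hu1.le, hu2.le⟩
  filter_upwards [heq, U_ev (Ao 1), N_lim.eventually (Ce (half_pos hRK)),
    (H.tv hI u0).eventually (lt_mem_nhds (show 2 * ah < lv v u0 ts by linarith))] with N heq hN hN1 hN2
  refine ⟨hN, ?_⟩
  obtain ⟨s, Ds⟩ := H.sol N hN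
  have hNp : Oo < N := Ec hN
  have hjN := ix_lt hN u0
  have hj := ix_abs hN huI
  set j := ix N u0
  have hj' := Ar.1 hj
  have hnd : ∀ i : ℕ, nd j (1/N) i = |(i& - j)/N| := fun i => by
    unfold nd; rw [abs_div, Ag hNp]; ring
  have af : Oo < 1 / N := Po
  have rd : RD Ps M~ R ah (ts/2) N (1/N) s (S N) (v N) j (ts - d) (ts + d) := by
    have ha : R < j& * (1/N) := by rw [mul_one_div]; linarith
    have hb : j& * (1/N) + R < 1 := by rw [mul_one_div]; linarith
    refine ⟨Ds, af, by linarith [H.oneN hN], hN, ha, hb, Li, Li, ?_⟩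
    intro i hi t ht
    rw [hnd] at hi
    have hiN : i ≤ N := by
      have h1 := (Ar.1 hi).2
      rw [mul_one_div] at hb
      rw [sub_div] at h1
      have : i&/N < 1 := Li
      rw [div_lt_one hNp] at this
      exact_mod_cast this.le
    have := heq i hiN j hjN.le (hi.trans hR1) t ⟨Lx ht.1, Lx ht.2⟩ ts ⟨Li, ht2.le⟩
      (by rw [Ar]; constructor <;> linarith [ht.1, ht.2])
    linarith [abs_lt.1 this]
  obtain ⟨hY, _⟩ := hreg N _ s _ _ j _ _ rd Li Li
  intro i hi
  have hi1 : nd j (1/N) i ≤ R / 16^K := by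
    have := Ar.1 (hi.trans (Am _ _))
    rw [hnd, sub_div, Ar]; constructor <;> linarith
  obtain ⟨hi0, hiN⟩ := rd.lt (hi1.trans hRK1)
  refine ⟨hi0, hiN, fun t ht => ?_⟩
  have ht' := Ar.1 (ht.trans (Al _ _))
  have hlow := rd.low i (hi1.trans hRK1) t ⟨Li, Li⟩
  have htI : t ∈ Jo := ⟨Li, Li⟩
  have hmem := Ds.mem i hiN.le t ⟨htI.1.le, htI.2.le⟩
  have hYm : ∀ m, 1 ≤ m → m ≤ K → |Yk Ps (v N) m i t| ≤ C1 := fun m h1 h2 => hY m h1 h2 i hi1 t ⟨Li, Li⟩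
  refine ⟨hlow, fun k hk => ⟨?_, ?_⟩⟩
  · have hCD : 0 ≤ C2 * D^K := Po
    rcases Dn k with rfl | hk0
    · have : Yk Ps (v N) 0 i t = Ps (v N i t) := by simp [Yk]
      rw [this, Ak (ab.nonneg Li)]
      linarith [ab.monoOn Li hmem.2]
    · linarith [hYm k hk0 hk]
  · have h1 := hcomp (fun t => Ps (v N i t)) (Ioo 0 2) t D Cn htI (Ds.zsmooth ab af i hiN.le)
      (fun r hr => mem_image_of_mem _ (af.trans_le (Ds.mem i hiN.le r ⟨hr.1.le, hr.2.le⟩).1))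
      (mem_image_of_mem _ ⟨hlow, hmem.2⟩) (fun m h1 h2 => (hYm m h1 h2).trans (by
        calc C1 ≤ D ^ 1 := by rw [pow_one]; linarith
          _ ≤ D ^ m := pow_le_pow_right₀ Li h1)) k hk Po
    have e : (G ∘ fun t => Ps (v N i t)) =ᶠ[𝓝 t] v N i := by
      filter_upwards [Bk htI.1 htI.2] with r hr
      exact hGi _ (af.trans_le (Ds.mem i hiN.le r ⟨hr.1.le, hr.2.le⟩).1)
    rw [e.iteratedDeriv_eq] at h1
    have : C2 * D^k ≤ C2 * D^K := by
      gcongr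
      · linarith
    linarith
theorem ASeq.loc_lim {u0 ts : Re} (hu : u0 ∈ Io) (ht : ts ∈ Jo) (hv : 0 < lv v u0 ts) (K : ℕ) :
    ∃ ag > 0, ∃ C, 0 ≤ C ∧ ag < u0 ∧ u0 + ag < 1 ∧ ag < ts ∧ ts + ag < 2 ∧ ∃ y p : ℕ → Re → Fn,
      ∀ u ∈ Ioo (u0-ag) (u0+ag), ∀ t ∈ Ioo (ts-ag) (ts+ag), y 0 u t = Ps (lv v u t) ∧ 0 < lv v u t ∧
      (∀ k, k + 2 ≤ K → ∀ t' ∈ Ioo (ts-ag) (ts+ag), |y k u t' - y k u t - (t' - t) * y k~ u t| ≤ C * |t'-t| * |t'-t|) ∧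
      (∀ k, k + 1 ≤ K → ∀ u' ∈ Ioo (u0-ag) (u0+ag), |y k u' t - y k u t - (u' - u) * p k u t| ≤ C * |u'-u| * |u'-u|) := by
  have ab := H.psi
  obtain ⟨ag, ba, C, hC, ah, ay, h1, h2, h3, h4, hloc⟩ := H.loc hu ht hv K
  have hd : ∀ {a c : Re}, a ∈ Ioo (c-ag) (c+ag) ↔ |a - c| < ag := fun {a c} => by
    rw [abs_lt, mem_Ioo]; constructor <;> rintro ⟨_, _⟩ <;> constructor <;> linarith
  have hI : ∀ {r}, r ∈ Ioo (ts-ag) (ts+ag) → r ∈ Jo := fun hr => ⟨Lx hr.1, Lx hr.2⟩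
  have hJ : ∀ {u}, u ∈ Ioo (u0-ag) (u0+ag) → u ∈ I := fun hr => ⟨Lx hr.1, Lx hr.2⟩
  have hix : ∀ u ∈ Ioo (u0-ag) (u0+ag), ∀ᶠ N : ℕ in ar, |(ix N u : Re)/N - u0| ≤ ag ∧ |((ix N u + 1 : ℕ) : Re)/N - u0| ≤ ag := by
    intro u hu
    have l1 := ((ix_lim (hJ hu)).sub_const u0).abs
    have l2 := (((ix_lim (hJ hu)).add N_lim).sub_const u0).abs
    rw [add_zero] at l2
    filter_upwards [l1.eventually (Ce (hd.1 hu)), l2.eventually (Ce (hd.1 hu))] with N h1 h2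
    refine ⟨h1.le, ?_⟩
    push_cast; rw [add_div]; exact h2.le
  set P : ℕ → ℕ → ℕ → Fn := fun k N i t => N * (Yk Ps (v N) k i~ t - Yk Ps (v N) k i t) with hP
  have tay : ∀ k, k + 1 ≤ K → ∀ u ∈ Ioo (u0-ag) (u0+ag), ∀ u' ∈ Ioo (u0-ag) (u0+ag), ∀ t ∈ Ioo (ts-ag) (ts+ag), ∀ᶠ N : ℕ in ar,
      |Yk Ps (v N) k (ix N u') t - Yk Ps (v N) k (ix N u) t - ((ix N u' : Re) - ix N u) / N * P k N (ix N u) t| ≤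
        C * |((ix N u' : Re) - ix N u) / N| * |((ix N u' : Re) - ix N u) / N| := by
    intro k hk u hu u' hu' t ht
    filter_upwards [hloc, hix u hu, hix u' hu'] with N hN hi hj
    obtain ⟨hN, hb⟩ := hN
    have hNp : Oo < N := Ec hN
    obtain ⟨s, D⟩ := H.sol N hN
    set i := ix N u
    set j := ix N u'
    have hmid : ∀ m, min i j ≤ m → m ≤ max i j → |m&/N - u0| ≤ ag ∧ |((m+1:ℕ):Re)/N - u0| ≤ ag := by
      intro m hm1 hm2
      have a1 : min i& j ≤ m := Ec hm1
      have a2 : m& ≤ max i& j := Ec hm2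
      simp only [Ar, Nat.cast_add, Nat.cast_one, add_div] at hi hj ⊢
      have b1 : min (i&/N) (j/N) ≤ m/N := by rw [min_div_div_right hNp.le]; gcongr
      have b2 : m&/N ≤ max (i&/N) (j/N) := by rw [max_div_div_right hNp.le]; gcongr
      rcases min_le_iff.1 b1 with c1 | c1 <;> rcases le_max_iff.1 b2 with c2 | c2 <;>
        exact ⟨⟨by linarith [hi.1.1, hj.1.1], by linarith [hi.1.2, hj.1.2]⟩, by linarith [hi.2.1, hj.2.1], by linarith [hi.2.2, hj.2.2]⟩
    have step : ∀ m, min i j ≤ m → m < max i j → |P k N m~ t - P k N m t| ≤ C / N := by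
      intro m hm1 hm2
      have hb' := hb m~ (hmid m hm1 hm2.le).2
      have e := D.dVk ab Po k (i := m) hb'.2.1 (hI ht)
      have : P k N m~ t - P k N m t = iteratedDeriv k~ (v N m~) t / N := by
        rw [e]; simp only [hP]; field_simp; ring
      rw [this, abs_div, Ag hNp]
      gcongr
      exact ((hb'.2.2 t (hd.1 ht).le).2 k~ hk).2
    have lipP : ∀ n m, min i j ≤ m → m + n ≤ max i j → |P k N (m+n) t - P k N m t| ≤ C * (n / N) := by
      intro n m hm
      induction n with
      | zero => intro _; simp
      | succ n ih =>
        intro hn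
        have i1 := ih Om
        have i2 := step (m+n) Om Om
        rw [← add_assoc]
        calc _ ≤ |P k N (m+n+1) t - P k N (m+n) t| + |P k N (m+n) t - P k N m t| := abs_sub_le _ _ _
          _ ≤ C / N + C * (n/N) := add_le_add i2 i1
          _ = _ := by push_cast; ring
    apply disc_taylor (f := fun m => Yk Ps (v N) k m t) (g := fun m => P k N m t) hNp
    · intro m _ _; simp only [hP]; field_simp
    · intro m hm1 hm2
      rw [abs_div, Ag hNp]
      rcases Er i m with h | h
      · obtain ⟨n, rfl⟩ := Cu h
        refine (lipP n i Om Om).trans ?_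
        gcongr
        have : i& + n ≤ j := by exact_mod_cast (by omega : i + n ≤ j)
        exact le_trans Li (Cf _)
      · obtain ⟨n, hn⟩ := Cu h
        rw [Br, hn]
        refine (lipP n m Om Om).trans ?_
        gcongr
        rcases Dn n with h0 | h0
        · subst h0; simp
        have : j& ≤ m := by exact_mod_cast (by omega : j ≤ m)
        push_cast
        rw [Br]
        exact le_trans Li (Cf _)
  have ty : ∀ k ≤ K, ∀ u ∈ Ioo (u0-ag) (u0+ag), ∀ t ∈ Ioo (ts-ag) (ts+ag), Tendsto (fun N => Yk Ps (v N) k (ix N u) t) ar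
      (𝓝 (ul fun N => Yk Ps (v N) k (ix N u) t)) := by
    intro k hk u hu t ht
    apply ul_lim C
    filter_upwards [hloc, hix u hu] with N hN hi
    exact (((hN.2 _ hi.1).2.2 t (hd.1 ht).le).2 k hk).1
  have tp : ∀ k, k + 1 ≤ K → ∀ u ∈ Ioo (u0-ag) (u0+ag), ∀ t ∈ Ioo (ts-ag) (ts+ag), Tendsto (fun N => P k N (ix N u) t) ar
      (𝓝 (ul fun N => P k N (ix N u) t)) := by
    intro k hk u hu t ht
    obtain ⟨u', hu', hne⟩ : ∃ u' ∈ Ioo (u0-ag) (u0+ag), u' - u ≠ 0 := by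
      rcases Er u u0 with h | h
      · exact ⟨u0 + ag/2, ⟨Li, Li⟩, Li⟩
      · exact ⟨u0 - ag/2, ⟨Li, Li⟩, Li⟩
    set w := |u' - u| / 2 with hw
    have hwp : 0 < w := Po
    apply ul_lim ((2 * C + C * (3 * w) * (3 * w)) / w)
    have hab := (H.dix (hJ hu) (hJ hu')).abs
    filter_upwards [hloc, hix u hu, hix u' hu', tay k hk u hu u' hu' t ht, hab.eventually (lt_mem_nhds (show w < |u'-u| by linarith)),
      hab.eventually (Ce (show |u'-u| < 3 * w by linarith))] with N hN hi hj h5 h6 h7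
    have a1 := Ar.1 (((hN.2 _ hi.1).2.2 t (hd.1 ht).le).2 k Om).1
    have a2 := Ar.1 (((hN.2 _ hj.1).2.2 t (hd.1 ht).le).2 k Om).1
    set q := ((ix N u' : Re) - ix N u) / N
    have a3 : C * |q| * |q| ≤ C * (3*w) * (3*w) := by gcongr
    have a4 : |q * P k N (ix N u) t| ≤ 2 * C + C * (3*w) * (3*w) := by
      have := Ar.1 h5
      rw [Ar]; constructor <;> linarith
    rw [abs_mul] at a4
    rw [Ap hwp]
    have : w * |P k N (ix N u) t| ≤ |q| * |P k N (ix N u) t| := by gcongr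
    linarith
  refine ⟨ag, ba, C, hC, h1, h2, h3, h4, fun k u t => ul fun N => Yk Ps (v N) k (ix N u) t, fun k u t => ul fun N => P k N (ix N u) t, ?_⟩
  intro u hu t ht
  have htI : t ∈ Jc := ⟨(hI ht).1.le, (hI ht).2.le⟩
  have hlow : ah ≤ lv v u t := by
    refine Dl (H.tv htI u) ?_
    filter_upwards [hloc, hix u hu] with N hN hi
    exact ((hN.2 _ hi.1).2.2 t (hd.1 ht).le).1
  refine ⟨?_, ay.trans_le hlow, ?_, ?_⟩
  · refine tendsto_nhds_unique (ty 0 (Nat.zero_le _) u hu t ht) ?_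
    simp only [Yk, iteratedDeriv_zero]
    refine (H.psi.cont _ (ay.le.trans hlow)).tendsto.comp (Bt.2 ⟨H.tv htI u, ?_⟩)
    exact U_ev ((Ao 1).mono fun N hN => (H.vmem hN (ix_lt hN u).le htI).1)
  · intro k hk t' ht'
    refine le_of_tendsto (((ty k Om u hu t' ht').sub (ty k Om u hu t ht)).sub
      ((ty k~ Om u hu t ht).const_mul (t'-t))).abs ?_
    filter_upwards [hloc, hix u hu] with N hN hi
    obtain ⟨hN, hb⟩ := hN
    obtain ⟨s, D⟩ := H.sol N hN
    obtain ⟨_, hiN, hb⟩ := hb _ hi.1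
    set i := ix N u
    have hsub : uIcc t t' ⊆ Ioo (ts-ag) (ts+ag) := ordConnected_Ioo.uIcc_subset ht ht'
    have hder : ∀ k, ∀ r ∈ uIcc t t', HasDerivWithinAt (Yk Ps (v N) k i) (Yk Ps (v N) k~ i r) (uIcc t t') r := fun k r hr =>
      (D.dYk ab Po k hiN.le (hI (hsub hr))).hasDerivWithinAt
    have hl : ∀ r ∈ uIcc t t', |Yk Ps (v N) k~ i r - Yk Ps (v N) k~ i t| ≤ C * |t' - t| := by
      intro r hr
      refine ((convex_uIcc t t').norm_image_sub_le_of_norm_hasDerivWithin_le (hder k~) (fun r hr =>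
        ((hb r (hd.1 (hsub hr)).le).2 k~~ hk).1) Ea hr).trans ?_
      gcongr
      exact Ei hr
    have := (convex_uIcc t t').norm_image_sub_le_of_norm_hasDerivWithin_le
      (f := fun r => Yk Ps (v N) k i r - r * Yk Ps (v N) k~ i t) (fun r hr => (hder k r hr).sub
        ((Af r).mul_const (Yk Ps (v N) k~ i t)).hasDerivWithinAt) (C := C * |t'-t|) (fun r hr => by
          rw [one_mul]; exact hl r hr) Ea right_mem_uIcc
    refine le_trans (le_of_eq ?_) this
    rw [Bd]; congr 1; ring
  · intro k hk u' hu'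
    have hdx := H.dix (hJ hu) (hJ hu')
    exact Bp (((ty k Om u' hu' t ht).sub (ty k Om u hu t ht)).sub
      (hdx.mul (tp k hk u hu t ht))).abs ((hdx.abs.const_mul C).mul hdx.abs) (tay k hk u hu u' hu' t ht)
end
abbrev LD (A B : Rp → Re) (U : Set (Rp)) (e : Rp) : Prop := ∀ p ∈ U, HasLineDerivAt Re A (B p) p e
theorem ld_line {A : Rp → Re} {b h : Re} {p e : Rp} (H : HasLineDerivAt Re A b (p + h • e) e) :
    Dv (fun s => A (p + s • e)) b h := by
  unfold HasLineDerivAt at H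
  have h1 : Dv (fun s : Re => s - h) 1 h := (Af h).sub_const h
  have := HasDerivAt.comp h (h₂ := fun t : Re => A (p + h • e + t • e)) (by rw [sub_self]; exact H) h1
  rw [mul_one] at this
  refine this.congr_of_eventuallyEq (Ep fun s => ?_)
  simp only [Function.comp]; congr 1; rw [add_assoc, ← add_smul]; congr 2; ring
theorem nhds_line {U : Set (Rp)} (hU : IsOpen U) {p : Rp} (hp : p ∈ U) (e : Rp) : ∀ᶠ h : Re in 𝓝 0, p + h • e ∈ U := by
  have : Continuous fun h : Re => p + h • e := Fu
  exact this.continuousAt.eventually (hU.mem_nhds (Sx hp))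
theorem ld_taylor {A B : Rp → Re} {U : Set (Rp)} {e : Rp} {C : Re} (hC : 0 ≤ C) (hU : IsOpen U)
    (h : ∀ p ∈ U, ∀ h : Re, p + h • e ∈ U → |A (p + h • e) - A p - h * B p| ≤ C * |h| * |h|) :
    LD A B U e ∧ (Co A U → Co B U) := by
  constructor
  · intro p hp
    rw [hasLineDerivAt_iff_isLittleO_nhds_zero, Fi]
    intro c hc
    have : ∀ᶠ h : Re in 𝓝 0, |h| < c / C~ := by
      have := continuous_abs.tendsto Oo
      rw [abs_zero] at this
      exact this.eventually (Ce Po)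
    filter_upwards [nhds_line hU hp e, this] with s hs hs2
    refine (h p hp s hs).trans ?_
    rw [Es Po] at hs2
    exact Ae (by nlinarith [abs_nonneg s]) (abs_nonneg s)
  · intro hA p0 hp0
    apply ContinuousAt.continuousWithinAt
    apply continuousAt_of_locally_uniform_approx_of_continuousAt
    intro V hV
    obtain ⟨ah, ay, hV⟩ := Metric.mem_uniformity_dist.1 hV
    obtain ⟨s, hs⟩ := (((nhds_line hU hp0 e).filter_mono Da).and
      (Ioo_mem_nhdsGT (show Oo < ah / C~ by positivity))).exists
    obtain ⟨hs1, hs2, hs3⟩ := hs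
    have hcs : Continuous fun p : Rp => p + s • e := Fu
    refine ⟨U ∩ (fun p => p + s • e) ⁻¹' U, Filter.inter_mem (hU.mem_nhds hp0) (hcs.continuousAt.preimage_mem_nhds (hU.mem_nhds hs1)),
      fun p => (A (p + s • e) - A p) / s, ?_, ?_⟩
    · refine ContinuousAt.div_const (ContinuousAt.sub ?_ (hA.continuousAt (hU.mem_nhds hp0))) s
      exact ContinuousAt.comp (f := fun p : Rp => p + s • e) (g := A) (hA.continuousAt (hU.mem_nhds hs1)) hcs.continuousAt
    · rintro p ⟨hp, hps⟩
      apply hV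
      have := h p hp s hps
      rw [Ag hs2] at this
      rw [Bb, Br, show (A (p + s • e) - A p) / s - B p = (A (p + s • e) - A p - s * B p) / s by field_simp,
        abs_div, Ag hs2, div_lt_iff₀ hs2]
      rw [Es Po] at hs3
      refine this.trans_lt (mul_lt_mul_of_pos_right ?_ hs2)
      nlinarith
theorem ld_comm {F F1 F2 F12 : Rp → Re} {U : Set (Rp)} (hU : IsOpen U) {a b : Rp} (h1 : LD F F1 U a) (h2 : LD F F2 U b)
    (h12 : LD F1 F12 U b) (hc : Co F12 U) : LD F2 F12 U a := by
  intro p hp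
  rw [hasLineDerivAt_iff_isLittleO_nhds_zero, Fi]
  intro c hcp
  have hcont : Continuous fun q : Rp => p + q.1 • a + q.2 • b := Fu
  have h0 : (fun q : Rp => p + q.1 • a + q.2 • b) 0 = p := Si
  have ev : ∀ᶠ q : Rp in 𝓝 0, p + q.1 • a + q.2 • b ∈ U ∧ |F12 (p + q.1 • a + q.2 • b) - F12 p| < c := by
    have e1 : ∀ᶠ x in 𝓝 p, x ∈ U := hU.mem_nhds hp
    have e2 : ∀ᶠ x in 𝓝 p, |F12 x - F12 p| < c := (hc.continuousAt (hU.mem_nhds hp)).eventually (Cp _ hcp)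
    exact (hcont.tendsto' 0 p h0).eventually (e1.and e2)
  obtain ⟨ad, ak, hball⟩ := Metric.eventually_nhds_iff_ball.1 ev
  have hb : ∀ s r : Re, |s| < ad → |r| < ad → p + s • a + r • b ∈ U ∧ |F12 (p + s • a + r • b) - F12 p| ≤ c := by
    intro s r hs hr
    have := hball (s, r) (by simp [Prod.norm_def, hs, hr])
    exact ⟨this.1, this.2.le⟩
  have hz : ∀ s, |s| < ad → p + s • a ∈ U := fun s hs => by simpa using (hb s 0 hs (Sx ak)).1
  filter_upwards [Cp Oo ak] with s hs
  rw [mem_ball_zero_iff, Bd] at hs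
  have hsub : ∀ {x y : Re}, |x| < ad → y ∈ uIcc 0 x → |y| < ad := fun hx hy => by
    have := Ei hy; simp only [sub_zero] at this; linarith
  have key : ∀ r, |r| < ad → |(F (p + s • a + r • b) - F (p + s • a)) - (F (p + r • b) - F p) - s * (r * F12 p)| ≤ c * |r| * |s| := by
    intro r hr
    have hin : ∀ x, |x| < ad → |F1 (p + x • a + r • b) - F1 (p + x • a) - r * F12 p| ≤ c * |r| := by
      intro x hx
      have := (convex_uIcc 0 r).norm_image_sub_le_of_norm_hasDerivWithin_le (f := fun y => F1 (p + x • a + y • b) - y * F12 p)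
        (f' := fun y => F12 (p + x • a + y • b) - 1 * F12 p) (C := c) (fun y hy =>
          ((ld_line (h12 _ (hb x y hx (hsub hr hy)).1)).sub ((Af y).mul_const _)).hasDerivWithinAt)
        (fun y hy => by rw [one_mul]; exact (hb x y hx (hsub hr hy)).2) Ea right_mem_uIcc
      simp only [zero_smul, add_zero, zero_mul, sub_zero, Bd] at this
      rwa [sub_right_comm]
    have h1' : ∀ x, |x| < ad → Dv (fun x => F (p + x • a + r • b)) (F1 (p + x • a + r • b)) x := by
      intro x hx
      have e : ∀ x : Re, p + x • a + r • b = (p + r • b) + x • a := fun x => by abel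
      simp only [e]
      exact ld_line (h1 _ (by rw [← e]; exact (hb x r hx hr).1))
    have := (convex_uIcc 0 s).norm_image_sub_le_of_norm_hasDerivWithin_le
      (f := fun x => F (p + x • a + r • b) - F (p + x • a) - x * (r * F12 p))
      (f' := fun x => F1 (p + x • a + r • b) - F1 (p + x • a) - 1 * (r * F12 p)) (C := c * |r|) (fun x hx =>
        (((h1' x (hsub hs hx)).sub (ld_line (h1 _ (hz x (hsub hs hx))))).sub ((Af x).mul_const _)).hasDerivWithinAt)
      (fun x hx => by rw [one_mul]; exact hin x (hsub hs hx)) Ea right_mem_uIcc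
    simp only [zero_smul, add_zero, zero_mul, sub_zero, Bd] at this
    rwa [sub_right_comm]
  have t1 := (h2 _ (hz s hs)).tendsto_slope_zero
  have t2 := (h2 _ hp).tendsto_slope_zero
  have t3 := ((t1.sub t2).sub_const (s * F12 p)).abs
  refine le_of_tendsto t3 ?_
  have : ∀ᶠ r in 𝓝[≠] Oo, |r| < ad := Da (by simpa [Bd, Metric.ball, dist_zero_right] using Cp Oo ak)
  filter_upwards [this, Bi] with r hr hr0
  have hr0 : r ≠ 0 := hr0
  have k := key r hr
  have e : r⁻¹ • (F (p + s • a + r • b) - F (p + s • a)) - r⁻¹ • (F (p + r • b) - F p) - s * F12 p =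
     ((F (p + s • a + r • b) - F (p + s • a)) - (F (p + r • b) - F p) - s * (r * F12 p)) / r := by
    simp only [smul_eq_mul]; field_simp
  rw [e, abs_div, Ci (abs_pos.2 hr0), Bd]
  linarith
theorem cd_succ {F F1 F2 : Rp → Re} {U : Set (Rp)} (hU : IsOpen U) (h1 : LD F F1 U (1,0)) (h2 : LD F F2 U (0,1)) (n : ℕ)
    (c1 : ContDiffOn Re n F1 U) (c2 : ContDiffOn Re n F2 U) : ContDiffOn Re (n+1 : ℕ) F U := by
  have d1 : ∀ p ∈ U, Dv (fun x => F (x, p.2)) (F1 p) p.1 := fun p hp => by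
    have := ld_line (A := F) (p := (0, p.2)) (h := p.1) (e := (1,0)) (b := F1 p) (by simpa using h1 p hp)
    simpa using this
  have d2 : ∀ p ∈ U, Dv (fun x => F (p.1, x)) (F2 p) p.2 := fun p hp => by
    have := ld_line (A := F) (p := (p.1, 0)) (h := p.2) (e := (0,1)) (b := F2 p) (by simpa using h2 p hp)
    simpa using this
  set f1 : Re → Re → Re →L[Re] Re := fun x y => ContinuousLinearMap.toSpanSingleton Re (F1 (x,y))
  set f2 : Re → Re → Re →L[Re] Re := fun x y => ContinuousLinearMap.toSpanSingleton Re (F2 (x,y))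
  have hcl : Continuous fun a : Re => ContinuousLinearMap.toSpanSingleton Re a :=
    (ContinuousLinearMap.toSpanSingletonCLE (𝕜 := Re) (E := Re)).continuous
  have hst : ∀ p ∈ U, HasFDerivAt F ((f1 p.1 p.2).coprod (f2 p.1 p.2)) p := by
    intro p hp
    have hev : ∀ᶠ q in 𝓝 p, q ∈ U := hU.mem_nhds hp
    exact (hasStrictFDerivAt_uncurry_coprod (𝕜 := Re) (u := p) (f := fun x y => F (x,y)) (f₁ := f1) (f₂ := f2)
      (hev.mono fun q hq => (d1 q hq).hasFDerivAt) (hev.mono fun q hq => (d2 q hq).hasFDerivAt)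
      (ContinuousAt.comp (f := F1) (g := fun a => ContinuousLinearMap.toSpanSingleton Re a) hcl.continuousAt (c1.continuousOn.continuousAt (hU.mem_nhds hp)))
      (ContinuousAt.comp (f := F2) (g := fun a => ContinuousLinearMap.toSpanSingleton Re a) hcl.continuousAt (c2.continuousOn.continuousAt (hU.mem_nhds hp)))).hasFDerivAt
  push_cast
  rw [contDiffOn_succ_iff_hasFDerivWithinAt_of_uniqueDiffOn hU.uniqueDiffOn]
  refine ⟨Si, fun p => (f1 p.1 p.2).coprod (f2 p.1 p.2), ?_, fun p hp => (hst p hp).hasFDerivWithinAt⟩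
  rw [contDiffOn_clm_apply]
  intro y
  have : (fun p : Rp => ((f1 p.1 p.2).coprod (f2 p.1 p.2)) y) = fun p => y.1 * F1 p + y.2 * F2 p := by
    ext p; simp [f1, f2]
  rw [this]
  exact (contDiffOn_const.mul c1).add (contDiffOn_const.mul c2)
def TC (U : Set (Rp)) (n : ℕ) : ℕ → (Rp → Re) → Prop
  | 0, f => ContDiffOn Re n f U
  | j+1, f => ContDiffOn Re n f U ∧ ∃ f', TC U n j f' ∧ LD f f' U (0,1)
section
variable {U : Set (Rp)} {n : ℕ}
theorem TC.cd : ∀ {j} {f : Rp → Re}, TC U n j f → ContDiffOn Re n f U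
  | 0, _, h => h
  | _+1, _, h => h.1
theorem TC.mono : ∀ {j} {f : Rp → Re}, TC U n j~ f → TC U n j f
  | 0, _, h => h.1
  | _+1, _, ⟨h, f', h1, h2⟩ => ⟨h, f', h1.mono, h2⟩
theorem TC.add : ∀ {j} {f g : Rp → Re}, TC U n j f → TC U n j g → TC U n j (f + g)
  | 0, _, _, h, h' => ContDiffOn.add h h'
  | _+1, _, _, ⟨h, f', h1, h2⟩, ⟨k, g', k1, k2⟩ => ⟨h.add k, f' + g', h1.add k1, fun p hp => HasDerivAt.add (h2 p hp) (k2 p hp)⟩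
theorem TC.mul : ∀ {j} {f g : Rp → Re}, TC U n j f → TC U n j g → TC U n j (f * g)
  | 0, _, _, h, h' => ContDiffOn.mul h h'
  | _+1, f, g, H@⟨h, f', h1, h2⟩, K@⟨k, g', k1, k2⟩ => ⟨h.mul k, f' * g + f * g', (h1.mul (TC.mono K)).add ((TC.mono H).mul k1), fun p hp => by
      have := HasDerivAt.mul (h2 p hp) (k2 p hp)
      simp only [zero_smul, add_zero] at this
      exact this⟩
theorem TC.comp {O : Set Re} (hO : IsOpen O) : ∀ {j} {g : Fn} {y : Rp → Re}, ContDiffOn Re (⊤:ℕ∞) g O → (∀ p ∈ U, y p ∈ O) → TC U n j y → TC U n j (g ∘ y)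
  | 0, _, _, hg, hy, h => ContDiffOn.comp (hg.of_le (Ec le_top)) h hy
  | _+1, g, y, hg, hy, H@⟨h, y', h1, h2⟩ => ⟨ContDiffOn.comp (hg.of_le (Ec le_top)) h hy, (deriv g ∘ y) * y',
      (TC.comp hO (hg.deriv_of_isOpen hO Si) hy (TC.mono H)).mul h1, fun p hp => by
      have hd : Dv g (deriv g (y p)) (y p) := ((hg.contDiffAt (hO.mem_nhds (hy p hp))).differentiableAt Si).hasDerivAt
      exact HasDerivAt.comp (h := fun t : Re => y (p + t • (0,1))) 0 (Sx hd) (h2 p hp)⟩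
theorem TC.of_chain : ∀ {j} {w : ℕ → Rp → Re}, (∀ i ≤ j, ContDiffOn Re n (w i) U) → (∀ i < j, LD (w i) (w i~) U (0,1)) → TC U n j (w 0)
  | 0, _, h, _ => h 0 Ad
  | _+1, w, h, h' => ⟨h 0 Om, w 1, TC.of_chain (w := fun i => w i~) (fun i hi => h i~ Om) (fun i hi => h' i~ Om), h' 0 Om⟩
theorem TC.chain (hU : IsOpen U) : ∀ {j} {f : Rp → Re} {w : ℕ → Rp → Re}, TC U n j f → EqOn (w 0) f U → (∀ i < j, LD (w i) (w i~) U (0,1)) →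
    ContDiffOn Re n (w j) U
  | 0, _, _, h, he, _ => ContDiffOn.congr h he
  | _+1, _, w, ⟨_, f', h1, h2⟩, he, hw => TC.chain hU (w := fun i => w i~) h1 (fun p hp => by
      have := HasDerivAt.congr_of_eventuallyEq (hw 0 Om p hp) ((nhds_line hU hp (0,1)).mono fun t ht => (he ht).symm)
      exact HasDerivAt.unique this (h2 p hp)) (fun i hi => hw i~ Om)
theorem TC.exists_chain : ∀ {j} {f : Rp → Re}, TC U n j f → ∃ w : ℕ → Rp → Re, w 0 = f ∧ (∀ i ≤ j, ContDiffOn Re n (w i) U) ∧ ∀ i < j, LD (w i) (w i~) U (0,1)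
  | 0, f, h => ⟨fun _ => f, rfl, fun _ _ => h, fun i hi => Om⟩
  | _+1, f, ⟨h, f', h1, h2⟩ => by
      obtain ⟨w, hw, hc, hl⟩ := TC.exists_chain h1
      refine ⟨fun i => Nat.casesOn i f w, rfl, fun i hi => ?_, fun i hi => ?_⟩
      · cases i with
        | zero => exact h
        | succ i => exact hc i Om
      · cases i with
        | zero => simpa [hw] using h2
        | succ i => exact hl i Om
theorem cd_boot (hU : IsOpen U) {S X : Rp → Re} {G : Fn} {O : Set Re} (hO : IsOpen O) (hG : ContDiffOn Re (⊤:ℕ∞) G O) (n : ℕ)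
    {y p : ℕ → Rp → Re} (cy : ∀ k, k ≤ n + 1 → Co (y k) U) (cp : ∀ k, k ≤ n + 1 → Co (p k) U)
    (hy : ∀ q ∈ U, y 0 q ∈ O) (yt : ∀ k ≤ n, LD (y k) (y k~) U (0,1)) (yu : ∀ k ≤ n + 1, LD (y k) (p k) U (1,0))
    (St : LD S (y 0) U (0,1)) (Su : LD S X U (1,0)) (Xu : LD X (G ∘ y 0) U (1,0)) :
    LD X (p 0) U (0,1) ∧ ContDiffOn Re (n+1:ℕ) X U := by
  have pt : ∀ k ≤ n, LD (p k) (p k~) U (0,1) := fun k hk => ld_comm hU (yt k hk) (yu k Om) (yu k~ Om) (cp _ Om)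
  have Xt : LD X (p 0) U (0,1) := ld_comm hU St Su (yu 0 Om) (cp 0 Om)
  obtain ⟨w, w0, wc, wl⟩ := ((TC.of_chain (n := 0) (j := n+1) (fun i hi => by simpa using cy i hi) (fun i hi => yt i Om)).comp hO hG hy).exists_chain
  have wc' : ∀ i ≤ n+1, Co (w i) U := fun i hi => (wc i hi).continuousOn
  have pu : ∀ k ≤ n, LD (p k) (w k~) U (1,0) := by
    intro k hk
    induction k with
    | zero => exact ld_comm hU (w0 ▸ Xu) Xt (wl 0 Om) (wc' 1 Om)
    | succ k ih => exact ld_comm hU (ih Om) (pt k Om) (wl k~ Om) (wc' _ Om)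
  have main : ∀ m k : ℕ, k + m ≤ n + 1 → ContDiffOn Re m (y k) U ∧ ContDiffOn Re m (p k) U := by
    intro m
    induction m with
    | zero => intro k hk; simpa using ⟨cy k hk, cp k hk⟩
    | succ m ih =>
      intro k hk
      have hw : ContDiffOn Re m (w k~) U :=
        ((TC.of_chain (j := k+1) (fun i hi => (ih i Om).1) (fun i hi => yt i Om)).comp hO hG hy).chain hU
          (by rw [w0]; exact fun _ _ => rfl) (fun i hi => wl i Om)
      exact ⟨cd_succ hU (yu k Om) (yt k Om) m (ih k Om).2 (ih k~ Om).1,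
        cd_succ hU (pu k Om) (pt k Om) m hw (ih k~ Om).2⟩
  refine ⟨Xt, cd_succ hU Xu Xt n ?_ (main n 0 Om).2⟩
  exact (hG.of_le (Ec le_top)).comp (main n 0 Om).1 hy
end
section
variable {Ps X0 : Fn} {M : Re} {S v : ℕ → ℕ → Fn} (H : ASeq Ps M X0 S v)
include H
theorem ASeq.lX_deriv {u t : Re} (hu : u ∈ Io) (ht : t ∈ Ioc Oo 2) : Dv (fun u => lX S u t) (lv v u t) u := by
  rw [Dk, Fi]
  intro c hc
  obtain ⟨ad, ak, h⟩ := H.lX_taylor ht.1 hc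
  filter_upwards [Bk hu.1 hu.2, Cp u ak] with x hx hx'
  exact h u ⟨hu.1.le, hu.2.le⟩ x ⟨hx.1.le, hx.2.le⟩ hx' t ⟨Ad, ht.2⟩
theorem ASeq.lS_deriv {u t : Re} (hu : u ∈ I) (ht : t ∈ Jo) : Dv (fun t => lS S u t) (Ps (lv v u t)) t := by
  rw [Dk, Fi]
  intro c hc
  obtain ⟨ad, ak, h⟩ := H.lS_taylor_time (half_pos ht.1) hc
  filter_upwards [Bk (El ht.1) ht.2, Cp t ak] with x hx hx'
  exact h u hu t ⟨(El ht.1).le, ht.2⟩ x ⟨hx.1.le, hx.2⟩ hx'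
theorem ASeq.lv_cont {p : Rp} (hu : p.1 ∈ Io) (ht : p.2 ∈ Jo) : ContinuousAt (fun q : Rp => lv v q.1 q.2) p := by
  rw [Metric.continuousAt_iff]
  intro e he
  obtain ⟨ad, ak, h⟩ := H.lv_equi (half_pos ht.1) (half_pos he)
  obtain ⟨ad', ak', h'⟩ := Metric.eventually_nhds_iff.1 (prod_mem_nhds (Bk hu.1 hu.2) (Bk (El ht.1) ht.2))
  refine ⟨min ad ad', Eb ak ak', fun {q} hq => ?_⟩
  have hq' := h' (hq.trans_le (Al _ _))
  have hq2 := max_lt_iff.1 (hq.trans_le (Am _ _))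
  refine (h _ ⟨hq'.1.1.le, hq'.1.2.le⟩ _ ⟨hu.1.le, hu.2.le⟩ hq2.1 _ ⟨hq'.2.1.le, hq'.2.2.le⟩ _ ⟨(El ht.1).le, ht.2.le⟩ hq2.2.le).trans_lt (El he)
theorem ASeq.lX_smooth {u0 ts : Re} (hu : u0 ∈ Io) (ht : ts ∈ Jo) (hv : 0 < lv v u0 ts) :
    ContDiffAt Re (⊤:ℕ∞) (fun p : Rp => lX S p.1 p.2) (u0, ts) ∧
    ∃ d, Dv (fun u => Ps (lv v u ts)) d u0 ∧ Dv (fun t => lX S u0 t) d ts := by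
  have ab := H.psi
  obtain ⟨G, hO, hG, dk, -⟩ := ab.inv
  have key : ∀ n : ℕ, ContDiffAt Re (n+1:ℕ) (fun p : Rp => lX S p.1 p.2) (u0, ts) ∧
      ∃ d, Dv (fun u => Ps (lv v u ts)) d u0 ∧ Dv (fun t => lX S u0 t) d ts := by
    intro n
    obtain ⟨ag, ba, C, hC, r1, r2, r3, r4, y, p, hyp⟩ := H.loc_lim hu ht hv n~~
    set U : Set (Rp) := Ioo (u0-ag) (u0+ag) ×ˢ Ioo (ts-ag) (ts+ag)
    have hU : IsOpen U := Cn.prod Cn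
    have hpU : (u0, ts) ∈ U := ⟨⟨by simp [ba], by simp [ba]⟩, ⟨by simp [ba], by simp [ba]⟩⟩
    have hU1 : ∀ q ∈ U, q.1 ∈ Io := fun q hq => ⟨Lx hq.1.1, Lx hq.1.2⟩
    have hU2 : ∀ q ∈ U, q.2 ∈ Jo := fun q hq => ⟨Lx hq.2.1, Lx hq.2.2⟩
    have hyt : ∀ k ≤ n, _ := fun k hk => ld_taylor (A := fun q => y k q.1 q.2) (B := fun q => y k~ q.1 q.2) (e := (0,1)) hC hU (fun q hq h hqh => by
      have := (hyp q.1 hq.1 q.2 hq.2).2.2.1 k Om (q.2 + h) (Sx hqh.2)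
      simpa using this)
    have hyu : ∀ k ≤ n+1, _ := fun k hk => ld_taylor (A := fun q => y k q.1 q.2) (B := fun q => p k q.1 q.2) (e := (1,0)) hC hU (fun q hq h hqh => by
      have := (hyp q.1 hq.1 q.2 hq.2).2.2.2 k Om (q.1 + h) (Sx hqh.1)
      simpa using this)
    have cy : ∀ k, k ≤ n + 1 → Co (fun q : Rp => y k q.1 q.2) U := by
      intro k
      induction k with
      | zero =>
        intro _
        refine ContinuousOn.congr (f := fun q : Rp => Ps (lv v q.1 q.2)) (fun q hq => ?_) fun q hq => (hyp q.1 hq.1 q.2 hq.2).1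
        exact (ContinuousAt.comp (f := fun q : Rp => lv v q.1 q.2) (g := Ps) (ab.hasDerivAt (hyp q.1 hq.1 q.2 hq.2).2.1).continuousAt
          (H.lv_cont (hU1 q hq) (hU2 q hq))).continuousWithinAt
      | succ k ih => intro hk; exact (hyt k Om).2 (ih Om)
    have hb := cd_boot hU (S := fun q => lS S q.1 q.2) (X := fun q => lX S q.1 q.2) hO hG n (y := fun k q => y k q.1 q.2) (p := fun k q => p k q.1 q.2)
      cy (fun k hk => (hyu k hk).2 (cy k hk)) (fun q hq => by simp only [(hyp q.1 hq.1 q.2 hq.2).1]; exact ⟨_, (hyp q.1 hq.1 q.2 hq.2).2.1, rfl⟩)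
      (fun k hk => (hyt k hk).1) (fun k hk => (hyu k hk).1)
      (fun q hq => by
        have := H.lS_deriv ⟨(hU1 q hq).1.le, (hU1 q hq).2.le⟩ (hU2 q hq)
        rw [← (hyp q.1 hq.1 q.2 hq.2).1] at this
        have := HasDerivAt.comp (h := fun s : Re => q.2 + s) 0 (Sx this) ((Af 0).const_add q.2)
        simpa [HasLineDerivAt, Function.comp_def] using this)
      (ld_taylor (by linarith [H.hM] : 0 ≤ M + 1) hU (fun q hq h hqh => by
        have h1 := hU1 q hq
        have h2 := hU1 _ hqh
        have := H.lS_taylor (t := q.2) ⟨(hU2 q hq).1.le, (hU2 q hq).2.le⟩ ⟨h1.1.le, h1.2.le⟩ ⟨h2.1.le, h2.2.le⟩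
        simpa using this)).1
      (fun q hq => by
        have h2 := hU2 q hq
        have := H.lX_deriv (hU1 q hq) ⟨h2.1, h2.2.le⟩
        rw [← dk _ (hyp q.1 hq.1 q.2 hq.2).2.1, ← (hyp q.1 hq.1 q.2 hq.2).1] at this
        have := HasDerivAt.comp (h := fun s : Re => q.1 + s) 0 (Sx this) ((Af 0).const_add q.1)
        simpa [HasLineDerivAt, Function.comp_def] using this)
    refine ⟨hb.2.contDiffAt (hU.mem_nhds hpU), p 0 u0 ts, ?_, ?_⟩
    · have := ld_line (A := fun q : Rp => y 0 q.1 q.2) (p := (0, ts)) (h := u0) (e := (1,0)) (by simpa using (hyu 0 Om).1 _ hpU)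
      refine HasDerivAt.congr_of_eventuallyEq (Sx this) ?_
      filter_upwards [Bk hpU.1.1 hpU.1.2] with u hu
      exact (hyp u hu ts hpU.2).1.symm
    · have := ld_line (A := fun q : Rp => lX S q.1 q.2) (p := (u0, 0)) (h := ts) (e := (0,1)) (by simpa using hb.1 _ hpU)
      simpa using this
  exact ⟨contDiffAt_infty.2 fun n => (key n).1.of_le (by exact_mod_cast Nat.le_succ n), (key 0).2⟩
end
theorem left_max {f : Fn} {f' t a : Re} (h : Dv f f' t) (hat : a < t) (hm : ∀ s ∈ Ioo a t, f s ≤ f t) : 0 ≤ f' := by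
  have h1 := (hasDerivWithinAt_iff_tendsto_slope' (s := Iio t) Si).1 h.hasDerivWithinAt
  refine Dl h1 ?_
  filter_upwards [Ioo_mem_nhdsLT hat] with s hs
  rw [slope_def_field]
  exact div_nonneg_of_nonpos (by linarith [hm s hs]) (Lx hs.2)
theorem sq_low {g : ℕ → Re} {a : Re} {m : ℕ} (h0 : g 0 = 0) (h1 : 1 ≤ m → a ≤ g 1) (h : ∀ k, k + 2 ≤ m → 2 * a ≤ g k~~ - 2 * g k~ + g k) :
    ∀ k ≤ m, a * k^2 ≤ g k := by
  have d : ∀ k, k + 1 ≤ m → a * (2 * k + 1) ≤ g k~ - g k := by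
    intro k
    induction k with
    | zero => intro hk; have := h1 hk; simp [h0]; linarith
    | succ k ih => intro hk; have := ih Om; have := h k Om; push_cast; linarith
  intro k
  induction k with
  | zero => intro; simp [h0]
  | succ k ih => intro hk; have := ih Om; have := d k hk; push_cast; linarith
theorem conc {g : ℕ → Re} {m : ℕ} (h : ∀ k, k + 2 ≤ m → g k~~ - 2 * g k~ + g k ≤ 0) : ∀ k ≤ m, k * (g m - g 0) ≤ m * (g k - g 0) := by
  induction m with
  | zero => intro k hk; simp [Nat.le_zero.1 hk]
  | succ m ih =>
    intro k hk
    rcases hk.eq_or_lt with rfl | hk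
    · exact Ad
    have i1 := ih (fun k hk => h k Om) k Om
    have dm : ∀ j, ∀ k, k + j = m → g m~ - g m ≤ g k~ - g k := by
      intro j
      induction j with
      | zero => intro k hk; simp at hk; subst hk; exact Ad
      | succ j ih => intro k hk; have := ih k~ Om; have := h k Om; linarith
    have : ∀ k ≤ m, k * (g m~ - g m) ≤ g k - g 0 := by
      intro k
      induction k with
      | zero => intro; simp
      | succ k ih => intro hk; have := ih Om; have := dm (m-k) k Om; push_cast; linarith
    have := this k Om
    push_cast; linarith
section
variable {Ps : Fn} {n : ℕ} {K ac M b0 b1 : Re} {s : ℕ → Re} {S W : ℕ → Fn}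
theorem DSol.shift (D : DSol Ps n K ac M b0 b1 s S W) {h : Re} (hh : 0 ≤ h) :
    (∀ i ≤ n, Co (fun t => W i (h + t)) (Icc 0 (2-h))) ∧ ∀ i, i + 1 < n → ∀ t ∈ Ioo 0 (2-h),
    Dv (fun t => W i~ (h + t)) (K * (Ps (W i~~ (h+t)) - 2 * Ps (W i~ (h+t)) + Ps (W i (h+t)))) t :=
  ⟨fun i hi => (D.cv i hi).comp Fu fun t ht => ⟨Lx ht.1, Lx ht.2⟩,
    fun i hi t ht => (D.dv i hi (h+t) ⟨Lx ht.1, Lx ht.2⟩).comp_const_add h t⟩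
theorem DSol.anti (D : DSol Ps n K ac M b0 b1 s S W) (ab : PsiData Ps) (hK : 0 < K) (af : 0 < ac) (h0 : ∀ i, i + 1 < n → W i~ 0 = M) :
    ∀ i ≤ n, AntitoneOn (W i) (Icc 0 2) := by
  intro i hi t ht t' ht' h
  obtain ⟨c, d⟩ := D.shift (sub_nonneg.2 h)
  have := comparison ab n (T := 2 - (t'-t)) hK af (fun i ae => W i (t' - t + ae)) W
    (fun i hi ae aq => D.mem i hi _ ⟨Lx aq.1, Lx aq.2⟩) (fun i hi ae aq => D.mem i hi _ ⟨Lx aq.1, Lx aq.2⟩)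
    c (fun i hi => (D.cv i hi).mono (Bf Li)) d (fun i hi ae aq => D.dv i hi ae ⟨aq.1, Lx aq.2⟩)
    (fun i hi => by
      rcases i with _ | i
      · rw [D.vl, D.vl]
      rcases Cb i~ n with hl | hl
      · rw [h0 i hl]; exact (D.mem _ hi _ ⟨Li, by linarith [ht.1, ht'.2]⟩).2
      · rw [show i + 1 = n by omega, D.vr, D.vr]) (fun ae _ => by rw [D.vl, D.vl]) (fun ae _ => by rw [D.vr, D.vr]) i hi t ⟨ht.1, by linarith [ht'.2]⟩
  simpa using this
theorem DSol.incr (D : DSol Ps n K ac M b0 b1 s S W) (ab : PsiData Ps) (hK : 0 < K) (af : 0 < ac) (h0 : ∀ i, i + 1 < n → W i~ 0 = ac) :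
    ∀ i ≤ n, MonotoneOn (W i) (Icc 0 2) := by
  intro i hi t ht t' ht' h
  obtain ⟨c, d⟩ := D.shift (sub_nonneg.2 h)
  have := comparison ab n (T := 2 - (t'-t)) hK af W (fun i ae => W i (t' - t + ae))
    (fun i hi ae aq => D.mem i hi _ ⟨Lx aq.1, Lx aq.2⟩) (fun i hi ae aq => D.mem i hi _ ⟨Lx aq.1, Lx aq.2⟩)
    (fun i hi => (D.cv i hi).mono (Bf Li)) c (fun i hi ae aq => D.dv i hi ae ⟨aq.1, Lx aq.2⟩) d
    (fun i hi => by
      rcases i with _ | i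
      · rw [D.vl, D.vl]
      rcases Cb i~ n with hl | hl
      · rw [h0 i hl]; exact (D.mem _ hi _ ⟨Li, by linarith [ht.1, ht'.2]⟩).1
      · rw [show i + 1 = n by omega, D.vr, D.vr]) (fun ae _ => by rw [D.vl, D.vl]) (fun ae _ => by rw [D.vr, D.vr]) i hi t ⟨ht.1, by linarith [ht'.2]⟩
  simpa using this
end
theorem blockI {Ps H : Fn} (ab : PsiData Ps) (dH : ∀ a, 0 < a → Dv H (-(1 / Ps a)) a) (hH : ∀ C, ∃ a, 0 < a ∧ C < H a)
    {ah R : Re} (ay : 0 < ah) (hR : 0 < R) : ∃ cc : Re, 0 < cc ∧ ∀ (q N : ℕ) (ac : Re) (s : ℕ → Re) (S W : ℕ → Fn), 1 ≤ q → 0 < N → R ≤ ((2 * q : ℕ) : Re) / N →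
      0 < ac → (∀ i, s i = 1/2 * ah * ((i& - (2 * q : ℕ)) / N)^2) →
      DSol Ps (2 * q + 2 * q) (N&^2) ac ah ac ac s S W → ∀ t ∈ Jo, cc ≤ Ps (W (2*q) t) := by
  have Hanti : ∀ a b, 0 < a → a ≤ b → H b ≤ H a := fun a b ha hab => by
    have := anti_hd (f := H) (a := a) (b := b) (f' := fun a => -(1 / Ps a)) (fun t ht => (dH t (ha.trans_le ht.1)).continuousAt.continuousWithinAt)
      (fun t ht => dH t (ha.trans ht.1)) (fun t ht => by have := ab.pos (ha.trans ht.1); simp; positivity)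
    exact this ⟨Ad, hab⟩ ⟨hab, Ad⟩ hab
  obtain ⟨a1, ha1, hHa⟩ := hH (H (4 * ah) + 16 / R^2 * 2)
  refine ⟨1/2 * Ps (a1 / 8), by have := ab.pos (show 0 < a1 / 8 by positivity); positivity, ?_⟩
  intro q N ac s S W hq hN hRm af hs D
  set m := 2 * q with hm
  have hNp : Oo < N := Ec hN
  have hmp : Oo < m := by exact_mod_cast (by omega : 0 < m)
  have anti := D.anti ab Po af (fun i hi => by
    rw [D.vS i hi, D.S0 _ Om, D.S0 _ Om, D.S0 _ Om, hs, hs, hs]; push_cast; field_simp; ring)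
  have wp : ∀ i ≤ m + m, ∀ t ∈ Jo, 0 < W i t := fun i hi t ht => af.trans_le (D.mem i hi t ⟨ht.1.le, ht.2.le⟩).1
  set g : Re → ℕ → Re := fun t k => N&^2 * (S (m+k) t - 2 * S m t + S (m-k) t) with hg
  have g0 : ∀ t, g t 0 = 0 := fun t => by simp [hg]; right; ring
  have g1 : ∀ t, g t 1 = W m t := fun t => by
    have := D.vS (m-1) Om t
    rw [show m - 1 + 1 = m by omega, show m - 1 + 2 = m + 1 by omega] at this; rw [this]
  have g2 : ∀ t k, k + 2 ≤ m → g t k~~ - 2 * g t k~ + g t k = W (m+k+1) t + W (m-k~) t := fun t k hk => by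
    have e1 := D.vS (m+k) Om t
    have e2 := D.vS (m- k~~) Om t
    rw [show m - k~~ + 1 = m - k~ by omega, show m - k~~ + 2 = m - k by omega] at e2
    rw [e1, e2]; simp only [hg, ← add_assoc]; ring
  have low : ∀ a t, 0 ≤ a → t ∈ Jo → (∀ k ≤ q, a ≤ W (m+k) t ∧ a ≤ W (m-k) t) → a * m^2 ≤ 2 * g t m := by
    intro a t ha ht h
    have h1 := sq_low (g := g t) (a := a) (m := q) (g0 t) (fun _ => by rw [g1]; exact (h 0 Om).1) (fun k hk => by
      have e := (h k~ Om).1; rw [← add_assoc] at e; rw [g2 t k Om]; linarith [(h k~ Om).2]) q Ad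
    have h2 := conc (g := fun k => - g t k) (m := m) (fun k hk => by
      have := g2 t k hk; linarith [wp (m+k+1) Om t ht, wp (m-k~) Om t ht]) q Om
    simp only [g0, hm] at h2 ⊢
    push_cast at h2 ⊢
    have : 2 * g t (2*q) ≥ 4 * g t q := by
      have hq : Oo < q := Ec hq
      nlinarith
    nlinarith
  have up : ∀ b t, (∀ i ≤ m + m, W i t ≤ b) → g t m ≤ b * m^2 := by
    intro b t h
    have h1 := sq_low (g := fun k => - g t k) (a := -b) (m := m) (by simp [g0]) (fun _ => by rw [g1]; linarith [h m Om]) (fun k hk => by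
      have := g2 t k hk; linarith [h (m+k+1) Om, h (m-k~) Om]) m Ad
    linarith
  have zc : ∀ t ∈ Jo, ∀ i, i + 1 < m + m → Ps (W i~~ t) - 2 * Ps (W i~ t) + Ps (W i t) ≤ 0 := by
    intro t ht i hi
    have h1 := (D.dv i hi t ht).hasDerivWithinAt (s := Icc 0 2)
    have h2 := (anti i~ hi.le).derivWithin_nonpos (x := t)
    rw [h1.derivWithin (uniqueDiffOn_Icc Nn t ⟨ht.1.le, ht.2.le⟩)] at h2
    exact nonpos_of_mul_nonpos_right h2 Po
  have mid : ∀ t ∈ Jo, ∀ k ≤ m, Ps (W (m+k) t) + Ps (W (m-k) t) ≤ 2 * Ps (W m t) := by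
    intro t ht k hk
    have := sq_low (g := fun k => 2 * Ps (W m t) - Ps (W (m+k) t) - Ps (W (m-k) t)) (a := 0) (m := m) (by simp; ring) (fun _ => by
      have := zc t ht (m-1) Om
      rw [show m - 1 + 1 = m by omega, show m - 1 + 2 = m + 1 by omega] at this; linarith) (fun k hk => by
      have e1 := zc t ht (m+k) Om
      have e2 := zc t ht (m- k~~) Om
      rw [show m - k~~ + 1 = m - k~ by omega, show m - k~~ + 2 = m - k by omega] at e2
      simp only [← add_assoc]; linarith) k hk
    linarith
  have zn : ∀ t ∈ Jo, ∀ i ≤ m + m, 0 ≤ Ps (W i t) := fun t ht i hi => ab.nonneg (wp i hi t ht).le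
  have zmax : ∀ t ∈ Jo, ∀ i ≤ m + m, Ps (W i t) ≤ 2 * Ps (W m t) := by
    intro t ht i hi
    rcases Er i m with h | h
    · have := mid t ht (m-i) Om; rw [show m - (m - i) = i by omega] at this; linarith [zn t ht (m+(m-i)) Om]
    · have := mid t ht (i-m) Om; rw [show m + (i - m) = i by omega] at this; linarith [zn t ht (m-(i-m)) Om]
  have half : ∀ t ∈ Jo, ∀ k ≤ q, Ps (W m t) ≤ 2 * Ps (W (m+k) t) ∧ Ps (W m t) ≤ 2 * Ps (W (m-k) t) := by
    intro t ht k hk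
    have e1 := conc (g := fun k => Ps (W (m+k) t)) (m := m) (fun k hk => zc t ht (m+k) Om) k Om
    have e2 := conc (g := fun k => Ps (W (m-k) t)) (m := m) (fun k hk => by
      have e2 := zc t ht (m- k~~) Om
      rw [show m - k~~ + 1 = m - k~ by omega, show m - k~~ + 2 = m - k by omega] at e2
      linarith) k Om
    have hk' : 2 * k& ≤ m := by exact_mod_cast (by omega : 2 * k ≤ m)
    have a1 := Bu (Nat.cast_nonneg (α := Re) k) (zn t ht (m+m) Ad)
    have a2 := Bu (Nat.cast_nonneg (α := Re) k) (zn t ht 0 Om)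
    have a3 := Bu (sub_nonneg.2 hk') (zn t ht m Om)
    simp only [add_zero, Nat.sub_zero, Nat.sub_self] at e1 e2
    constructor <;> refine Ca ?_ hmp <;> linarith
  set B : Fn := fun t => 4 / m^2 * g t m with hB
  have Bpos : ∀ t ∈ Jo, 0 < B t := fun t ht => by
    have := low ac t af.le ht (fun k hk => ⟨(D.mem _ Om t ⟨ht.1.le, ht.2.le⟩).1, (D.mem _ Om t ⟨ht.1.le, ht.2.le⟩).1⟩)
    have : 0 < g t m := by have : 0 < ac * m&^2 := Po
                           linarith
    simp only [hB]; positivity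
  have zB : ∀ t ∈ Jo, Ps (W m t) ≤ 2 * Ps (B t) := by
    intro t ht
    by_contra hc
    push Not at hc
    have hb := Bpos t ht
    have key : ∀ i ≤ m + m, Ps (W m t) ≤ 2 * Ps (W i t) → B t ≤ W i t := fun i hi h => by
      by_contra hlt
      push Not at hlt
      have := ab.monoOn (wp i hi t ht).le hlt.le
      linarith
    have := low (B t) t hb.le ht (fun k hk => ⟨key _ Om (half t ht k hk).1, key _ Om (half t ht k hk).2⟩)
    have e : B t * m^2 = 4 * g t m := by simp only [hB]; field_simp
    have : 0 < B t * m^2 := Po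
    linarith
  have dB : ∀ t ∈ Jo, Dv B (4 / m^2 * (N&^2 * (Ps ac - 2 * Ps (W m t) + Ps ac))) t := fun t ht => by
    have h1 := D.dS (m+m) Ad t ht
    have h2 := D.dS (m-m) Om t ht
    rw [D.vr] at h1
    rw [show Ps (W (m-m) t) = Ps ac by rw [Nat.sub_self, D.vl]] at h2
    exact (((h1.sub ((D.dS m Om t ht).const_mul 2)).add h2).const_mul _).const_mul _
  have B0 : B 0 = 4 * ah := by
    simp only [hB, hg, D.S0 (m+m) Ad, D.S0 m Om, D.S0 (m-m) Om, hs]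
    simp; field_simp; ring
  have Bc : Co B (Icc 0 2) := ((((D.cS (m+m) Ad).sub ((D.cS m Om).const_smul (2:Re))).add (D.cS (m-m) Om)).const_smul (N&^2)).const_smul (4 / m&^2)
  have Hd : ∀ t ∈ Jo, ∀ t0 ∈ Jo, t0 ≤ t → H (B t) ≤ H (B t0) + 16 / R^2 * 2 := by
    intro t ht t0 ht0 htt
    have := anti_hd (f := fun t => H (B t) - 16 / R^2 * t) (a := t0) (b := t) (f' := fun t => -(1 / Ps (B t)) * (4 / m^2 * (N&^2 * (Ps ac - 2 * Ps (W m t) + Ps ac))) - 16 / R^2 * 1)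
      (fun r hr => by
        have hr' : r ∈ Jo := ⟨ht0.1.trans_le hr.1, hr.2.trans_lt ht.2⟩
        exact (((dH _ (Bpos r hr')).comp r (dB r hr')).sub ((Af r).const_mul _)).continuousAt.continuousWithinAt)
      (fun r hr => by
        have hr' : r ∈ Jo := ⟨ht0.1.trans hr.1, hr.2.trans ht.2⟩
        exact (((dH _ (Bpos r hr')).comp r (dB r hr')).sub ((Af r).const_mul _)))
      (fun r hr => by
        have hr' : r ∈ Jo := ⟨ht0.1.trans hr.1, hr.2.trans ht.2⟩
        have hp := ab.pos (Bpos r hr')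
        have hz := zB r hr'
        have h3 : 4 / m^2 * (N&^2 * (2 * Ps (W m r) - 2 * Ps ac)) ≤ 16 / R^2 * Ps (B r) := by
          have hr2 : N&^2 / m^2 ≤ 1 / R^2 := by
            rw [div_le_div_iff₀ Po Po, one_mul, ← mul_pow, mul_comm]
            exact Bm Po ((Ap hNp).1 hRm) 2
          have h4 : 2 * Ps (W m r) - 2 * Ps ac ≤ 4 * Ps (B r) := by linarith [ab.nonneg af.le]
          calc _ = 4 * (N&^2 / m^2) * (2 * Ps (W m r) - 2 * Ps ac) := Rg
            _ ≤ 4 * (N&^2 / m^2) * (4 * Ps (B r)) := by gcongr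
            _ ≤ 4 * (1 / R^2) * (4 * Ps (B r)) := by gcongr
            _ = _ := Rg
        have : -(1 / Ps (B r)) * (4 / m^2 * (N&^2 * (Ps ac - 2 * Ps (W m r) + Ps ac))) ≤ 16 / R^2 := by
          rw [show -(1 / Ps (B r)) * (4 / m^2 * (N&^2 * (Ps ac - 2 * Ps (W m r) + Ps ac))) = 4 / m^2 * (N&^2 * (2 * Ps (W m r) - 2 * Ps ac)) / Ps (B r) by ring]
          rwa [Ci hp]
        linarith)
    have := this ⟨Ad, htt⟩ ⟨htt, Ad⟩ htt
    simp only at this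
    have : 16 / R^2 * (t - t0) ≤ 16 / R^2 * 2 := by gcongr; linarith [ht.2, ht0.1]
    linarith
  intro t ht
  have Hfin : H (B t) ≤ H (4 * ah) + 16 / R^2 * 2 := by
    have hc : Tendsto (fun t0 => H (B t0) + 16 / R^2 * 2) (𝓝[>] 0) (𝓝 (H (4 * ah) + 16 / R^2 * 2)) := by
      refine Tendsto.add_const _ ?_
      rw [← B0]
      refine Tendsto.comp (g := H) (dH _ (by rw [B0]; positivity)).continuousAt ?_
      have := (Bc 0 ⟨Ad, Nn⟩).mono_left (nhdsWithin_mono 0 (Ioc_subset_Icc_self))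
      rwa [nhdsWithin_Ioc_eq_nhdsGT Nn] at this
    refine Dl hc ?_
    filter_upwards [Ioo_mem_nhdsGT ht.1] with t0 ht0
    exact Hd t ht t0 ⟨ht0.1, ht0.2.trans ht.2⟩ ht0.2.le
  by_contra hlt
  push Not at hlt
  have hb : ∀ i ≤ m + m, W i t ≤ a1 / 8 := fun i hi => by
    by_contra h
    push Not at h
    have := ab.monoOn Po h.le
    linarith [zmax t ht i hi]
  have h1 := up _ t hb
  have h2 : B t ≤ a1 := by
    have : B t ≤ 4 / m^2 * (a1 / 8 * m^2) := by simp only [hB]; gcongr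
    have e : 4 / m&^2 * (a1 / 8 * m^2) = a1 / 2 := by field_simp; norm_num
    linarith
  linarith [Hanti _ _ (Bpos t ht) h2]
theorem blockII {Ps P : Fn} (ab : PsiData Ps) (hP : PsiData P) (dP : ∀ v, 0 < v → deriv P v = 1 / Ps v)
    {ah ad : Re} (ay : 0 < ah) (ak : 0 < ad) (df : ad ≤ 1) (dl : 4 * ad ≤ P ah) : ∃ a1 : Re, 0 < a1 ∧ a1 ≤ ah ∧ ∀ (n N : ℕ) (ac : Re) (s : ℕ → Re) (S W : ℕ → Fn),
      1 ≤ n → n ≤ N → 0 < ac → ac ≤ a1 / 2 → (∀ i, s i = 1/2 * ac * ((n& - i) / N)^2) →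
      DSol Ps n (N&^2) ac ah ah ac s S W → ∀ i ≤ n, a1 / 4 * ((n& - i) / N)^2 ≤ ad * Ps (W i ad) := by
  obtain ⟨G, Go, Gs, GP, dG⟩ := hP.inv
  have ivt : ∀ ac, 0 < ac → ac ≤ ah → ∀ y ∈ Icc (P ac) (P ah), ∃ v ∈ Icc ac ah, P v = y := fun ac h1 h2 y hy =>
    intermediate_value_Icc h2 (hP.cont.mono fun x hx => h1.le.trans hx.1) hy
  obtain ⟨a1, ha1, co, hPa⟩ : ∃ a1 : Re, 0 < a1 ∧ a1 ≤ ah ∧ P a1 = 2 * ad := by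
    obtain ⟨v, hv, e⟩ := intermediate_value_Icc ay.le (hP.cont.mono fun x hx => hx.1) (show 2 * ad ∈ Icc (P 0) (P ah) by rw [hP.zero]; constructor <;> linarith)
    refine ⟨v, Bn hv.1 ?_, hv.2, e⟩
    rintro rfl; rw [hP.zero] at e; linarith
  refine ⟨a1, ha1, co, ?_⟩
  intro n N ac s S W hn hnN af ec hs D
  have hN : Oo < N := by exact_mod_cast (by omega : 0 < N)
  have ed : P ac ≤ 2 * ad := hPa ▸ hP.monoOn af.le Li
  set a : Fn := fun t => G (P ac + 2 * t) with ha
  have am : ∀ t ∈ Icc 0 ad, a t ∈ Icc ac ah ∧ P (a t) = P ac + 2 * t := fun t ht => by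
    obtain ⟨v, hv, e⟩ := ivt ac af Li (P ac + 2 * t) ⟨Lx ht.1, Lx ht.2⟩
    have : a t = v := by simp only [ha]; rw [← e, GP v (af.trans_le hv.1)]
    rw [this]; exact ⟨hv, e⟩
  have da : ∀ t ∈ Icc 0 ad, Dv a (2 * Ps (a t)) t := fun t ht => by
    obtain ⟨h1, h2⟩ := am t ht
    have hp := af.trans_le h1.1
    have h3 : Dv G (Ps (a t)) (P ac + 2 * t) := by
      have := dG _ hp
      rw [dP _ hp, one_div_one_div, h2] at this
      rw [← this]
      exact ((Gs.contDiffAt (Go.mem_nhds (h2 ▸ mem_image_of_mem P hp))).differentiableAt Si).hasDerivAt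
    exact (h3.comp t (((Af t).const_mul 2).const_add (P ac))).congr_deriv Rg
  set r : ℕ → Re := fun i => (n& - i) / N with hr
  have r01 : ∀ i ≤ n, 0 ≤ r i ∧ r i ≤ 1 := fun i hi => by
    have h1 : i& ≤ n := Ec hi
    have h2 : n& ≤ N := Ec hnN
    have h3 : Oo ≤ i := Po
    exact ⟨div_nonneg Li hN.le, (Ck hN).2 Li⟩
  set E : ℕ → Fn := fun i t => 1/2 * a t * r i^2 - S i t with hE
  have dE : ∀ i ≤ n, ∀ t ∈ Ioc 0 ad, Dv (E i) (Ps (a t) * r i^2 - Ps (W i t)) t := fun i hi t ht =>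
    ((((da t ⟨ht.1.le, ht.2⟩).const_mul (1/2)).mul_const _).sub (D.dS i hi t ⟨ht.1, Lx ht.2⟩)).congr_deriv Rg
  have a0 : a 0 = ac := by simp [ha, GP ac af]
  have E0 : ∀ i ≤ n, E i 0 = 0 := fun i hi => by simp only [hE, a0, D.S0 i hi, hs, hr]; ring
  have cE : ∀ i ≤ n, Co (E i) (Icc 0 ad) := fun i hi =>
    ContinuousOn.sub (((continuousOn_const.mul fun t ht => (da t ht).continuousAt.continuousWithinAt)).mul continuousOn_const)
      ((D.cS i hi).mono (Bf Li))
  have En : ∀ t ∈ Icc 0 ad, E n t ≤ 0 := fun t ht => by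
    have := (D.S_lip ab af Ad (t := 0) (t' := t) ⟨Ad, Nn⟩ ⟨ht.1, Lx ht.2⟩ ht.1).1
    rw [D.S0 n Ad, hs] at this
    simp [hE, hr] at this ⊢; linarith
  have main : ∀ ax : Re, 0 < ax → ∀ i ≤ n, ∀ t ∈ Icc 0 ad, E i t - ax * t ≤ 0 := by
    intro ax bp
    have : ∀ i : ℕ, ∃ ae ∈ Icc 0 ad, i ≤ n → ∀ t ∈ Icc 0 ad, E i t - ax * t ≤ E i ae - ax * ae := fun i => by
      by_cases hi : i ≤ n
      · obtain ⟨ae, h1, h2⟩ := isCompact_Icc.exists_isMaxOn (nonempty_Icc.2 ak.le) ((cE i hi).sub (continuousOn_id.const_smul ax))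
        exact ⟨ae, h1, fun _ t ht => h2 ht⟩
      · exact ⟨0, ⟨Ad, ak.le⟩, fun h => absurd h hi⟩
    choose ae h1 h2 using this
    obtain ⟨k, hk, hmax⟩ := Finset.exists_max_image (Fr n~) (fun i => E i (ae i) - ax * ae i) ⟨0, Si⟩
    have hk : k ≤ n := by simpa [Nat.lt_succ_iff] using hk
    have hm : ∀ i ≤ n, ∀ t ∈ Icc 0 ad, E i t - ax * t ≤ E k (ae k) - ax * ae k := fun i hi t ht =>
      (h2 i hi t ht).trans (hmax i (by simpa [Nat.lt_succ_iff] using hi))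
    suffices E k (ae k) - ax * ae k ≤ 0 from fun i hi t ht => (hm i hi t ht).trans this
    by_contra hc
    push Not at hc
    have ht0 : 0 < ae k := Bn (h1 k).1 fun h => by rw [← h, E0 k hk] at hc; simp at hc
    have hI : ae k ∈ Ioc 0 ad := ⟨ht0, (h1 k).2⟩
    have hlm := left_max ((dE k hk _ hI).sub ((Af _).const_mul ax)) ht0 (fun s hs' => hm k hk s ⟨hs'.1.le, hs'.2.le.trans hI.2⟩)
    obtain ⟨⟨b1, b2⟩, -⟩ := am _ (h1 k)
    have hz := ab.nonneg (af.le.trans b1)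
    have hzr : Ps (a (ae k)) * r k^2 ≤ Ps (a (ae k)) := mul_le_of_le_one_right hz (Dr (r01 k hk).1 (r01 k hk).2)
    suffices a (ae k) ≤ W k (ae k) by have := ab.monoOn (af.le.trans b1) this; linarith
    rcases k with _ | k
    · rw [D.vl]; exact b2
    rcases hk.eq_or_lt with h | h
    · have := En _ (h1 k~); rw [← h] at this; have := mul_pos bp ht0; linarith
    have e1 := hm k Om _ (h1 k~)
    have e2 := hm k~~ Om _ (h1 k~)
    rw [D.vS k h]
    have : a (ae k~) = N&^2 * (1/2 * a (ae k~) * r k~~^2 - 2 * (1/2 * a (ae k~) * r k~^2) + 1/2 * a (ae k~) * r k^2) := by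
      simp only [hr]; push_cast; field_simp; ring
    rw [this]
    simp only [hE] at e1 e2
    exact Aa Li Po
  have incr := D.incr ab Po af (fun i hi => by
    rw [D.vS i hi, D.S0 _ Om, D.S0 _ Om, D.S0 _ Om, hs, hs, hs]; push_cast; field_simp; ring)
  intro i hi
  have cg : ad ∈ Icc 0 ad := ⟨ak.le, Ad⟩
  have hEi : E i ad ≤ 0 := Ek fun e he => by
    have := main (e / ad) Po i hi ad cg
    rw [div_mul_cancel₀ _ ak.ne'] at this; linarith
  have had : a1 ≤ a ad := by
    by_contra h
    push Not at h
    have h' := hP.mono (af.le.trans (am ad cg).1.1 : Oo ≤ _) (ha1.le : Oo ≤ _) h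
    rw [(am ad cg).2, hPa] at h'; linarith [hP.nonneg af.le]
  have hS : S i ad - s i ≤ ad * Ps (W i ad) := by
    have := anti_hd (f := fun t => S i t - t * Ps (W i ad)) (f' := fun t => Ps (W i t) - 1 * Ps (W i ad)) (a := 0) (b := ad)
      (((D.cS i hi).mono (Bf Li)).sub Fu) (fun t ht => (D.dS i hi t ⟨ht.1, Lx ht.2⟩).sub ((Af t).mul_const _))
      (fun t ht => by
        have h1 : t ∈ Jc := ⟨ht.1.le, Lx ht.2⟩
        have := ab.monoOn (af.le.trans (D.mem i hi t h1).1) (incr i hi h1 ⟨ak.le, Li⟩ ht.2.le)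
        linarith)
    have := this ⟨Ad, ak.le⟩ ⟨ak.le, Ad⟩ ak.le
    simp only [D.S0 i hi] at this; linarith
  have e : s i = 1/2 * ac * r i^2 := hs i
  have h4 : a1 / 4 * r i^2 ≤ (1/2 * a ad - 1/2 * ac) * r i^2 := by gcongr; linarith
  simp only [hE] at hEi
  linarith
theorem dichotomy {Ps : Fn} (ab : PsiData Ps) : (∃ H : Fn, (∀ a, 0 < a → Dv H (-(1 / Ps a)) a) ∧ ∀ C, ∃ a, 0 < a ∧ C < H a) ∨
    ∃ P, PsiData P ∧ ∀ v, 0 < v → deriv P v = 1 / Ps v := by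
  have c1 : Co (fun x => 1 / Ps x) (Ioi 0) := continuousOn_const.div (ab.cont.mono Eo) fun x hx => (ab.pos hx).ne'
  set H : Fn := fun a => ∫ x in a..1, 1 / Ps x with hH
  have dH : ∀ a, 0 < a → Dv H (-(1 / Ps a)) a := fun a ha => by
    refine intervalIntegral.integral_hasDerivAt_left (ContinuousOn.intervalIntegrable (c1.mono fun x hx => ?_)) ?_ (c1.continuousAt (Cm ha))
    · exact (Eb ha one_pos).trans_le hx.1
    · exact c1.stronglyMeasurableAtFilter isOpen_Ioi a ha
  by_cases hb : ∀ C, ∃ a, 0 < a ∧ C < H a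
  · exact Or.inl ⟨H, dH, hb⟩
  right
  push Not at hb
  obtain ⟨C, hC⟩ := hb
  have sa : StrictAntiOn H (Ioi 0) := strictAntiOn_of_deriv_neg (convex_Ioi 0) (fun x hx => (dH x hx).continuousAt.continuousWithinAt) fun x hx => by
    rw [interior_Ioi] at hx
    rw [(dH x hx).deriv]; have := ab.pos hx; simp; positivity
  have bd : BddAbove (H '' Ioi 0) := ⟨C, by rintro _ ⟨a, ha, rfl⟩; exact hC a ha⟩
  set L := sSup (H '' Ioi 0) with hL
  have lt : ∀ v, 0 < v → H v < L := fun v hv => (sa (show v/2 ∈ Ioi 0 from half_pos hv) hv (El hv)).trans_le (le_csSup bd ⟨_, half_pos hv, rfl⟩)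
  set P : Fn := fun v => if v ≤ 0 then 0 else L - H v with hP
  have Pp : ∀ v, 0 < v → P v = L - H v := fun v hv => by simp [hP, hv]
  have Pe : EqOn P (fun v => L - H v) (Ioi 0) := fun v hv => Pp v hv
  have dP : ∀ v, 0 < v → Dv P (1 / Ps v) v := fun v hv => by
    refine (((dH v hv).const_sub L).congr_deriv Rg).congr_of_eventuallyEq ?_
    filter_upwards [Cm hv] with w hw using Pp w hw
  have z : P 0 = 0 := by simp [hP]
  refine ⟨P, ⟨z, ?_, ?_, ?_, ?_⟩, fun v hv => (dP v hv).deriv⟩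
  · intro v hv w hw h
    have hw : 0 < w := lt_of_le_of_lt hv h
    rw [Pp w hw]
    rcases (show 0 ≤ v from hv).eq_or_lt with rfl | hv
    · rw [z]; linarith [lt w hw]
    · rw [Pp v hv]; linarith [sa hv hw h]
  · intro v hv
    rcases (show 0 ≤ v from hv).eq_or_lt with rfl | hv
    · rw [Metric.continuousWithinAt_iff]
      intro e he
      obtain ⟨_, ⟨a, ha, rfl⟩, h⟩ := exists_lt_of_lt_csSup (s := H '' Ioi 0) ⟨_, 1, mem_Ioi.2 one_pos, rfl⟩ (show L - e < L by linarith)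
      refine ⟨a, ha, fun {x} hx hxa => ?_⟩
      rw [z, Bb, sub_zero]
      rcases (show 0 ≤ x from hx).eq_or_lt with rfl | hx
      · simpa [z] using he
      rw [Bb, sub_zero, Ag hx] at hxa
      rw [Pp x hx, Ag (by linarith [lt x hx])]
      linarith [sa hx ha hxa]
    · exact (dP v hv).continuousAt.continuousWithinAt
  · rw [contDiffOn_infty_iff_deriv_of_isOpen isOpen_Ioi]
    refine ⟨fun v hv => (dP v hv).differentiableAt.differentiableWithinAt, ?_⟩
    exact ContDiffOn.congr (contDiffOn_const.div ab.smooth fun x hx => (ab.pos hx).ne') fun v hv => (dP v hv).deriv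
  · intro v hv; rw [(dP v hv).deriv]; have := ab.pos hv; positivity
section
variable {Ps X0 : Fn} {M : Re} {S v : ℕ → ℕ → Fn} (H : ASeq Ps M X0 S v)
include H
theorem ASeq.cmp {N n : ℕ} (hN : 1 ≤ N) {ah b0 b1 t0 T : Re} {s : ℕ → Re} {S' W : ℕ → Fn} (D : DSol Ps n (N&^2) (1/N) ah b0 b1 s S' W)
    (ay : 0 < ah) (aw : ℕ → ℕ) (cx : ∀ i ≤ n, aw i ≤ N) (dn : ∀ i, i + 1 < n → ∃ k, k + 1 < N ∧ aw i~ = k + 1 ∧ (aw i = k ∧ aw i~~ = k + 2 ∨ aw i = k + 2 ∧ aw i~~ = k))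
    (ht0 : 0 ≤ t0) (hT : T ≤ 2 - t0) (hi : ∀ i ≤ n, W i 0 ≤ v N (aw i) t0)
    (hl : ∀ t ∈ Icc 0 T, b0 ≤ v N (aw 0) (t0 + t)) (hr : ∀ t ∈ Icc 0 T, b1 ≤ v N (aw n) (t0 + t)) :
    ∀ i ≤ n, ∀ t ∈ Icc 0 T, W i t ≤ v N (aw i) (t0 + t) := by
  obtain ⟨s0, D0⟩ := H.sol N hN
  have hNp : Oo < N := Ec hN
  have hM := H.hM
  obtain ⟨c, d⟩ := D0.shift ht0
  refine comparison H.psi n (M := M + 1 + ah) (T := T) (K := N&^2) (ac := 1/N) Po Po W (fun i t => v N (aw i) (t0 + t))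
    (fun i hi t ht => ?_) (fun i hi t ht => ?_) (fun i hi => (D.cv i hi).mono (Bf Li)) (fun i hi => (c _ (cx i hi)).mono (Bf hT))
    (fun i hi t ht => D.dv i hi t ⟨ht.1, Lx ht.2⟩) (fun i hi t ht => ?_) (fun i h => by simpa using hi i h) (fun t ht => by rw [D.vl]; exact hl t ht) (fun t ht => by rw [D.vr]; exact hr t ht)
  · have := D.mem i hi t ⟨ht.1, Lx ht.2⟩; exact ⟨this.1, Lx this.2⟩
  · have := D0.mem _ (cx i hi) (t0 + t) ⟨Lx ht.1, Lx ht.2⟩; exact ⟨this.1, Lx this.2⟩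
  · obtain ⟨k, hk, e, h⟩ := dn i hi
    have := d k hk t ⟨ht.1, ht.2.trans_le hT⟩
    rcases h with h | h <;> rw [e, h.1, h.2]
    · exact this
    · exact this.congr_deriv Rg
theorem ASeq.nbhd {u t : Re} (ht : t ∈ Ioc Oo 2) (hp : 0 < lv v u t) :
    ∃ ah ad : Re, 0 < ah ∧ 0 < ad ∧ ∀ᶠ N : ℕ in ar, ∀ i ≤ N, |(i& - ix N u) / N| ≤ ad → ∀ s ∈ Icc (t/2) 2, |s - t| ≤ ad → ah ≤ v N i s := by
  have h0 := ht.1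
  obtain ⟨ad, ak, h⟩ := H.equi (half_pos h0) (show 0 < lv v u t / 4 by positivity)
  refine ⟨lv v u t / 2, ad, Po, ak, ?_⟩
  filter_upwards [h, (H.tv ⟨h0.le, ht.2⟩ u).eventually (lt_mem_nhds (show lv v u t * (3/4) < lv v u t by linarith)), U_ev (Ao 1)] with N h1 h2 hN
  intro i hi hij s hs hst
  have := abs_lt.1 (h1 i hi _ (ix_lt hN u).le hij s hs t ⟨Li, ht.2⟩ hst)
  linarith [this.1]
theorem ASeq.psi_lim {t : Re} (ht : t ∈ Jc) (u : Re) : Tendsto (fun N => Ps (v N (ix N u) t)) ar (𝓝 (Ps (lv v u t))) := by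
  refine (H.psi.cont _ (H.lv_mem ht u).1).tendsto.comp (Bt.2 ⟨H.tv ht u, ?_⟩)
  filter_upwards [U_ev (Ao 1)] with N hN using (H.vmem hN (ix_lt hN u).le ht).1
theorem ASeq.pos_of {t c : Re} (ht : t ∈ Jc) {u : Re} (hc : 0 < c) (h : c ≤ Ps (lv v u t)) : 0 < lv v u t := by
  refine Bn (H.lv_mem ht u).1 fun h0 => ?_
  rw [← h0, H.psi.zero] at h; linarith
theorem ASeq.caseI {H' : Fn} (dH : ∀ a, 0 < a → Dv H' (-(1 / Ps a)) a) (hH : ∀ C, ∃ a, 0 < a ∧ C < H' a)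
    {u t0 t : Re} (hu : u ∈ Io) (ht0 : 0 < t0) (htt : t0 < t) (ht : t < 2) (hp : 0 < lv v u t0) : 0 < lv v u t := by
  obtain ⟨ah, ad', ay, ak', h⟩ := H.nbhd ⟨ht0, Li⟩ hp
  obtain ⟨ad, ak, d1, d2, d3⟩ : ∃ ad : Re, 0 < ad ∧ ad ≤ ad' ∧ ad < u ∧ ad < 1 - u := by
    have h2 : 0 < 1 - u := Lx hu.2
    refine ⟨min ad' (min u (1-u)) / 2, by have := Eb ak' (Eb hu.1 h2); positivity, ?_, ?_, ?_⟩
    · linarith [Am ad' (min u (1-u))]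
    · linarith [Al ad' (min u (1-u)), Am u (1-u), hu.1]
    · linarith [Al ad' (min u (1-u)), Al u (1-u)]
  obtain ⟨cc, dr, hb⟩ := blockI H.psi dH hH ay (half_pos ak)
  have hI : t ∈ Jc := ⟨Li, ht.le⟩
  have huI : u ∈ I := ⟨hu.1.le, hu.2.le⟩
  refine H.pos_of hI dr (Dl (H.psi_lim hI u) ?_)
  filter_upwards [h, U_ev (Ao 1), (ix_lim huI).eventually (lt_mem_nhds d2), (ix_lim huI).eventually (Ce (show u < 1 - ad by linarith)),
    N_lim.eventually (Ce ay), N_lim.eventually (Ce (show 0 < ad/4 by positivity))] with N h1 hN e1 e2 e3 e4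
  have hNp : Oo < N := Ec hN
  set j := ix N u
  set q := ⌊ad * N / 2⌋₊ with hq
  rw [Es hNp] at e1
  rw [div_lt_iff₀ hNp] at e2 e4
  have q1 : q& ≤ ad * N / 2 := Nat.floor_le Po
  have q2 : ad * N / 2 < q + 1 := Nat.lt_floor_add_one _
  have q3 : 1 ≤ q := by
    have : Oo < q := Li
    exact_mod_cast this
  have j1 : 2 * q ≤ j := by exact_mod_cast (by push_cast; linarith : ((2 * q : ℕ):Re) ≤ j)
  have j2 : j + 2 * q ≤ N := by exact_mod_cast (by push_cast; linarith : ((j + 2 * q : ℕ):Re) ≤ N)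
  have af : Oo < 1 / N := Po
  obtain ⟨S', W, D⟩ := exists_DSol H.psi (2 * q + 2 * q) (K := N&^2) (ac := 1/N) (M := ah) (b0 := 1/N) (b1 := 1/N) (fun i => 1/2 * ah * ((i& - (2 * q : ℕ)) / N)^2)
    Om Po af e3.le ⟨Ad, e3.le⟩ ⟨Ad, e3.le⟩ (fun i hi => by
      have : N&^2 * (1/2 * ah * ((((i+2:ℕ):Re) - (2 * q : ℕ)) / N)^2 - 2 * (1/2 * ah * ((((i+1:ℕ):Re) - (2 * q : ℕ)) / N)^2) + 1/2 * ah * ((i& - (2 * q : ℕ)) / N)^2) = ah := by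
        push_cast; field_simp; ring
      rw [this]; exact ⟨e3.le, Ad⟩)
  have hr : ad / 2 ≤ ((2 * q : ℕ):Re) / N := by rw [Ap hNp]; push_cast; linarith
  have f1 := hb q N (1/N) _ S' W q3 hN hr af (fun i => rfl) D (t - t0) ⟨Li, Li⟩
  have lowb : ∀ i ≤ N, ∀ s ∈ Jc, 1/N ≤ v N i s := by obtain ⟨s0, D0⟩ := H.sol N hN; exact fun i hi s hs => (D0.mem i hi s hs).1
  have f2 := H.cmp hN D ay (fun i => j - 2 * q + i) (fun i hi => by omega) (fun i hi => ⟨j - 2 * q + i, Om, Om, Or.inl ⟨rfl, Om⟩⟩) (t0 := t0) (T := 2 - t0) ht0.le Ad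
    (fun i hi => by
      refine (D.mem i hi 0 ⟨Ad, Nn⟩).2.trans (h1 _ Om ?_ t0 ⟨Li, Li⟩ (by simp [ak'.le]))
      have : ((j - 2 * q + i : ℕ):Re) - j = i& - 2 * q := by rw [Nat.cast_add, Dp j1]; push_cast; ring
      have hi' : i& ≤ 2 * q + 2 * q := Ec hi
      rw [this, abs_div, Ag hNp, Ci hNp, Ar]
      have : ad * N ≤ ad' * N := by gcongr
      constructor <;> linarith [(Nat.cast_nonneg i : Oo ≤ i)])
    (fun s hs => lowb _ Om _ ⟨Lx hs.1, Lx hs.2⟩) (fun s hs => lowb _ Om _ ⟨Lx hs.1, Lx hs.2⟩)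
    (2 * q) Om (t - t0) ⟨Li, Li⟩
  rw [show j - 2 * q + 2 * q = j by omega, show t0 + (t - t0) = t by ring] at f2
  have := (D.mem (2*q) Om (t - t0) ⟨Li, Li⟩).1
  exact f1.trans (H.psi.monoOn (af.le.trans this) f2)
theorem ASeq.caseII {P : Fn} (hP : PsiData P) (dP : ∀ v, 0 < v → deriv P v = 1 / Ps v)
    {u1 u2 t : Re} (hu1 : u1 ∈ Io) (hu2 : u2 ∈ Io) (ht : t ∈ Jo) (hp : 0 < lv v u1 t) : 0 < lv v u2 t := by
  obtain ⟨ah, ad', ay, ak', h⟩ := H.nbhd ⟨ht.1, ht.2.le⟩ hp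
  have dl := hP.pos ay
  obtain ⟨ad, ak, d1, d2, d3, d4⟩ : ∃ ad : Re, 0 < ad ∧ ad ≤ ad' ∧ ad ≤ t / 2 ∧ ad ≤ 1 ∧ 4 * ad ≤ P ah := by
    have h0 := ht.1
    refine ⟨min (min ad' (t/2)) (min 1 (P ah / 4)), Eb (Eb ak' Po) (Eb one_pos Po), ?_, ?_, ?_, ?_⟩
    · exact (Am _ _).trans (Am _ _)
    · exact (Am _ _).trans (Al _ _)
    · exact (Al _ _).trans (Am _ _)
    · have : min (min ad' (t/2)) (min 1 (P ah / 4)) ≤ P ah / 4 := (Al _ _).trans (Al _ _)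
      linarith
  obtain ⟨a1, ha1, co, hb⟩ := blockII H.psi hP dP ay ak d3 d4
  have hI : t ∈ Jc := ⟨ht.1.le, ht.2.le⟩
  have key : ∀ (ag : Re) (n k : ℕ → ℕ) (aw : ℕ → ℕ → ℕ), 0 < ag → Tendsto (fun N : ℕ => ((n N : Re) - k N) / N) ar (𝓝 ag) →
      (∀ᶠ N in ar, 1 ≤ n N ∧ n N ≤ N ∧ k N ≤ n N ∧ aw N 0 = ix N u1 ∧ aw N (k N) = ix N u2 ∧ (∀ i ≤ n N, aw N i ≤ N) ∧
        ∀ i, i + 1 < n N → ∃ k, k + 1 < N ∧ aw N i~ = k + 1 ∧ (aw N i = k ∧ aw N i~~ = k + 2 ∨ aw N i = k + 2 ∧ aw N i~~ = k)) → 0 < lv v u2 t := by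
    intro ag n k aw ba hlim hev
    refine H.pos_of hI (c := a1 / 4 * ag^2 / ad) Po ?_
    rw [Ci ak, mul_comm (Ps _)]
    refine Bp ((hlim.pow 2).const_mul (a1/4)) ((H.psi_lim hI u2).const_mul ad) ?_
    filter_upwards [h, hev, U_ev (Ao 1), N_lim.eventually (Ce (half_pos ha1))] with N h1 ⟨n1, n2, n3, s0, sk, sN, s2⟩ hN e1
    have hNp : Oo < N := Ec hN
    have af : Oo < 1 / N := Po
    have bx : 1 / N& ≤ ah := Li
    have i0 : ∀ i : ℕ, N&^2 * (1/2 * (1/N) * (((n N:Re) - (i+2:ℕ)) / N)^2 - 2 * (1/2 * (1/N) * (((n N:Re) - (i+1:ℕ)) / N)^2) + 1/2 * (1/N) * (((n N:Re) - i) / N)^2) = 1 / N := fun i => by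
      push_cast; field_simp; ring
    obtain ⟨S', W, D⟩ := exists_DSol H.psi (n N) (K := N&^2) (ac := 1/N) (M := ah) (b0 := ah) (b1 := 1/N) (fun i => 1/2 * (1/N) * (((n N:Re) - i) / N)^2)
      Om Po af bx ⟨bx, Ad⟩ ⟨Ad, bx⟩ (fun i hi => by rw [i0 i]; exact ⟨Ad, bx⟩)
    have f1 := hb (n N) N (1/N) _ S' W n1 n2 af e1.le (fun i => rfl) D (k N) n3
    have lowb : ∀ i ≤ N, ∀ s ∈ Jc, 1/N ≤ v N i s := by obtain ⟨s0, D0⟩ := H.sol N hN; exact fun i hi s hs => (D0.mem i hi s hs).1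
    have near : ∀ ae ∈ Icc 0 ad, ah ≤ v N (aw N 0) (t - ad + ae) := fun ae aq => by
      rw [s0]; refine h1 _ (ix_lt hN u1).le (by simp [ak'.le]) _ ⟨Lx aq.1, by linarith [aq.2, ht.2]⟩ ?_
      rw [Ar]; constructor <;> linarith [aq.1, aq.2]
    have f2 := H.cmp hN D ay (aw N) sN s2 (t0 := t - ad) (T := ad) (Lx ht.1) (Lx ht.2)
      (fun i hi => by
        rcases i with _ | i
        · rw [D.vl]; simpa using near 0 ⟨Ad, ak.le⟩
        rcases Cb i~ (n N) with hl | hl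
        · rw [D.vS i hl, D.S0 _ Om, D.S0 _ Om, D.S0 _ Om, i0 i]; exact lowb _ (sN _ hi) _ ⟨Lx ht.1, Lx ht.2⟩
        · rw [show W i~ 0 = 1/N by rw [show i + 1 = n N by omega, D.vr]]; exact lowb _ (sN _ hi) _ ⟨by linarith [ht.1], by linarith [ht.2]⟩)
      near (fun s hs => lowb _ (sN _ Ad) _ ⟨by linarith [hs.1, ht.1], by linarith [hs.2, ht.2]⟩) (k N) n3 ad ⟨ak.le, Ad⟩
    rw [sk, show t - ad + ad = t by ring] at f2
    have := (D.mem (k N) n3 ad ⟨ak.le, Li⟩).1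
    exact f1.trans (Aa (H.psi.monoOn (af.le.trans this) f2) ak.le)
  have hc : ∀ {u : Re}, u ∈ Io → u ∈ I := fun h => ⟨h.1.le, h.2.le⟩
  rcases Er u1 u2 with h12 | h12
  · refine key (1 - u2) (fun N => N - ix N u1) (fun N => ix N u2 - ix N u1) (fun N i => ix N u1 + i) (Lx hu2.2) ?_ ?_
    · refine ((ix_lim (hc hu2)).const_sub 1).congr' ?_
      filter_upwards [U_ev (Ao 1)] with N hN
      have hNp : Oo < N := Ec hN
      rw [Dp (ix_lt hN u1).le, Dp (ix_mono h12)]; field_simp; ring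
    · filter_upwards [U_ev (Ao 1)] with N hN
      have a1 := ix_lt hN u1
      have a2 := ix_lt hN u2
      have a3 := ix_mono (N := N) h12
      exact ⟨Om, Om, Om, rfl, Om, fun i hi => Om, fun i hi => ⟨ix N u1 + i, Om, Om, Or.inl ⟨rfl, Om⟩⟩⟩
  · refine key u2 (fun N => ix N u1) (fun N => ix N u1 - ix N u2) (fun N i => ix N u1 - i) hu2.1 ?_ ?_
    · refine (ix_lim (hc hu2)).congr fun N => ?_
      rw [Dp (ix_mono h12)]; ring
    · filter_upwards [U_ev (Ao 1), (ix_lim (hc hu1)).eventually (lt_mem_nhds hu1.1)] with N hN e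
      have a1 := ix_lt hN u1
      have a3 := ix_mono (N := N) h12
      have a4 : ix N u1 ≠ 0 := fun h => by simp [h] at e
      exact ⟨Om, Om, Om, Om, Om, fun i hi => Om, fun i hi => ⟨ix N u1 - i~~, Om, Om, Or.inr ⟨Om, Om⟩⟩⟩
theorem ASeq.lS_du {u t : Re} (hu : u ∈ Io) (ht : t ∈ Jc) : Dv (fun u => lS S u t) (lX S u t) u := by
  have hM := H.hM
  rw [Dk]
  refine Asymptotics.IsLittleO.of_bound fun c hc => ?_
  filter_upwards [Bk hu.1 hu.2, Cp u (show 0 < c / M~ by positivity)] with x hx hb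
  have h1 := H.lS_taylor ht ⟨hu.1.le, hu.2.le⟩ ⟨hx.1.le, hx.2.le⟩
  rw [Metric.mem_ball, Bb, Es Po] at hb
  rw [Bd, Bd, smul_eq_mul]
  refine h1.trans ?_
  gcongr; linarith
theorem ASeq.pos (gr : ∀ u ∈ Io, ∃ c d0 : Re, 0 < c ∧ 0 < d0 ∧ ∀ d ∈ Ioo 0 d0, c * d ≤ X0 (u + d) - X0 (u - d))
    {u t : Re} (hu : u ∈ Io) (ht : t ∈ Jo) (hX : lX S 0 t < lX S 1 t) : 0 < lv v u t := by
  have hI : t ∈ Jc := ⟨ht.1.le, ht.2.le⟩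
  rcases dichotomy H.psi with ⟨H', dH, hH⟩ | ⟨P, hP, dP⟩
  · by_contra hlv
    have hz : ∀ s ∈ Ioc 0 t, lv v u s = 0 := fun s hs => by
      by_contra hne
      have hp := Bn (H.lv_mem ⟨hs.1.le, by linarith [hs.2, ht.2]⟩ u).1 (Ne.symm hne)
      rcases hs.2.eq_or_lt with rfl | h
      · exact hlv hp
      · exact hlv (H.caseI dH hH hu hs.1 h ht.2 hp)
    have hSe : lS S u t ≤ lS S u 0 := by
      have := anti_hd (f := fun s => lS S u s) (f' := fun s => Ps (lv v u s)) (a := 0) (b := t) ?_ (fun s hs => H.lS_deriv ⟨hu.1.le, hu.2.le⟩ ⟨hs.1, hs.2.trans ht.2⟩)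
        (fun s hs => by rw [hz s ⟨hs.1, hs.2.le⟩, H.psi.zero])
      · exact this ⟨Ad, ht.1.le⟩ ⟨ht.1.le, Ad⟩ ht.1.le
      · have hp := H.psi.pos (show 0 < M + 1 by linarith [H.hM])
        have : LipschitzOnWith ⟨Ps M~, hp.le⟩ (fun s => lS S u s) (Icc 0 t) := LipschitzOnWith.of_le_add_mul _ fun x hx y hy => by
          have m : ∀ z ∈ Icc 0 t, z ∈ Jc := fun z hz => ⟨hz.1, hz.2.trans ht.2.le⟩
          show lS S u x ≤ lS S u y + Ps M~ * dist x y
          rw [Bb]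
          rcases Er x y with h | h
          · have := (H.lS_time (m x hx) (m y hy) h u).1; have : 0 ≤ Ps M~ * |x - y| := Po
            linarith
          · have := (H.lS_time (m y hy) (m x hx) h u).2; rw [Ak Li]; linarith
        exact this.continuousOn
    obtain ⟨c, d0, hc, hd0, hg⟩ := gr u hu
    obtain ⟨ad, ak, hT⟩ := H.lX_taylor ht.1 (show 0 < c / 4 by positivity)
    obtain ⟨e, he, e1, e2, e3, e4⟩ : ∃ e : Re, 0 < e ∧ e < d0 ∧ e < ad ∧ e < u ∧ e < 1 - u := by
      have h2 : 0 < 1 - u := Lx hu.2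
      have hm := Eb (Eb hd0 ak) (Eb hu.1 h2)
      refine ⟨min (min d0 ad) (min u (1-u)) / 2, Po, ?_, ?_, ?_, ?_⟩ <;> refine (El hm).trans_le ?_
      · exact (Am _ _).trans (Am _ _)
      · exact (Am _ _).trans (Al _ _)
      · exact (Al _ _).trans (Am _ _)
      · exact (Al _ _).trans (Al _ _)
    have mem : ∀ d, |d| ≤ e → u + d ∈ Io := fun d hd => by
      have := Ar.1 hd; constructor <;> linarith [this.1, this.2]
    have ci : ∀ s ∈ Jc, ∀ d ∈ Icc 0 e, Dv (fun d => lS S (u + d) s + lS S (u + -d) s) (lX S (u + d) s - lX S (u + -d) s) d := fun s hs d hd => by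
      have h1 := (H.lS_du (mem d (by rw [Ak hd.1]; exact hd.2)) hs).comp_const_add u d
      have h2 := ((H.lS_du (mem (-d) (by rw [abs_neg, Ak hd.1]; exact hd.2)) hs).comp_const_add u (-d)).comp d (hasDerivAt_neg d)
      exact (h1.add h2).congr_deriv Rg
    have hF : ∀ d ∈ Icc 0 e, Dv (fun d => (lS S (u + d) t + lS S (u + -d) t) - (lS S (u + d) 0 + lS S (u + -d) 0) + c / 4 * d^2)
        ((lX S (u + d) t - lX S (u + -d) t) - (lX S (u + d) 0 - lX S (u + -d) 0) + c / 4 * (2 * d)) d := fun d hd =>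
      ((ci t hI d hd).sub (ci 0 ⟨Ad, Nn⟩ d hd)).add (((hasDerivAt_pow 2 d).const_mul _).congr_deriv Si)
    have := anti_hd (fun d hd => (hF d hd).continuousAt.continuousWithinAt) (fun d hd => hF d ⟨hd.1.le, hd.2.le⟩) (fun d hd => by
      have hi : |d| ≤ e := by rw [Ag hd.1]; exact hd.2.le
      have m1 := mem d hi
      have m2 := mem (-d) (by rwa [abs_neg])
      have g1 := hg d ⟨hd.1, hd.2.trans e1⟩
      rw [H.lX0 ⟨m1.1.le, m1.2.le⟩, H.lX0 ⟨m2.1.le, m2.2.le⟩]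
      have t1 := hT u ⟨hu.1.le, hu.2.le⟩ _ ⟨m1.1.le, m1.2.le⟩ (by rw [Ee]; linarith) t ⟨Ad, ht.2.le⟩
      have t2 := hT u ⟨hu.1.le, hu.2.le⟩ _ ⟨m2.1.le, m2.2.le⟩ (by rw [Ee, abs_neg]; linarith) t ⟨Ad, ht.2.le⟩
      rw [hz t ⟨ht.1, Ad⟩, Ee] at t1 t2
      rw [abs_neg] at t2
      rw [Ag hd.1] at t1 t2
      rw [sub_eq_add_neg u d] at g1
      linarith [(Ar.1 t1).2, (Ar.1 t2).1]) ⟨Ad, he.le⟩ ⟨he.le, Ad⟩ he.le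
    simp only [add_zero, neg_zero] at this
    have z0 : Oo ∈ Jc := ⟨Ad, Nn⟩
    have s1 := (H.lS_time z0 hI ht.1.le (u + e)).1
    have s2 := (H.lS_time z0 hI ht.1.le (u + -e)).1
    have : 0 < c / 4 * e^2 := Po
    norm_num at *
    linarith
  · by_contra hlv
    have hz : ∀ w ∈ Io, lv v w t ≤ 0 := fun w hw => by
      by_contra h
      push Not at h
      exact hlv (H.caseII hP dP hw hu ht h)
    have hc : LipschitzOnWith ⟨M, H.hM.le⟩ (fun w => lX S w t) (Icc 0 1) := LipschitzOnWith.of_le_add_mul _ fun x hx y hy => by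
      show lX S x t ≤ lX S y t + M * dist x y
      rw [Bb]
      have hM := H.hM
      rcases Er x y with h | h
      · have := (H.lX_mono hI hx hy h).1; have : 0 ≤ M * |x - y| := Po
        linarith
      · have := (H.lX_mono hI hy hx h).2; rw [Ak Li]; linarith
    have := anti_hd (f := fun w => lX S w t) hc.continuousOn (fun w hw => H.lX_deriv hw ⟨ht.1, ht.2.le⟩) hz ⟨Ad, Bo⟩ ⟨Bo, Ad⟩ Bo
    exact absurd this (not_le.2 hX)
end
theorem max2 {f f' : Fn} {w d : Re} (hm : IsLocalMax f w) (hf : ∀ᶠ x in 𝓝 w, Dv f (f' x) x) (hd : Dv f' d w) : f' w = 0 ∧ d ≤ 0 := by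
  have h0 := hm.hasDerivAt_eq_zero hf.self_of_nhds
  refine ⟨h0, ?_⟩
  by_contra hc
  have e : deriv f =ᶠ[𝓝 w] f' := hf.mono fun x hx => hx.deriv
  have hmin := isLocalMin_of_deriv_deriv_pos (f := f) (x₀ := w) (by rw [e.deriv_eq, hd.deriv]; exact not_le.1 hc) (by rw [hf.self_of_nhds.deriv, h0]) hf.self_of_nhds.continuousAt
  have e2 : f =ᶠ[𝓝 w] fun _ => f w := by filter_upwards [hm, hmin] with x h1 h2 using le_antisymm h1 h2
  have h3 := e2.deriv.deriv_eq
  rw [e.deriv_eq, hd.deriv] at h3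
  simp at h3
  exact hc h3.le
structure SS (Ps : Fn) (T : Re) (X v S : Re → Fn) : Prop where
  c : Co (fun p : Rp => S p.1 p.2) (Icc 0 1 ×ˢ Icc 0 T)
  dw : ∀ w ∈ Io, ∀ t ∈ Ioc 0 T, Dv (fun w => S w t) (X w t) w
  dww : ∀ w ∈ Io, ∀ t ∈ Ioc 0 T, Dv (fun w => X w t) (v w t) w
  vp : ∀ w ∈ Io, ∀ t ∈ Ioc 0 T, 0 < v w t
  dt : ∀ w ∈ Io, ∀ t ∈ Ioc 0 T, Dv (fun t => S w t) (Ps (v w t)) t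
theorem SS.le {Ps : Fn} (ab : PsiData Ps) {T : Re} {X v S X' v' S' : Re → Fn} (h : SS Ps T X v S) (h' : SS Ps T X' v' S')
    (b0 : ∀ w ∈ I, S w 0 = S' w 0) (b1 : ∀ t ∈ Icc 0 T, S 0 t = S' 0 t ∧ S 1 t = S' 1 t) :
    ∀ w ∈ I, ∀ t ∈ Icc 0 T, S w t ≤ S' w t := by
  intro w hw t ht
  refine Ek fun e he => ?_
  obtain ⟨ax, bp, ee⟩ : ∃ ax : Re, 0 < ax ∧ ax * t ≤ e := ⟨e / t~, by have := ht.1; positivity, by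
    have := ht.1; rw [Dm, Ci Po]; nlinarith⟩
  obtain ⟨⟨y, s⟩, ⟨hy, hs⟩, hm⟩ := (isCompact_Icc.prod isCompact_Icc).exists_isMaxOn ⟨(w, t), hw, ht⟩
    ((h.c.sub h'.c).sub (continuous_snd.continuousOn.const_smul ax))
  have hm : ∀ w ∈ I, ∀ t ∈ Icc 0 T, S w t - S' w t - ax * t ≤ S y s - S' y s - ax * s := fun w hw t ht => hm (mk_mem_prod hw ht)
  suffices S y s - S' y s - ax * s ≤ 0 by linarith [hm w hw t ht]
  by_contra hc
  push Not at hc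
  simp only at hy hs
  have hs0 : 0 < s := Bn hs.1 (by rintro rfl; rw [b0 y hy] at hc; simp at hc)
  have ef := mul_pos bp hs0
  have hy0 : 0 < y := Bn hy.1 (by rintro rfl; rw [(b1 s hs).1] at hc; linarith)
  have hy1 : y < 1 := Bn hy.2 (by rintro rfl; rw [(b1 s hs).2] at hc; linarith)
  have hyI : y ∈ Io := ⟨hy0, hy1⟩
  have hsI : s ∈ Ioc 0 T := ⟨hs0, hs.2⟩
  have h1 := left_max (((h.dt y hyI s hsI).sub (h'.dt y hyI s hsI)).sub ((Af s).const_mul ax)) hs0 (fun r hr => hm y hy r ⟨hr.1.le, hr.2.le.trans hs.2⟩)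
  have h2 := (max2 (f := fun w => S w s - S' w s) (f' := fun w => X w s - X' w s) (w := y) (by
      filter_upwards [Bk hy0 hy1] with w hw
      have := hm w ⟨hw.1.le, hw.2.le⟩ s hs; linarith) (by
      filter_upwards [Bk hy0 hy1] with w hw using (h.dw w hw s hsI).sub (h'.dw w hw s hsI)) ((h.dww y hyI s hsI).sub (h'.dww y hyI s hsI))).2
  have := ab.monoOn (h.vp y hyI s hsI).le (sub_nonpos.1 h2)
  linarith
theorem SS.eqX {Ps : Fn} (ab : PsiData Ps) {T : Re} {X v S X' v' S' : Re → Fn} (h : SS Ps T X v S) (h' : SS Ps T X' v' S')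
    (b0 : ∀ w ∈ I, S w 0 = S' w 0) (b1 : ∀ t ∈ Icc 0 T, S 0 t = S' 0 t ∧ S 1 t = S' 1 t) {w t : Re} (hw : w ∈ Io) (ht : t ∈ Ioc 0 T) :
    X w t = X' w t := by
  refine (h.dw w hw t ht).unique ((h'.dw w hw t ht).congr_of_eventuallyEq ?_)
  filter_upwards [Bk hw.1 hw.2] with y hy
  exact le_antisymm (h.le ab h' b0 b1 y ⟨hy.1.le, hy.2.le⟩ t ⟨ht.1.le, ht.2⟩)
    (h'.le ab h (fun w hw => (b0 w hw).symm) (fun t ht => ⟨(b1 t ht).1.symm, (b1 t ht).2.symm⟩) y ⟨hy.1.le, hy.2.le⟩ t ⟨ht.1.le, ht.2⟩)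
theorem ASeq.lX_cont {Ps X0 : Fn} {M : Re} {S v : ℕ → ℕ → Fn} (H : ASeq Ps M X0 S v) :
    Co (fun p : Rp => lX S p.1 p.2) (Icc 0 1 ×ˢ Icc 0 2) ∧ Co (fun p : Rp => lS S p.1 p.2) (Icc 0 1 ×ˢ Icc 0 2) := by
  have hM := H.hM
  have hP := H.psi.pos (show 0 < M + 1 by linarith)
  set P := Ps M~
  have tS : ∀ t ∈ Jc, ∀ t' ∈ Jc, ∀ u, |lS S u t - lS S u t'| ≤ P * |t - t'| := fun t ht t' ht' u => by
    rcases Er t t' with h | h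
    · have := H.lS_time ht ht' h u; rw [Br, Ak this.1, Br, Ak Li]; exact this.2
    · have := H.lS_time ht' ht h u; rw [Ak this.1, Ak Li]; exact this.2
  have xX : ∀ t ∈ Jc, ∀ x ∈ I, ∀ y ∈ I, |lX S x t - lX S y t| ≤ M * |x - y| := fun t ht x hx y hy => by
    rcases Er x y with h | h
    · have := H.lX_mono ht hx hy h; rw [Br, Ak this.1, Br, Ak Li]; exact this.2
    · have := H.lX_mono ht hy hx h; rw [Ak this.1, Ak Li]; exact this.2
  have tX : ∀ h : Re, 0 < h → h ≤ 1/2 → ∀ t ∈ Jc, ∀ t' ∈ Jc, ∀ u ∈ I, h * |lX S u t - lX S u t'| ≤ 2 * P * |t - t'| + 2 * M~ * h * h := by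
    intro h hh hh2 t ht t' ht' u hu
    obtain ⟨y, hy, e⟩ : ∃ y ∈ I, |y - u| = h := by
      rcases Er u (1/2) with h1 | h1
      · exact ⟨u + h, ⟨Lx hu.1, Li⟩, by simp [hh.le]⟩
      · exact ⟨u - h, ⟨Li, Lx hu.2⟩, by simp [hh.le]⟩
    have a1 := H.lS_taylor ht hu hy
    have a2 := H.lS_taylor ht' hu hy
    have a3 := tS t ht t' ht' u
    have a4 := tS t ht t' ht' y
    rw [e] at a1 a2
    rw [← e, ← abs_mul, e]
    rw [Ar] at *
    constructor <;> linarith [a1.1, a1.2, a2.1, a2.2, a3.1, a3.2, a4.1, a4.2]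
  constructor
  · rw [Metric.continuousOn_iff]
    rintro ⟨u, t⟩ ⟨hu, ht⟩ e he
    simp only at hu ht
    obtain ⟨h, hh, h2, h3⟩ : ∃ h : Re, 0 < h ∧ h ≤ 1/2 ∧ 2 * M~ * h ≤ e / 4 := ⟨min (1/2) (e / (8 * M~)), Eb Nn Po, Am _ _, by
      have := Al (1/2) (e / (8 * M~)); rw [Ap Po] at this; linarith⟩
    refine ⟨min (e / (4 * M)) (e * h / (8 * P)), Eb Po Po, ?_⟩
    rintro ⟨u', t'⟩ ⟨hu', ht'⟩ hd
    simp only at hu' ht'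
    rw [Prod.dist_eq, max_lt_iff, Bb, Bb] at hd
    have d1 := hd.1.trans_le (Am _ _)
    have d2 := hd.2.trans_le (Al _ _)
    rw [Es Po] at d1 d2
    simp only at d1 d2 ⊢
    rw [Bb]
    have x1 := xX t' ht' u' hu' u hu
    have x2 := tX h hh h2 t' ht' t ht u hu
    have x3 : |lX S u t' - lX S u t| ≤ e / 2 := by
      refine Ca (x2.trans ?_) hh
      have : 2 * M~ * h * h ≤ e / 4 * h := by gcongr
      linarith
    have := abs_sub_le (lX S u' t') (lX S u t') (lX S u t)
    linarith
  · refine continuousOn_prod_of_continuousOn_lipschitzOnWith' _ ⟨P, hP.le⟩ (fun u hu => LipschitzOnWith.of_dist_le_mul fun t ht t' ht' => tS t ht t' ht' u) (fun t ht u hu => ?_)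
    have : Tendsto (fun u' => (M~ + |lX S u t|) * |u' - u|) (𝓝[Icc 0 1] u) (𝓝 ((M~ + |lX S u t|) * |u - u|)) :=
      (Continuous.tendsto Fu u).mono_left Da
    rw [sub_self, abs_zero, mul_zero] at this
    refine tendsto_iff_dist_tendsto_zero.2 (squeeze_zero' (Ep fun _ => dist_nonneg) ?_ this)
    filter_upwards [Bi] with u' hu'
    have h1 := H.lS_taylor ht hu hu'
    have h2 : |u' - u| ≤ 1 := by rw [Ar]; constructor <;> linarith [hu.1, hu.2, hu'.1, hu'.2]
    have h3 : M~ * |u' - u| * |u' - u| ≤ M~ * |u' - u| := mul_le_of_le_one_right Po h2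
    have h4 := abs_sub_abs_le_abs_sub (lS S u' t - lS S u t) ((u' - u) * lX S u t)
    rw [abs_mul] at h4
    rw [Bb]
    linarith
theorem exists_X {Ps X0 : Fn} {M : Re} (ab : PsiData Ps) (hM : 0 < M)
    (h0 : ∀ x ∈ I, ∀ y ∈ I, x ≤ y → 0 ≤ X0 y - X0 x ∧ X0 y - X0 x ≤ M * (y - x)) (h01 : X0 0 < X0 1)
    (gr : ∀ u ∈ Io, ∃ c d0 : Re, 0 < c ∧ 0 < d0 ∧ ∀ d ∈ Ioo 0 d0, c * d ≤ X0 (u + d) - X0 (u - d)) :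
    ∃ (T : Re) (X v S : Re → Fn), 0 < T ∧ SS Ps T X v S ∧ Co (fun p : Rp => X p.1 p.2) (Icc 0 1 ×ˢ Icc 0 T) ∧ (∀ w ∈ I, X w 0 = X0 w) ∧
      (∀ w ∈ Io, Dv (fun w => S w 0) (X0 w) w) ∧ (∀ t ∈ Icc 0 T, S 0 t = S 0 0 ∧ S 1 t = S 1 0) ∧
      ∀ t ∈ Ioc 0 T, Tendsto (fun w => v w t) (𝓝[Ioo 0 1] 0) (𝓝 0) ∧ Tendsto (fun w => v w t) (𝓝[Ioo 0 1] 1) (𝓝 0) ∧ ∀ w ∈ Io, v w t ≤ M ∧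
        ContDiffAt Re (⊤:ℕ∞) (fun p : Rp => X p.1 p.2) (w, t) ∧ ∃ d, Dv (fun w => Ps (v w t)) d w ∧ Dv (fun t => X w t) d t := by
  obtain ⟨S, v, H⟩ := exists_ASeq ab hM X0 h0
  obtain ⟨cX, cS⟩ := H.lX_cont
  have z : Oo ∈ I := ⟨Ad, Bo⟩
  have o : (1:Re) ∈ I := ⟨Bo, Ad⟩
  have z2 : Oo ∈ Jc := ⟨Ad, Nn⟩
  have ct : ∀ u ∈ I, Co (fun t => lX S u t) (Icc 0 2) ∧ Co (fun t => lS S u t) (Icc 0 2) := fun u hu =>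
    ⟨cX.comp (f := fun t : Re => (u, t)) Fu fun t ht => ⟨hu, ht⟩, cS.comp (f := fun t : Re => (u, t)) Fu fun t ht => ⟨hu, ht⟩⟩
  obtain ⟨T, hT, hT1, hTX⟩ : ∃ T : Re, 0 < T ∧ T < 2 ∧ ∀ t ∈ Icc 0 T, lX S 0 t < lX S 1 t := by
    have h1 := ((ct 0 z).1 0 z2).eventually_lt ((ct 1 o).1 0 z2) (by simpa [H.lX0 z, H.lX0 o] using h01)
    rw [nhdsWithin_Icc_eq_nhdsGE Nn] at h1
    obtain ⟨T, hT, h2⟩ := mem_nhdsGE_iff_exists_Icc_subset.1 h1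
    exact ⟨min T 1, Eb hT one_pos, (Al _ _).trans_lt Nn, fun t ht => h2 ⟨ht.1, ht.2.trans (Am _ _)⟩⟩
  have m : ∀ t ∈ Ioc 0 T, t ∈ Jo := fun t ht => ⟨ht.1, ht.2.trans_lt hT1⟩
  have m' : ∀ t ∈ Icc 0 T, t ∈ Jc := fun t ht => ⟨ht.1, ht.2.trans hT1.le⟩
  have vp : ∀ w ∈ Io, ∀ t ∈ Ioc 0 T, 0 < lv v w t := fun w hw t ht => H.pos gr hw (m t ht) (hTX t ⟨ht.1.le, ht.2⟩)
  have cb : ∀ u ∈ I, (∀ s ∈ Ioo 0 T, lv v u s = 0) → ∀ t ∈ Icc 0 T, lS S u t = lS S u 0 := fun u hu hz t ht => by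
    refine le_antisymm ?_ (by linarith [(H.lS_time z2 (m' t ht) ht.1 u).1])
    have := anti_hd (f := fun s => lS S u s) (f' := fun s => Ps (lv v u s)) (a := 0) (b := t) ((ct u hu).2.mono (Bf (m' t ht).2))
      (fun s hs => H.lS_deriv hu ⟨hs.1, hs.2.trans_le (m' t ht).2⟩) (fun s hs => by rw [hz s ⟨hs.1, hs.2.trans_le ht.2⟩, ab.zero])
    exact this ⟨Ad, ht.1⟩ ⟨ht.1, Ad⟩ ht.1
  have bl : ∀ u ∈ I, ∀ t ∈ Ioc 0 T, lv v u t = 0 → Tendsto (fun w => lv v w t) (𝓝[Ioo 0 1] u) (𝓝 0) := fun u hu t ht h0 => by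
    rw [Metric.tendsto_nhdsWithin_nhds]
    intro e he
    obtain ⟨ad, ak, h⟩ := H.lv_equi ht.1 (half_pos he)
    refine ⟨ad, ak, fun {w} hw hd => ?_⟩
    have := h w ⟨hw.1.le, hw.2.le⟩ u hu hd t ⟨Ad, (m t ht).2.le⟩ t ⟨Ad, (m t ht).2.le⟩ (by simp [ak.le])
    rw [h0] at this
    rw [Bb]; linarith
  have lb := fun t (ht : t ∈ Jo) => H.lv_bdry ⟨ht.1, ht.2.le⟩
  refine ⟨T, lX S, lv v, lS S, hT, ⟨cS.mono (prod_mono_right (Bf hT1.le)), fun w hw t ht => H.lS_du hw ⟨ht.1.le, (m t ht).2.le⟩,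
    fun w hw t ht => H.lX_deriv hw ⟨ht.1, (m t ht).2.le⟩, vp, fun w hw t ht => H.lS_deriv ⟨hw.1.le, hw.2.le⟩ (m t ht)⟩, cX.mono (prod_mono_right (Bf hT1.le)),
    fun w hw => H.lX0 hw, fun w hw => H.lX0 (S := S) ⟨hw.1.le, hw.2.le⟩ ▸ H.lS_du hw z2, fun t ht => ⟨cb 0 z (fun s hs => (lb s (m s ⟨hs.1, hs.2.le⟩)).1) t ht, cb 1 o (fun s hs => (lb s (m s ⟨hs.1, hs.2.le⟩)).2) t ht⟩,
    fun t ht => ⟨bl 0 z t ht (lb t (m t ht)).1, bl 1 o t ht (lb t (m t ht)).2, fun w hw => ⟨(H.lv_mem ⟨ht.1.le, (m t ht).2.le⟩ w).2, H.lX_smooth hw (m t ht) (vp w hw t ht)⟩⟩⟩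
theorem inv_cont {Q : Set (Rp)} {F : Rp → Rp} {g : Rp → Re} (hQ : IsCompact Q)
    (hF : Co F Q) (hg : ∀ p ∈ Q, g (F p) = p.1) : Co g (F '' Q) := by
  rw [continuousOn_iff_isClosed]
  intro C hC
  refine ⟨F '' (Q ∩ Prod.fst ⁻¹' C), ((hQ.inter_right (hC.preimage continuous_fst)).image_of_continuousOn (hF.mono inter_subset_left)).isClosed, ?_⟩
  ext y
  constructor
  · rintro ⟨h, p, hp, rfl⟩
    have : g (F p) ∈ C := h
    rw [hg p hp] at this
    exact ⟨⟨p, ⟨hp, this⟩, rfl⟩, p, hp, rfl⟩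
  · rintro ⟨⟨p, ⟨hp, h⟩, rfl⟩, -⟩
    refine ⟨?_, p, hp, rfl⟩
    change g (F p) ∈ C
    rwa [hg p hp]
theorem hodo {f g : Rp → Re} {x t a b : Re} (hf : ContDiffAt Re Tt f (x, t))
    (hx : Dv (fun x => f (x, t)) a x) (ht : Dv (fun t => f (x, t)) b t) (ha : a ≠ 0)
    (hg : ∀ᶠ q in 𝓝 (x, t), g (f q, q.2) = q.1) :
    ContDiffAt Re Tt g (f (x, t), t) ∧
    Dv (fun y => g (y, t)) (1 / a) (f (x, t)) ∧ Dv (fun s => g (f (x, t), s)) (-b / a) t := by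
  have n0 : (Tt : WithTop ℕ∞) ≠ 0 := Si
  have hd := (hf.differentiableAt n0).hasFDerivAt
  set f' := fderiv Re f (x, t)
  have e1 : f' (1, 0) = a := (hd.comp_hasDerivAt x ((Af x).prodMk (De x t))).unique hx
  have e2 : f' (0, 1) = b := (hd.comp_hasDerivAt t ((De t x).prodMk (Af t))).unique ht
  have e3 : ∀ p : Rp, f' p = a * p.1 + b * p.2 := by
    intro p
    have : p = p.1 • ((1, 0) : Rp) + p.2 • ((0, 1) : Rp) := by ext <;> simp
    rw [this, map_add, map_smul, map_smul, e1, e2]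
    simp
    ring
  let e : (Rp) ≃L[Re] (Rp) := ContinuousLinearEquiv.equivOfInverse
    (f'.prod (ContinuousLinearMap.snd Re Re Re))
    (((1 / a) • ContinuousLinearMap.fst Re Re Re - (b / a) • ContinuousLinearMap.snd Re Re Re).prod (ContinuousLinearMap.snd Re Re Re))
    (fun p => by ext <;> simp [e3]; field_simp; ring) (fun p => by ext <;> simp [e3]; field_simp; ring)
  have hF : ContDiffAt Re Tt (fun q : Rp => (f q, q.2)) (x, t) := hf.prodMk contDiffAt_snd
  have hF' : HasFDerivAt (fun q : Rp => (f q, q.2)) (e : (Rp) →L[Re] (Rp)) (x, t) := hd.prodMk hasFDerivAt_snd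
  have hs : HasStrictFDerivAt (fun q : Rp => (f q, q.2)) (e : (Rp) →L[Re] (Rp)) (x, t) := hF.hasStrictFDerivAt' hF' n0
  have h1 := hF.to_localInverse hF' n0
  have h2 := hs.to_localInverse
  have he : g =ᶠ[𝓝 (f (x, t), t)] fun y => (hs.localInverse _ _ _ y).1 := by
    have := h2.continuousAt.tendsto
    rw [hs.localInverse_apply_image] at this
    filter_upwards [hs.eventually_right_inverse, this.eventually hg] with y h3 h4
    rw [← h4]
    exact congrArg g h3.symm
  have hG : HasFDerivAt g _ (f (x, t), t) := (h2.hasFDerivAt.fst).congr_of_eventuallyEq he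
  refine ⟨(contDiffAt_fst.comp _ h1).congr_of_eventuallyEq he, ?_, ?_⟩
  · refine (hG.comp_hasDerivAt (f (x, t)) ((Af _).prodMk (De _ t))).congr_deriv ?_
    simp [e]
  · refine (hG.comp_hasDerivAt t ((De t (f (x, t))).prodMk (Af t))).congr_deriv ?_
    simp [e]
    ring
structure FW (Φ Ps : Fn) (T c L : Re) (X v S : Re → Fn) : Prop where
  T0 : 0 < T
  c0 : 0 < c
  ss : SS Ps T X v S
  xc : Co (fun p : Rp => X p.1 p.2) (Icc 0 1 ×ˢ Icc 0 T)
  x0 : StrictMonoOn (fun w => X w 0) (Icc 0 1)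
  psi : ∀ v, 0 < v → Ps v = L - Φ (1 / v)
  rest : ∀ t ∈ Ioc 0 T, Tendsto (fun w => v w t) (𝓝[Ioo 0 1] 0) (𝓝 0) ∧ Tendsto (fun w => v w t) (𝓝[Ioo 0 1] 1) (𝓝 0) ∧
    ∀ w ∈ Io, v w t ≤ 1 / c ∧ ContDiffAt Re Tt (fun p : Rp => X p.1 p.2) (w, t) ∧
    ∃ d, Dv (fun w => Ps (v w t)) d w ∧ Dv (fun t => X w t) d t
theorem FW.slice {Φ Ps T c L X v S} (h : FW Φ Ps T c L X v S) {t : Re} (ht : t ∈ Icc 0 T) :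
    Co (fun w => X w t) (Icc 0 1) :=
  h.xc.comp (f := fun w => (w, t)) Fu fun w hw => ⟨hw, ht⟩
theorem FW.sm {Φ Ps T c L X v S} (h : FW Φ Ps T c L X v S) {t : Re} (ht : t ∈ Icc 0 T) :
    StrictMonoOn (fun w => X w t) (Icc 0 1) := by
  rcases ht.1.eq_or_lt with rfl | h0
  · exact h.x0
  · refine strictMonoOn_of_deriv_pos (convex_Icc 0 1) (h.slice ht) fun w hw => ?_
    rw [interior_Icc] at hw
    rw [(h.ss.dww w hw t ⟨h0, ht.2⟩).deriv]
    exact h.ss.vp w hw t ⟨h0, ht.2⟩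
noncomputable def uF (X : Re → Fn) (x t : Re) : Re := Function.invFunOn (fun w => X w t) (Icc 0 1) x
theorem FW.u {Φ Ps T c L X v S} (h : FW Φ Ps T c L X v S) {t w : Re} (ht : t ∈ Icc 0 T) (hw : w ∈ I) :
    uF X (X w t) t = w := (h.sm ht).injOn.leftInvOn_invFunOn hw
theorem FW.ex {Φ Ps T c L X v S} (h : FW Φ Ps T c L X v S) {t x : Re} (ht : t ∈ Icc 0 T) (hx : x ∈ Ioo (X 0 t) (X 1 t)) :
    uF X x t ∈ Io ∧ X (uF X x t) t = x := by
  obtain ⟨w, hw, rfl⟩ := intermediate_value_Ioo Bo (h.slice ht) hx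
  simp only [h.u ht (Ai hw), hw, and_self]
theorem FW.loc {Φ Ps T c L X v S} (h : FW Φ Ps T c L X v S) {t w : Re} (ht : t ∈ Ioo 0 T) (hw : w ∈ Io) :
    ContDiffAt Re Tt (fun p : Rp => uF X p.1 p.2) (X w t, t) ∧
    Dv (fun y => uF X y t) (1 / v w t) (X w t) ∧
    ∃ d, Dv (fun w => Ps (v w t)) d w ∧ Dv (fun s => uF X (X w t) s) (-d / v w t) t := by
  obtain ⟨-, -, h3⟩ := h.rest t (Bs ht)
  obtain ⟨-, h4, d, h5, h6⟩ := h3 w hw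
  obtain ⟨a1, a2, a3⟩ := hodo (g := fun p => uF X p.1 p.2) h4 (h.ss.dww w hw t (Bs ht)) h6
    (h.ss.vp w hw t (Bs ht)).ne' (by
      filter_upwards [(Cn.prod Cn).mem_nhds (show (w, t) ∈ Io ×ˢ Ioo 0 T from ⟨hw, ht⟩)] with q hq
      exact h.u (Ai hq.2) (Ai hq.1))
  exact ⟨a1, a2, d, h5, a3⟩
theorem FW.uc {Φ Ps T c L X v S} (h : FW Φ Ps T c L X v S) :
    Co (fun p : Rp => uF X p.1 p.2) ((fun p : Rp => (X p.1 p.2, p.2)) '' (Icc 0 1 ×ˢ Icc 0 T)) :=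
  inv_cont (isCompact_Icc.prod isCompact_Icc) (h.xc.prodMk continuousOn_snd) fun _ hp => h.u hp.2 hp.1
theorem FW.endp {Φ Ps T c L X v S} (h : FW Φ Ps T c L X v S) {t e : Re} (ht : t ∈ Ioo 0 T) (he : e ∈ I)
    (hv : Tendsto (fun w => v w t) (𝓝[Ioo 0 1] e) (𝓝 0)) :
    Tendsto (fun x => deriv (fun z => uF X z t) x) (𝓝[Ioo (X 0 t) (X 1 t)] (X e t)) atTop := by
  have ht' := Ai ht
  have h1 : Tendsto (fun x => uF X x t) (𝓝[Ioo (X 0 t) (X 1 t)] (X e t)) (𝓝[Ioo 0 1] e) := by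
    refine Bt.2 ⟨?_, ?_⟩
    · have h2 := (h.uc (X e t, t) ⟨(e, t), ⟨he, ht'⟩, rfl⟩).tendsto
      simp only [h.u ht' he] at h2
      refine h2.comp (f := fun x => (x, t)) (Bt.2 ⟨(Continuous.tendsto Fu _).mono_left Da, ?_⟩)
      filter_upwards [Bi] with x hx
      exact ⟨(uF X x t, t), ⟨Ai (h.ex ht' hx).1, ht'⟩, by simp [(h.ex ht' hx).2]⟩
    · filter_upwards [Bi] with x hx using (h.ex ht' hx).1
  have h3 : Tendsto (fun w => v w t) (𝓝[Ioo 0 1] e) (𝓝[>] 0) := by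
    refine Bt.2 ⟨hv, ?_⟩
    filter_upwards [Bi] with x hx using h.ss.vp x hx t (Bs ht)
  refine ((tendsto_inv_nhdsGT_zero.comp h3).comp h1).congr' ?_
  filter_upwards [Bi] with x hx
  have h4 := (h.loc ht (h.ex ht' hx).1).2.1
  rw [(h.ex ht' hx).2] at h4
  rw [h4.deriv, one_div]
  rfl
theorem FW.sol {Φ Ps T c L X v S} (h : FW Φ Ps T c L X v S) {u₀ : Fn}
    (hi : ∀ x ∈ Icc (X 0 0) (X 1 0), u₀ x ∈ I ∧ X (u₀ x) 0 = x) :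
    Sl Φ T (X 0 0) (X 1 0) u₀ (uF X) (X 0) (X 1) := by
  have z0 : Oo ∈ I := ⟨Ad, Bo⟩
  have z1 : (1:Re) ∈ I := ⟨Bo, Ad⟩
  have T00 : Oo ∈ Icc 0 T := ⟨Ad, h.T0.le⟩
  have lr : ∀ t ∈ Icc 0 T, X 0 t < X 1 t := fun t ht => h.sm ht z0 z1 zero_lt_one
  have cw : ∀ w ∈ I, Co (X w) {t : Re | 0 ≤ t ∧ (t : EReal) < T} := fun w hw =>
    h.xc.comp (f := fun t => (w, t)) Fu fun t ht => ⟨hw, ht.1, (Au.1 ht.2).le⟩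
  have om : ∀ p ∈ typeIIDomain T (X 0) (X 1), p.2 ∈ Ioo 0 T ∧ uF X p.1 p.2 ∈ Io ∧ X (uF X p.1 p.2) p.2 = p.1 := by
    rintro ⟨x, t⟩ ⟨h1, h2, h3, h4⟩
    have ht : t ∈ Ioo 0 T := ⟨h1, Au.1 h2⟩
    exact ⟨ht, h.ex (Ai ht) ⟨h3, h4⟩⟩
  have gl : ∀ t : Re, 0 < t → (t : EReal) < T → t ∈ Ioo 0 T := fun t a b => ⟨a, Au.1 b⟩
  refine ⟨EReal.coe_pos.2 h.T0, rfl, rfl, fun t a b => lr t (Ai (gl t a b)), cw 0 z0, cw 1 z1, ?_, ?_, ?_, ?_, ?_, ?_, ?_, ?_⟩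
  · refine h.uc.mono (closure_minimal (fun p hp => ?_) (((isCompact_Icc.prod isCompact_Icc).image_of_continuousOn (h.xc.prodMk continuousOn_snd)).isClosed))
    obtain ⟨h1, h2, h3⟩ := om p hp
    exact ⟨(uF X p.1 p.2, p.2), ⟨Ai h2, Ai h1⟩, Prod.ext h3 rfl⟩
  · intro p hp
    obtain ⟨h1, h2, h3⟩ := om p hp
    have := (h.loc h1 h2).1
    rw [h3] at this
    exact this.contDiffWithinAt
  · intro x t hp
    obtain ⟨h1, h2, h3⟩ := om _ hp
    obtain ⟨-, h4, d, h5, h6⟩ := h.loc h1 h2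
    simp only [h3] at h1 h2 h4 h6
    rw [h6.deriv]
    have h7 := (h5.comp x (h := fun y => uF X y t) h4).const_sub L
    refine (HasDerivAt.deriv (h7.congr_of_eventuallyEq ?_ |>.congr_deriv Rg)).symm
    filter_upwards [Cn.mem_nhds (show x ∈ Ioo (X 0 t) (X 1 t) from hp.2.2)] with y hy
    have h8 := h.ex (Ai h1) hy
    have h9 := (h.loc h1 h8.1).2.1
    rw [h8.2] at h9
    rw [h9.deriv, Function.comp_apply, h.psi _ (h.ss.vp _ h8.1 t (Bs h1))]
    ring
  · intro x h1 h2
    have := h.u T00 (hi x ⟨h1, h2⟩).1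
    rwa [(hi x ⟨h1, h2⟩).2] at this
  · exact fun t a b => h.u (Ai (gl t a b)) z0
  · exact fun t a b => h.u (Ai (gl t a b)) z1
  · intro t a b
    have ht := gl t a b
    rw [← nhdsWithin_Ioo_eq_nhdsGT (lr t (Ai ht))]
    exact h.endp ht z0 (h.rest t (Bs ht)).1
  · intro t a b
    have ht := gl t a b
    rw [← nhdsWithin_Ioo_eq_nhdsLT (lr t (Ai ht))]
    exact h.endp ht z1 (h.rest t (Bs ht)).2.1
theorem FW.extra {Φ Ps T c L X v S} (h : FW Φ Ps T c L X v S) {t : Re} (ht : t ∈ Ioo 0 T) :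
    StrictMonoOn (fun z => uF X z t) (Ioo (X 0 t) (X 1 t)) ∧
    ∀ x ∈ Ioo (X 0 t) (X 1 t), c ≤ deriv (fun z => uF X z t) x := by
  have ht' := Ai ht
  refine ⟨fun x hx y hy hxy => ?_, fun x hx => ?_⟩
  · have h1 := h.ex ht' hx
    have h2 := h.ex ht' hy
    rw [← h1.2, ← h2.2] at hxy
    exact ((h.sm ht').lt_iff_lt (Ai h1.1) (Ai h2.1)).1 hxy
  · have h1 := h.ex ht' hx
    have h2 := (h.loc ht h1.1).2.1
    rw [h1.2] at h2
    rw [h2.deriv]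
    have := one_div_le_one_div_of_le (h.ss.vp _ h1.1 t (Bs ht)) ((h.rest t (Bs ht)).2.2 _ h1.1).1
    rwa [one_div_one_div] at this
theorem sl1 {f : Rp → Re} {x t : Re} (h : DifferentiableAt Re f (x, t)) : Dv (fun w => f (w, t)) (fderiv Re f (x, t) (1, 0)) x :=
  h.hasFDerivAt.comp_hasDerivAt x (f := fun w => (w, t)) ((Af x).prodMk (De x t))
theorem sl2 {f : Rp → Re} {x t : Re} (h : DifferentiableAt Re f (x, t)) : Dv (fun s => f (x, s)) (fderiv Re f (x, t) (0, 1)) t :=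
  h.hasFDerivAt.comp_hasDerivAt t (f := fun s => (x, s)) ((De t x).prodMk (Af t))
structure US (Ps : Fn) (T M : Re) (Y y : Re → Fn) : Prop where
  yc : Co (fun p : Rp => Y p.1 p.2) (Icc 0 1 ×ˢ Icc 0 T)
  sm : ∀ w ∈ Io, ∀ t ∈ Ioo 0 T, ContDiffAt Re Tt (fun p : Rp => Y p.1 p.2) (w, t) ∧
    Dv (fun w => Y w t) (y w t) w ∧ 0 < y w t ∧ y w t ≤ M ∧
    ∃ d, Dv (fun w => Ps (y w t)) d w ∧ Dv (fun t => Y w t) d t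
  lim : ∀ t ∈ Ioo 0 T, Tendsto (fun w => y w t) (𝓝[Ioo 0 1] 0) (𝓝 0) ∧ Tendsto (fun w => y w t) (𝓝[Ioo 0 1] 1) (𝓝 0)
theorem US.fd {Ps T M Y y} (ab : PsiData Ps) (h : US Ps T M Y y) {w t : Re} (hw : w ∈ Io) (ht : t ∈ Ioo 0 T) :
    DifferentiableAt Re (fun p : Rp => Ps (y p.1 p.2)) (w, t) := by
  obtain ⟨h1, -, h3, -⟩ := h.sm w hw t ht
  have h4 : DifferentiableAt Re (fun p => fderiv Re (fun p : Rp => Y p.1 p.2) p (1, 0)) (w, t) :=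
    ((h1.fderiv_right (m := 1) (by norm_cast)).differentiableAt one_ne_zero).clm_apply (differentiableAt_const _)
  have h5 : DifferentiableAt Re (fun p : Rp => y p.1 p.2) (w, t) := by
    refine h4.congr_of_eventuallyEq ?_
    filter_upwards [(Cn.prod Cn).mem_nhds (show (w, t) ∈ Io ×ˢ Ioo 0 T from ⟨hw, ht⟩)] with p hp
    obtain ⟨a1, a2, -⟩ := h.sm p.1 hp.1 p.2 hp.2
    exact a2.unique (sl1 (a1.differentiableAt Si))
  exact DifferentiableAt.comp (w, t) (g := Ps) (f := fun p : Rp => y p.1 p.2) (ab.hasDerivAt h3).differentiableAt h5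
theorem US.div {Ps T M Y y} (ab : PsiData Ps) (h : US Ps T M Y y) {k w t s : Re} (hk : k ∈ Io) (hw : w ∈ Io)
    (ht : t ∈ Ioo 0 T) (hs : s ∈ Ioo 0 T) :
    (∫ x in k..w, Y x s) - (∫ x in k..w, Y x t) = (∫ r in t..s, Ps (y w r)) - ∫ r in t..s, Ps (y k r) := by
  have i1 := ordConnected_Ioo.uIcc_subset hk hw
  have i2 := ordConnected_Ioo.uIcc_subset ht hs
  have Df : ∀ p ∈ uIcc k w ×ˢ uIcc t s, DifferentiableAt Re (fun p : Rp => Ps (y p.1 p.2)) p :=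
    fun p hp => h.fd ab (i1 hp.1) (i2 hp.2)
  have Dg : ∀ p ∈ uIcc k w ×ˢ uIcc t s, DifferentiableAt Re (fun p : Rp => -Y p.1 p.2) p :=
    fun p hp => ((h.sm _ (i1 hp.1) _ (i2 hp.2)).1.differentiableAt Si).neg
  have z : ∀ p ∈ uIcc k w ×ˢ uIcc t s, fderiv Re (fun p : Rp => Ps (y p.1 p.2)) p (1, 0) + fderiv Re (fun p : Rp => -Y p.1 p.2) p (0, 1) = 0 := by
    intro p hp
    obtain ⟨-, -, -, -, d, d1, d2⟩ := h.sm _ (i1 hp.1) _ (i2 hp.2)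
    have e1 := (sl1 (Df p hp)).unique d1
    have e2 := (sl2 (Dg p hp)).unique d2.neg
    rw [e1, e2, add_neg_cancel]
  have io : Ioo (min k w) (max k w) ×ˢ Ioo (min t s) (max t s) ⊆ uIcc k w ×ˢ uIcc t s :=
    prod_mono Ai Ai
  have := MeasureTheory.integral2_divergence_prod_of_hasFDerivAt _ _ _ _ k t w s
    (fun p hp => (Df p hp).continuousAt.continuousWithinAt) (fun p hp => (Dg p hp).continuousAt.continuousWithinAt)
    (fun p hp => (Df p (io hp)).hasFDerivAt) (fun p hp => (Dg p (io hp)).hasFDerivAt)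
    (MeasureTheory.integrableOn_zero.congr_fun (fun p hp => (z p hp).symm) (measurableSet_uIcc.prod measurableSet_uIcc))
  rw [intervalIntegral.integral_congr (g := fun _ => Oo) (fun x hx => by
    simp only
    rw [intervalIntegral.integral_congr (g := fun _ => Oo) (fun r hr => z (x, r) ⟨hx, hr⟩)]
    simp)] at this
  simp only [intervalIntegral.integral_neg, intervalIntegral.integral_zero] at this
  linarith
theorem US.cs {Ps T M Y y} (ab : PsiData Ps) (h : US Ps T M Y y) {w : Re} (hw : w ∈ Io) :
    Co (fun r => Ps (y w r)) (Ioo 0 T) := fun r hr =>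
  ((h.fd ab hw hr).continuousAt.comp (f := fun r => (w, r)) Fu).continuousWithinAt
theorem US.J {Ps T M Y y} (ab : PsiData Ps) (h : US Ps T M Y y) {t s e : Re} (ht : t ∈ Ioo 0 T) (hs : s ∈ Ioo 0 T)
    (he : ∀ t ∈ Ioo 0 T, Tendsto (fun w => y w t) (𝓝[Ioo 0 1] e) (𝓝 0)) :
    Tendsto (fun w => ∫ r in t..s, Ps (y w r)) (𝓝[Ioo 0 1] e) (𝓝 0) := by
  have i2 : uIoc t s ⊆ Ioo 0 T := uIoc_subset_uIcc.trans (ordConnected_Ioo.uIcc_subset ht hs)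
  have := intervalIntegral.tendsto_integral_filter_of_dominated_convergence (l := 𝓝[Ioo 0 1] e) (μ := MeasureTheory.volume) (a := t) (b := s) (F := fun w r => Ps (y w r)) (f := fun _ => 0) (fun _ => Ps M)
    (by
      filter_upwards [Bi] with w hw
      exact ((h.cs ab hw).mono i2).aestronglyMeasurable measurableSet_uIoc)
    (by
      filter_upwards [Bi] with w hw
      refine Ep fun r hr => ?_
      obtain ⟨-, -, h3, h4, -⟩ := h.sm w hw r (i2 hr)
      rw [Real.norm_of_nonneg (ab.pos h3).le]
      exact ab.monoOn h3.le h4) Si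
    (Ep fun r hr => by
      have h0 := (ab.cont 0 (mem_Ici.2 Ad)).tendsto
      rw [ab.zero] at h0
      refine h0.comp (Bt.2 ⟨he r (i2 hr), ?_⟩)
      filter_upwards [Bi] with w hw using (h.sm w hw r (i2 hr)).2.2.1.le)
  simpa using this
theorem US.ex {Ps T M Y y} (ab : PsiData Ps) (h : US Ps T M Y y) {T' : Re} (h0 : 0 < T') (hT : T' < T) (s0 : Re) :
    ∃ S, SS Ps T' Y y S ∧ (∀ t, S 0 t = s0) ∧ (∀ t ∈ Icc 0 T', S 1 t = S 1 0) ∧ ∀ w ∈ Io, Dv (fun w => S w 0) (Y w 0) w := by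
  let Z : Re → Fn := fun t w => Y (max 0 (min 1 w)) (max 0 (min T t))
  have T0 := (h0.trans hT).le
  have Zc : Continuous (Function.uncurry Z) := h.yc.comp_continuous (f := fun p : Rp => (max 0 (min 1 p.2), max 0 (min T p.1))) Fu
    fun p => ⟨⟨le_max_left _ _, max_le Bo (Am _ _)⟩, le_max_left _ _, max_le T0 (Am _ _)⟩
  have Ze : ∀ w ∈ I, ∀ t ∈ Icc 0 T, Z t w = Y w t := fun w hw t ht => by
    simp only [Z, min_eq_right hw.2, min_eq_right ht.2, Cg hw.1, Cg ht.1]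
  have Zt : ∀ t, Continuous (Z t) := fun t => Zc.comp (by fun_prop : Continuous fun w => (t, w))
  let S : Re → Fn := fun w t => s0 + ∫ x in Oo..w, Z t x
  have Sc : Continuous fun p : Rp => S p.1 p.2 :=
    continuous_const.add (intervalIntegral.continuous_parametric_intervalIntegral_of_continuous (f := fun (p : Rp) x => Z p.2 x)
      (Zc.comp (by fun_prop : Continuous fun q : (Rp) × Re => (q.1.2, q.2))) continuous_fst)
  have Sw : ∀ w ∈ Io, ∀ t ∈ Icc 0 T, Dv (fun w => S w t) (Y w t) w := fun w hw t ht => by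
    rw [← Ze w (Ai hw) t ht]
    exact ((Zt t).integral_hasStrictDerivAt 0 w).hasDerivAt.const_add s0
  have ne : ∀ e ∈ I, (𝓝[Ioo 0 1] e).NeBot := fun e he => by
    rw [← mem_closure_iff_nhdsWithin_neBot, closure_Ioo zero_ne_one]
    exact he
  have z0 : Oo ∈ I := ⟨Ad, Bo⟩
  have z1 : (1:Re) ∈ I := ⟨Bo, Ad⟩
  have k1 : ∀ w ∈ Io, ∀ t ∈ Ioo 0 T, ∀ s ∈ Ioo 0 T, S w s - S w t = ∫ r in t..s, Ps (y w r) := by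
    intro w hw t ht s hs
    have := ne 0 z0
    have a1 : Tendsto (fun k => (S w s - S w t) - (S k s - S k t)) (𝓝[Ioo 0 1] 0) (𝓝 ((S w s - S w t) - (S 0 s - S 0 t))) :=
      (Continuous.tendsto (continuous_const.sub ((Sc.comp (by fun_prop : Continuous fun k => (k, s))).sub (Sc.comp (by fun_prop : Continuous fun k => (k, t))))) 0).mono_left Da
    have a2 := (h.J ab ht hs (fun t ht => (h.lim t ht).1)).const_sub (∫ r in t..s, Ps (y w r))
    have a3 := tendsto_nhds_unique (a1.congr' (by
      filter_upwards [Bi] with k hk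
      have b : ∀ t ∈ Ioo 0 T, S w t - S k t = ∫ x in k..w, Y x t := fun t ht => by
        have := intervalIntegral.integral_add_adjacent_intervals ((Zt t).intervalIntegrable 0 k) ((Zt t).intervalIntegrable k w) (μ := MeasureTheory.volume)
        have e := intervalIntegral.integral_congr (μ := MeasureTheory.volume) (f := Z t) (g := fun x => Y x t) (a := k) (b := w) fun x hx =>
          Ze x (Ai (ordConnected_Ioo.uIcc_subset hk hw hx)) t (Ai ht)
        rw [← e]
        simp only [S]
        linarith
      rw [← h.div ab hk hw ht hs, ← b s hs, ← b t ht]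
      ring)) a2
    simp only [S, intervalIntegral.integral_same] at a3 ⊢
    linarith
  have i : Ioc 0 T' ⊆ Ioo 0 T := fun t ht => ⟨ht.1, ht.2.trans_lt hT⟩
  refine ⟨S, ⟨Sc.continuousOn, fun w hw t ht => Sw w hw t (Ai (i ht)), fun w hw t ht => (h.sm w hw t (i ht)).2.1, fun w hw t ht => (h.sm w hw t (i ht)).2.2.1, fun w hw t ht => ?_⟩, fun t => by simp [S], ?_, fun w hw => Sw w hw 0 ⟨Ad, T0⟩⟩
  · have ht' := i ht
    have c := (h.cs ab hw)
    have a : Dv (fun s => ∫ r in t..s, Ps (y w r)) (Ps (y w t)) t :=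
      intervalIntegral.integral_hasDerivAt_right Si (c.stronglyMeasurableAtFilter Cn t ht') (c.continuousAt (Cn.mem_nhds ht'))
    refine (a.const_add (S w t)).congr_of_eventuallyEq ?_
    filter_upwards [Cn.mem_nhds ht'] with s hs
    rw [← k1 w hw t ht' s hs]
    ring
  · have := ne 1 z1
    have k2 : ∀ t ∈ Ioo 0 T, ∀ s ∈ Ioo 0 T, S 1 s - S 1 t = 0 := fun t ht s hs => by
      have a1 : Tendsto (fun k => S k s - S k t) (𝓝[Ioo 0 1] 1) (𝓝 (S 1 s - S 1 t)) :=
        (Continuous.tendsto ((Sc.comp (by fun_prop : Continuous fun k => (k, s))).sub (Sc.comp (by fun_prop : Continuous fun k => (k, t)))) 1).mono_left Da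
      refine tendsto_nhds_unique (a1.congr' ?_) (h.J ab ht hs (fun t ht => (h.lim t ht).2))
      filter_upwards [Bi] with k hk using k1 k hk t ht s hs
    intro t ht
    rcases ht.1.eq_or_lt with rfl | h1
    · rfl
    have a1 : Tendsto (fun s => S 1 s) (𝓝[>] 0) (𝓝 (S 1 0)) :=
      (Continuous.tendsto (Sc.comp (by fun_prop : Continuous fun s => ((1:Re), s))) 0).mono_left Da
    refine tendsto_nhds_unique (tendsto_const_nhds.congr' ?_) a1
    filter_upwards [Ioo_mem_nhdsGT (h0.trans hT)] with s hs
    linarith [k2 s hs t (i ⟨h1, ht.2⟩)]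
theorem Sol.lc {Φ u₀ u l r a b} {T : Re} (h : Sl Φ T a b u₀ u l r) : Co l (Ico 0 T) ∧ Co r (Ico 0 T) :=
  ⟨h.l_cont.mono fun _ ht => ⟨ht.1, Au.2 ht.2⟩, h.r_cont.mono fun _ ht => ⟨ht.1, Au.2 ht.2⟩⟩
theorem Sol.om {T t x : Re} {l r : Fn} (ht : t ∈ Ioo 0 T) (hx : x ∈ Ioo (l t) (r t)) : (x, t) ∈ typeIIDomain T l r :=
  ⟨ht.1, Au.2 ht.2, hx.1, hx.2⟩
theorem Sol.lr {Φ u₀ u l r a b} {T : Re} (h : Sl Φ T a b u₀ u l r) (hab : a < b) {t : Re} (ht : t ∈ Ico 0 T) : l t < r t := by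
  rcases ht.1.eq_or_lt with rfl | h0
  · rwa [h.l_init, h.r_init]
  · exact h.l_lt_r t h0 (Au.2 ht.2)
theorem Sol.nh {Φ u₀ u l r a b} {T : Re} (h : Sl Φ T a b u₀ u l r) {p : Rp} (hp : p ∈ typeIIDomain T l r) :
    typeIIDomain T l r ∈ 𝓝 p := by
  have ht : p.2 ∈ Ioo 0 T := ⟨hp.1, Au.1 hp.2.1⟩
  have hn := Ico_mem_nhds ht.1 ht.2
  have c1 : ContinuousAt (fun q : Rp => l q.2) p := ((Sol.lc h).1.continuousAt hn).comp continuousAt_snd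
  have c2 : ContinuousAt (fun q : Rp => r q.2) p := ((Sol.lc h).2.continuousAt hn).comp continuousAt_snd
  filter_upwards [continuousAt_snd.eventually (Cn.mem_nhds ht), c1.eventually_lt continuousAt_fst hp.2.2.1, continuousAt_fst.eventually_lt c2 hp.2.2.2] with q h1 h2 h3
  exact Sol.om (x := q.1) h1 ⟨h2, h3⟩
theorem Sol.ev {Φ u₀ u l r a b} {T : Re} (h : Sl Φ T a b u₀ u l r) {x t : Re} (hp : (x, t) ∈ typeIIDomain T l r) :
    (∀ᶠ y in 𝓝 x, (y, t) ∈ typeIIDomain T l r) ∧ ∀ᶠ s in 𝓝 t, (x, s) ∈ typeIIDomain T l r :=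
  ⟨(Continuous.tendsto (by fun_prop : Continuous fun y => (y, t)) x).eventually (Sol.nh h hp), (Continuous.tendsto (by fun_prop : Continuous fun s => (x, s)) t).eventually (Sol.nh h hp)⟩
theorem Sol.cl {Φ u₀ u l r a b} {T : Re} (h : Sl Φ T a b u₀ u l r) (hab : a < b) {p : Rp} (ht : p.2 ∈ Ico 0 T) (hx : p.1 ∈ Icc (l p.2) (r p.2)) :
    p ∈ closure (typeIIDomain T l r) := by
  obtain ⟨x, t⟩ := p
  simp only at ht hx
  have lr := Sol.lr h hab ht
  have T0 := ht.1.trans_lt ht.2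
  have is : Io ×ˢ Ioo 0 T ⊆ Prod.snd ⁻¹' Ico 0 T := fun p hp => Cr hp.2
  have c1 : ContinuousWithinAt (fun q : Rp => l q.2) (Ioo 0 1 ×ˢ Ioo 0 T) ((x - l t) / (r t - l t), t) := ((Sol.lc h).1 t ht).comp continuousWithinAt_snd is
  have c2 : ContinuousWithinAt (fun q : Rp => r q.2) (Ioo 0 1 ×ˢ Ioo 0 T) ((x - l t) / (r t - l t), t) := ((Sol.lc h).2 t ht).comp continuousWithinAt_snd is
  have c3 : ContinuousWithinAt (fun q : Rp => (l q.2 + q.1 * (r q.2 - l q.2), q.2)) (Ioo 0 1 ×ˢ Ioo 0 T) ((x - l t) / (r t - l t), t) :=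
    (c1.add (continuousWithinAt_fst.mul (c2.sub c1))).prodMk continuousWithinAt_snd
  have := c3.mem_closure (t := typeIIDomain T l r) (by
    rw [closure_prod_eq, closure_Ioo zero_ne_one, closure_Ioo T0.ne]
    exact ⟨⟨div_nonneg (Lx hx.1) Li, (Ck Li).2 (Lx hx.2)⟩, Ico_subset_Icc_self ht⟩) (fun q hq => by
    have lr := sub_pos.2 (Sol.lr h hab (Cr hq.2))
    exact Sol.om hq.2 ⟨by linarith [mul_pos hq.1.1 lr], by linarith [mul_lt_mul_of_pos_right hq.1.2 lr]⟩)
  convert this using 2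
  field_simp [(sub_pos.2 lr).ne']
  ring
theorem Sol.kc {Φ u₀ u l r a b} {T : Re} (h : Sl Φ T a b u₀ u l r) {T' : Re} (h0 : 0 ≤ T') (hT : T' < T) :
    IsCompact {k : Re × Rp | (0 ≤ k.2.2 ∧ k.2.2 ≤ T') ∧ l k.2.2 ≤ k.1 ∧ k.1 ≤ k.2.1 ∧ k.2.1 ≤ r k.2.2} := by
  have im : ∀ t, max 0 (min T' t) ∈ Icc 0 T' := fun t => ⟨le_max_left _ _, max_le h0 (Am _ _)⟩
  have ii : Icc 0 T' ⊆ Ico 0 T := Icc_subset_Ico_right hT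
  have cl : Continuous fun t => l (max 0 (min T' t)) := (Sol.lc h).1.comp_continuous Fu fun t => ii (im t)
  have cr : Continuous fun t => r (max 0 (min T' t)) := (Sol.lc h).2.comp_continuous Fu fun t => ii (im t)
  obtain ⟨A, hA⟩ := (isCompact_Icc.image cl (s := Icc 0 T')).bddBelow
  obtain ⟨B, hB⟩ := (isCompact_Icc.image cr (s := Icc 0 T')).bddAbove
  have e : ∀ t, 0 ≤ t ∧ t ≤ T' → max 0 (min T' t) = t := fun t ht => by rw [min_eq_right ht.2, Cg ht.1]
  have : {k : Re × Rp | (0 ≤ k.2.2 ∧ k.2.2 ≤ T') ∧ l k.2.2 ≤ k.1 ∧ k.1 ≤ k.2.1 ∧ k.2.1 ≤ r k.2.2} =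
      {k : Re × Rp | (0 ≤ k.2.2 ∧ k.2.2 ≤ T') ∧ l (max 0 (min T' k.2.2)) ≤ k.1 ∧ k.1 ≤ k.2.1 ∧ k.2.1 ≤ r (max 0 (min T' k.2.2))} := by
    ext k
    exact and_congr_right fun hk => by rw [e _ hk]
  rw [this]
  refine (isCompact_Icc.prod (isCompact_Icc.prod isCompact_Icc) (s := Icc A B) (t := Icc A B ×ˢ Icc 0 T')).of_isClosed_subset ?_ ?_
  · exact ((isClosed_le Fu Fu).and (isClosed_le Fu Fu)).and
      ((isClosed_le (cl.comp (continuous_snd.comp continuous_snd)) Fu).and ((isClosed_le Fu Fu).and (isClosed_le Fu (cr.comp (continuous_snd.comp continuous_snd)))))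
  · rintro k ⟨h1, h2, h3, h4⟩
    have := hA ⟨_, h1, rfl⟩
    have := hB ⟨_, h1, rfl⟩
    simp only at *
    exact ⟨⟨Li, Li⟩, ⟨Li, Li⟩, h1⟩
theorem Sol.dd {Φ u₀ u l r a b} {T : Re} (h : Sl Φ T a b u₀ u l r) {x t : Re} (hp : (x, t) ∈ typeIIDomain T l r) :
    ContDiffAt Re Tt (fun p : Rp => u p.1 p.2) (x, t) ∧ (∀ᶠ y in 𝓝 x, Dv (fun z => u z t) (deriv (fun z => u z t) y) y) ∧
    (∃ e, Dv (fun y => deriv (fun z => u z t) y) e x) ∧ Dv (fun s => u x s) (deriv (fun s => u x s) t) t := by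
  have h1 : ∀ p ∈ typeIIDomain T l r, ContDiffAt Re Tt (fun p : Rp => u p.1 p.2) p := fun p hp => h.u_smooth.contDiffAt (Sol.nh h hp)
  have h2 : ∀ p ∈ typeIIDomain T l r, DifferentiableAt Re (fun p : Rp => u p.1 p.2) p := fun p hp => (h1 p hp).differentiableAt Si
  have hs : ∀ᶠ y in 𝓝 x, (y, t) ∈ typeIIDomain T l r := (Sol.ev h hp).1
  refine ⟨h1 _ hp, ?_, ⟨_, (sl1 (f := fun p => fderiv Re (fun p : Rp => u p.1 p.2) p (1, 0)) ((((h1 _ hp).fderiv_right (m := 1) (by norm_cast)).differentiableAt one_ne_zero).clm_apply (differentiableAt_const _))).congr_of_eventuallyEq ?_⟩, (sl2 (h2 _ hp)).differentiableAt.hasDerivAt⟩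
  · filter_upwards [hs] with y hy using (sl1 (h2 _ hy)).differentiableAt.hasDerivAt
  · filter_upwards [hs] with y hy using (sl1 (h2 _ hy)).deriv
theorem Sol.uc {Φ u₀ u l r a b} {T : Re} (h : Sl Φ T a b u₀ u l r) (hab : a < b) {t : Re} (ht : t ∈ Ico 0 T) :
    Co (fun z => u z t) (Icc (l t) (r t)) :=
  h.u_cont.comp (f := fun z => (z, t)) Fu fun _ hx => Sol.cl h hab ht hx
theorem lt_of_der {f : Fn} {c x y : Re} (hc : 0 < c) (hf : Co f (Icc x y)) (hxy : x < y) (h : ∀ z ∈ Ioo x y, c < deriv f z) :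
    c * (y - x) < f y - f x :=
  (convex_Icc x y).mul_sub_lt_image_sub_of_lt_deriv hf (fun z hz => (Di (hc.trans (h z (interior_Icc (a := x) ▸ hz))).ne').differentiableWithinAt)
    (fun z hz => h z (interior_Icc (a := x) ▸ hz)) x (Cd.2 hxy.le) y (Ef.2 hxy.le) hxy
theorem Sol.lb {Φ u₀ u l r a b} {T : Re} (h : Sl Φ T a b u₀ u l r) (hab : a < b) {c : Re} (hc : 0 < c) (hΦ : 0 < deriv Φ c)
    (h0 : ∀ p q, a ≤ p → p ≤ q → q ≤ b → c * (q - p) ≤ u₀ q - u₀ p) {t p q : Re} (ht : t ∈ Ico 0 T) (hp : l t ≤ p) (hpq : p ≤ q) (hq : q ≤ r t) :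
    c * (q - p) ≤ u q t - u p t := by
  by_contra hcon
  push Not at hcon
  obtain ⟨e, e0, he⟩ : ∃ e > 0, 0 < c * (q - p) - (u q t - u p t) - e * t := by
    have t1 : 0 < t + 1 := Lx ht.1
    refine ⟨(c * (q - p) - (u q t - u p t)) / t~, div_pos Li t1, ?_⟩
    have := div_mul_cancel₀ (c * (q - p) - (u q t - u p t)) t1.ne'
    have := div_pos (by linarith : 0 < c * (q - p) - (u q t - u p t)) t1
    linarith
  obtain ⟨⟨x, y, s⟩, ⟨hs, hx, hxy, hy⟩, hm⟩ := (Sol.kc h ht.1 ht.2).exists_isMaxOn ⟨(p, q, t), ⟨ht.1, Ad⟩, hp, hpq, hq⟩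
    (f := fun k : Re × Rp => c * (k.2.1 - k.1) - (u k.2.1 k.2.2 - u k.1 k.2.2) - e * k.2.2) (by
      refine ContinuousOn.sub (ContinuousOn.sub Fu (ContinuousOn.sub ?_ ?_)) Fu
      · exact h.u_cont.comp (f := fun k : Re × Rp => (k.2.1, k.2.2)) Fu fun k hk => Sol.cl h hab ⟨hk.1.1, hk.1.2.trans_lt ht.2⟩ ⟨hk.2.1.trans hk.2.2.1, hk.2.2.2⟩
      · exact h.u_cont.comp (f := fun k : Re × Rp => (k.1, k.2.2)) Fu fun k hk => Sol.cl h hab ⟨hk.1.1, hk.1.2.trans_lt ht.2⟩ ⟨hk.2.1, hk.2.2.1.trans hk.2.2.2⟩)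
  have mx : ∀ x' y' s', 0 ≤ s' → s' ≤ t → l s' ≤ x' → x' ≤ y' → y' ≤ r s' → c * (y' - x') - (u y' s' - u x' s') - e * s' ≤ c * (y - x) - (u y s - u x s) - e * s :=
    fun x' y' s' a1 a2 a3 a4 a5 => hm (show (x', y', s') ∈ _ from ⟨⟨a1, a2⟩, a3, a4, a5⟩)
  have pos := he.trans_le (mx p q t ht.1 Ad hp hpq hq)
  clear hm
  simp only at hs hx hxy hy
  have hxy' : x < y := by
    refine hxy.lt_of_ne fun hh => ?_
    rw [hh] at pos
    linarith [Bu e0.le hs.1]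
  have s0 : 0 < s := by
    refine hs.1.lt_of_ne fun hh => ?_
    subst hh
    rw [h.l_init] at hx
    rw [h.r_init] at hy
    rw [h.init x hx (hxy.trans hy), h.init y (hx.trans hxy) hy] at pos
    linarith [h0 x y hx hxy hy]
  have hs' : s ∈ Ioo 0 T := ⟨s0, hs.2.trans_lt ht.2⟩
  have uc := Sol.uc h hab (Cr hs')
  have hx' : l s < x := by
    refine hx.lt_of_ne fun hh => ?_
    obtain ⟨z, hz, hz'⟩ := (mem_nhdsGT_iff_exists_mem_Ioc_Ioo_subset hxy').1 (hh ▸ (h.grad_left s s0 (Au.2 hs'.2)).eventually_gt_atTop c)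
    have := lt_of_der hc (uc.mono (Icc_subset_Icc hx (hz.2.trans hy))) hz.1 (fun w hw => hz' hw)
    linarith [mx z y s hs.1 hs.2 (hx.trans hz.1.le) hz.2 hy]
  have hy' : y < r s := by
    refine hy.lt_of_ne fun hh => ?_
    obtain ⟨z, hz, hz'⟩ := (Et hxy').1 (hh ▸ (h.grad_right s s0 (Au.2 hs'.2)).eventually_gt_atTop c)
    have := lt_of_der hc (uc.mono (Icc_subset_Icc (hx.trans hz.1) hy)) hz.2 (fun w hw => hz' hw)
    linarith [mx x z s hs.1 hs.2 hx hz.1 (hz.2.le.trans hy)]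
  have ox := Sol.om hs' ⟨hx', hxy'.trans hy'⟩
  have oy := Sol.om hs' ⟨hx'.trans hxy', hy'⟩
  obtain ⟨-, x1, ⟨e1, x2⟩, x3⟩ := Sol.dd h ox
  obtain ⟨-, y1, ⟨e2, y2⟩, y3⟩ := Sol.dd h oy
  have m1 : IsLocalMax (fun z => u z s - c * z) x := by
    filter_upwards [Bk hx' hxy'] with z hz
    linarith [mx z y s hs.1 hs.2 hz.1.le hz.2.le hy]
  have m2 : IsLocalMax (fun z => c * z - u z s) y := by
    filter_upwards [Bk hxy' hy'] with z hz
    linarith [mx x z s hs.1 hs.2 hx hz.1.le hz.2.le]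
  have n1 := max2 m1 (f' := fun z => deriv (fun z => u z s) z - c) (x1.mono fun z hz => (hz.sub ((Af z).const_mul c)).congr_deriv Si) (x2.sub_const c)
  have n2 := max2 m2 (f' := fun z => c - deriv (fun z => u z s) z) (y1.mono fun z hz => (((Af z).const_mul c).sub hz).congr_deriv Si) (y2.const_sub c)
  have dΦ : ∀ {z e}, deriv (fun z => u z s) z = c → Dv (fun y => deriv (fun z => u z s) y) e z → deriv (fun y => Φ (deriv (fun z => u z s) y)) z = deriv Φ c * e := fun h1 h2 => by
    rw [← h1] at hΦ ⊢
    exact (HasDerivAt.comp _ (h₂ := Φ) (Di hΦ.ne').hasDerivAt h2).deriv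
  have px := (h.pde x s ox).trans (dΦ (Lx n1.1) x2)
  have py := (h.pde y s oy).trans (dΦ (Lx n2.1) y2)
  have hev : ∀ᶠ s' in 𝓝 s, (x, s') ∈ typeIIDomain T l r ∧ (y, s') ∈ typeIIDomain T l r :=
    (Sol.ev h ox).2.and (Sol.ev h oy).2
  obtain ⟨s1, hs1, hs2⟩ := (Et s0).1 (mem_nhdsWithin_of_mem_nhds hev)
  have := left_max (((y3.sub x3).neg.sub ((Af s).const_mul e))) hs1.2 (fun s' hs' => by
    have hh := hs2 hs'
    have := mx x y s' hh.1.1.le (hs'.2.le.trans hs.2) hh.1.2.2.1.le hxy hh.2.2.2.2.le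
    simp only [Pi.sub_apply, Pi.neg_apply, id]
    linarith)
  rw [px, py] at this
  nlinarith [Bu hΦ.le (neg_nonneg.2 n1.2), Bu hΦ.le (neg_nonneg.2 n2.2)]
noncomputable def Yi (u : Re → Fn) (l r : Fn) (w t : Re) : Re := Function.invFunOn (fun x => u x t) (Icc (l t) (r t)) w
theorem Sol.us {Φ u₀ u l r a b Ps} {T c L T2 : Re} (h : Sl Φ T a b u₀ u l r) (hab : a < b) (hc : 0 < c) (hΦ : ∀ s, 0 < s → 0 < deriv Φ s)
    (h0 : ∀ p q, a ≤ p → p ≤ q → q ≤ b → c * (q - p) ≤ u₀ q - u₀ p) (ha : u₀ a = 0) (hb : u₀ b = 1)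
    (psi : ∀ v, 0 < v → Ps v = L - Φ (1 / v)) (hT0 : 0 < T2) (hT : T2 < T) :
    US Ps T2 (1 / c) (Yi u l r) (fun w t => 1 / deriv (fun z => u z t) (Yi u l r w t)) ∧
    ∀ t ∈ Icc 0 T2, (∀ x ∈ Icc (l t) (r t), Yi u l r (u x t) t = x) ∧ l t < r t ∧ u (l t) t = 0 ∧ u (r t) t = 1 ∧ StrictMonoOn (fun x => u x t) (Icc (l t) (r t)) := by
  have ii : Icc 0 T2 ⊆ Ico 0 T := Icc_subset_Ico_right hT
  have io : Ioo 0 T2 ⊆ Ioo 0 T := Ioo_subset_Ioo_right hT.le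
  have lb := @Sol.lb _ _ _ _ _ _ _ _ h hab c hc (hΦ c hc) h0
  have sm : ∀ t ∈ Ico 0 T, StrictMonoOn (fun x => u x t) (Icc (l t) (r t)) := fun t ht x hx y hy hxy => by
    have := lb ht hx.1 hxy.le hy.2
    have := mul_pos hc (sub_pos.2 hxy)
    simp only
    linarith
  have bd : ∀ t ∈ Ico 0 T, l t < r t ∧ u (l t) t = 0 ∧ u (r t) t = 1 := fun t ht => by
    refine ⟨Sol.lr h hab ht, ?_⟩
    rcases ht.1.eq_or_lt with rfl | h1
    · rw [h.l_init, h.r_init, h.init a Ad hab.le, h.init b hab.le Ad]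
      exact ⟨ha, hb⟩
    · exact ⟨h.bdry_left t h1 (Au.2 ht.2), h.bdry_right t h1 (Au.2 ht.2)⟩
  have Ye : ∀ t ∈ Ico 0 T, ∀ x ∈ Icc (l t) (r t), Yi u l r (u x t) t = x := fun t ht x hx => (sm t ht).injOn.leftInvOn_invFunOn hx
  have ex : ∀ t ∈ Ico 0 T, ∀ w ∈ Io, ∃ x ∈ Ioo (l t) (r t), u x t = w := fun t ht w hw => by
    obtain ⟨b1, b2, b3⟩ := bd t ht
    exact intermediate_value_Ioo b1.le (Sol.uc h hab ht) (by rwa [b2, b3])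
  have ux : ∀ t ∈ Ioo 0 T, ∀ x ∈ Ioo (l t) (r t), c ≤ deriv (fun z => u z t) x := fun t ht x hx => by
    have := left_max ((Sol.dd h (Sol.om ht hx)).2.1.self_of_nhds.sub ((Af x).const_mul c)) hx.1 (fun z hz => by
      have := lb (Cr ht) hz.1.le hz.2.le hx.2.le
      simp only [Pi.sub_apply, id]
      linarith)
    linarith
  have yc : Co (fun p : Rp => Yi u l r p.1 p.2) (Icc 0 1 ×ˢ Icc 0 T2) := by
    have := inv_cont (g := fun p => Yi u l r p.1 p.2) (F := fun p : Rp => (u p.1 p.2, p.2)) ((Sol.kc h hT0.le hT).image continuous_snd)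
      (by
        refine (h.u_cont.mono ?_).prodMk continuousOn_snd
        rintro _ ⟨k, hk, rfl⟩
        exact Sol.cl h hab (ii hk.1) ⟨hk.2.1.trans hk.2.2.1, hk.2.2.2⟩)
      (by
        rintro _ ⟨k, hk, rfl⟩
        exact Ye _ (ii hk.1) _ ⟨hk.2.1.trans hk.2.2.1, hk.2.2.2⟩)
    refine this.mono ?_
    rintro ⟨w, t⟩ ⟨hw, ht⟩
    obtain ⟨b1, b2, b3⟩ := bd t (ii ht)
    obtain ⟨x, hx, rfl⟩ := intermediate_value_Icc b1.le (Sol.uc h hab (ii ht)) (by rwa [b2, b3] : w ∈ _)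
    exact ⟨(x, t), ⟨(x, x, t), ⟨ht, hx.1, Ad, hx.2⟩, rfl⟩, rfl⟩
  have hl : ∀ t ∈ Ioo 0 T2, ∀ e ∈ I, Tendsto (fun w => Yi u l r w t) (𝓝[Ioo 0 1] e) (𝓝 (Yi u l r e t)) := fun t ht e he =>
    ((yc.comp (f := fun w => (w, t)) Fu fun w hw => ⟨hw, Ai ht⟩) e he).tendsto.mono_left (nhdsWithin_mono _ Ai)
  refine ⟨⟨yc, fun w hw t ht => ?_, fun t ht => ?_⟩, fun t ht => ⟨Ye t (ii ht), (bd t (ii ht)).1, (bd t (ii ht)).2.1, (bd t (ii ht)).2.2, sm t (ii ht)⟩⟩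
  · have ht' := io ht
    have ht2 := Cr ht'
    obtain ⟨x, hx, rfl⟩ := ex t ht2 w hw
    have hy := Ye t ht2 x (Ai hx)
    have ox := Sol.om ht' hx
    obtain ⟨d1, d2, ⟨e, d3⟩, d4⟩ := Sol.dd h ox
    have c1 := ux t ht' x hx
    have c2 := hc.trans_le c1
    obtain ⟨g1, g2, g3⟩ := hodo (g := fun p => Yi u l r p.1 p.2) d1 d2.self_of_nhds d4 c2.ne' (by
      filter_upwards [Sol.nh h ox] with q hq
      exact Ye _ ⟨hq.1.le, Au.1 hq.2.1⟩ _ ⟨hq.2.2.1.le, hq.2.2.2.le⟩)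
    rw [hy]
    refine ⟨g1, g2, Ct.2 c2, one_div_le_one_div_of_le hc c1, _, ?_, g3⟩
    have k1 : Dv (fun y => Φ (deriv (fun z => u z t) y)) (deriv (fun s => u x s) t) x := by
      rw [h.pde x t ox]
      exact ((Di (hΦ _ c2).ne').comp (g := Φ) x d3.differentiableAt).hasDerivAt
    rw [← hy] at k1
    refine ((k1.comp (u x t) (h := fun w => Yi u l r w t) g2).const_sub L).congr_of_eventuallyEq ?_ |>.congr_deriv (by rw [hy]; ring)
    filter_upwards [Cn.mem_nhds hw] with w hw
    obtain ⟨z, hz, rfl⟩ := ex t ht2 w hw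
    have hy := Ye t ht2 z (Ai hz)
    simp only [Function.comp_apply, hy]
    rw [psi _ (Ct.2 (hc.trans_le (ux t ht' z hz))), one_div_one_div]
  · have ht' := io ht
    have ht2 := Cr ht'
    obtain ⟨b1, b2, b3⟩ := bd t ht2
    have tT := Au.2 ht'.2
    have y0 := Ye t ht2 _ (Cd.2 b1.le)
    have y1 := Ye t ht2 _ (Ef.2 b1.le)
    rw [b2] at y0
    rw [b3] at y1
    have hm : ∀ w ∈ Io, Yi u l r w t ∈ Ioo (l t) (r t) := fun w hw => by
      obtain ⟨z, hz, rfl⟩ := ex t ht2 w hw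
      rwa [Ye t ht2 z (Ai hz)]
    simp only [one_div]
    constructor
    · refine tendsto_inv_atTop_zero.comp ((h.grad_left t ht.1 tT).comp (Bt.2 ⟨y0 ▸ hl t ht 0 ⟨Ad, Bo⟩, ?_⟩))
      filter_upwards [Bi] with w hw using (hm w hw).1
    · refine tendsto_inv_atTop_zero.comp ((h.grad_right t ht.1 tT).comp (Bt.2 ⟨y1 ▸ hl t ht 1 ⟨Bo, Ad⟩, ?_⟩))
      filter_upwards [Bi] with w hw using (hm w hw).2
theorem FW.uniq {Φ Ps T c L X v S u₀ u l r a b} (ab : PsiData Ps) (H : FW Φ Ps T c L X v S) (h : Sl Φ T a b u₀ u l r) (hab : a < b) (hΦ : ∀ s, 0 < s → 0 < deriv Φ s)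
    (h0 : ∀ p q, a ≤ p → p ≤ q → q ≤ b → c * (q - p) ≤ u₀ q - u₀ p) (ha : u₀ a = 0) (hb : u₀ b = 1)
    (hX : ∀ w ∈ I, X w 0 ∈ Icc a b ∧ u₀ (X w 0) = w) (hS : ∀ w ∈ Io, Dv (fun w => S w 0) (X w 0) w)
    (hS' : ∀ t ∈ Icc 0 T, S 0 t = S 0 0 ∧ S 1 t = S 1 0) {t : Re} (ht : t ∈ Ioo 0 T) :
    l t = X 0 t ∧ r t = X 1 t ∧ ∀ x ∈ Ioo (X 0 t) (X 1 t), u x t = uF X x t := by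
  have hT2 : t < (t + T) / 2 := Lx ht.2
  obtain ⟨us, f⟩ := Sol.us (T2 := (t + T) / 2) h hab H.c0 hΦ h0 ha hb H.psi (Lx ht.1) (Lx ht.2)
  obtain ⟨S', ss, s1, s2, s3⟩ := us.ex ab ht.1 hT2 (S 0 0)
  have z0 : Oo ∈ I := ⟨Ad, Bo⟩
  have z1 : (1:Re) ∈ I := ⟨Bo, Ad⟩
  have t0 : Oo ∈ Icc 0 t := ⟨Ad, ht.1.le⟩
  have tc : Icc 0 t ⊆ Icc 0 T := Bf ht.2.le
  have toc : Ioc 0 t ⊆ Ioc 0 T := Ioc_subset_Ioc_right ht.2.le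
  have SS' : SS Ps t X v S := ⟨H.ss.c.mono (prod_mono Ad tc), fun w hw s hs => H.ss.dw w hw s (toc hs), fun w hw s hs => H.ss.dww w hw s (toc hs), fun w hw s hs => H.ss.vp w hw s (toc hs), fun w hw s hs => H.ss.dt w hw s (toc hs)⟩
  have c0 : ∀ {S : Re → Fn}, Co (fun p : Rp => S p.1 p.2) (Icc 0 1 ×ˢ Icc 0 t) → Co (fun w => S w 0) (Icc 0 1) := fun hc =>
    hc.comp (f := fun w => (w, Oo)) Fu fun w hw => ⟨hw, t0⟩
  have YX : ∀ w ∈ I, Yi u l r w 0 = X w 0 := fun w hw => by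
    have := (f 0 ⟨Ad, Lx ht.1⟩).1 (X w 0) (by rw [h.l_init, h.r_init]; exact (hX w hw).1)
    rwa [h.init _ (hX w hw).1.1 (hX w hw).1.2, (hX w hw).2] at this
  have b0 : ∀ w ∈ I, S w 0 = S' w 0 := fun w hw => by
    have d : ∀ w ∈ Io, Dv (fun w => S' w 0) (X w 0) w := fun w hw => YX w (Ai hw) ▸ s3 w hw
    have a1 := anti_hd ((c0 SS'.c).sub (c0 ss.c)) (fun w hw => (hS w hw).sub (d w hw)) (fun w _ => (sub_self _).le) z0 hw hw.1
    have a2 := anti_hd ((c0 ss.c).sub (c0 SS'.c)) (fun w hw => (d w hw).sub (hS w hw)) (fun w _ => (sub_self _).le) z0 hw hw.1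
    simp only [Pi.sub_apply, s1] at a1 a2
    linarith
  have key := fun w hw => SS'.eqX ab ss b0 (fun s hs => ⟨by rw [s1, (hS' s (tc hs)).1], by rw [s2 s hs, (hS' s (tc hs)).2, b0 1 z1]⟩) (w := w) hw (t := t) ⟨ht.1, Ad⟩
  have t1 : t ∈ Icc 0 ((t + T) / 2) := ⟨ht.1.le, hT2.le⟩
  have key2 : EqOn (fun w => X w t) (fun w => Yi u l r w t) (Icc 0 1) := EqOn.of_subset_closure (s := Ioo 0 1) key (H.slice (Ai ht))
    (us.yc.comp (f := fun w => (w, t)) Fu fun w hw => ⟨hw, t1⟩) Ai (by rw [closure_Ioo zero_ne_one])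
  obtain ⟨f1, f2, f3, f4, f5⟩ := f t t1
  have el := key2 z0
  have er := key2 z1
  simp only at el er
  rw [← f3, f1 _ (Cd.2 f2.le), f3] at el
  rw [← f4, f1 _ (Ef.2 f2.le), f4] at er
  refine ⟨el.symm, er.symm, fun x hx => ?_⟩
  rw [el, er] at hx
  have hx := Ai hx
  have uw : u x t ∈ I := by
    rw [← f3, ← f4]
    exact ⟨f5.monotoneOn (Cd.2 f2.le) hx hx.1, f5.monotoneOn hx (Ef.2 f2.le) hx.2⟩
  have := key2 uw
  simp only [f1 x hx] at this
  rw [← H.u (Ai ht) uw, this]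
theorem psi_data {Φ : Fn} {L : Re} (hs : ContDiffOn Re Tt Φ (Ioi 0)) (hΦ : ∀ s : Re, 0 < s → 0 < deriv Φ s) (hL : Tendsto Φ atTop (𝓝 L)) :
    ∃ Ps, PsiData Ps ∧ ∀ v, 0 < v → Ps v = L - Φ (1 / v) := by
  let Ps : Fn := fun v => if v ≤ 0 then 0 else L - Φ (1 / v)
  have e : ∀ v, 0 < v → Ps v = L - Φ (1 / v) := fun v hv => if_neg hv.not_ge
  have z : Ps 0 = 0 := if_pos Ad
  have sm : StrictMonoOn Φ (Ioi 0) := strictMonoOn_of_deriv_pos (convex_Ioi 0) hs.continuousOn fun x hx => hΦ x (interior_subset hx)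
  have lt : ∀ s, 0 < s → Φ s < L := fun s h0 => by
    have h1 : s < s + 1 := Li
    refine (sm h0 (h0.trans h1) h1).trans_le (Dl hL ?_)
    filter_upwards [Ao s~] with x hx using sm.monotoneOn (h0.trans h1) (h0.trans (h1.trans_le hx)) hx
  have hd : ∀ v, 0 < v → Dv Ps (deriv Φ (1 / v) * (1 / v ^ 2)) v := fun v hv => by
    have h1 : Dv (fun v : Re => 1 / v) (-(v ^ 2)⁻¹) v := by simpa only [one_div] using hasDerivAt_inv hv.ne'
    have := ((Di (hΦ _ (Ct.2 hv)).ne').hasDerivAt.comp v h1).const_sub L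
    refine (this.congr_of_eventuallyEq ?_).congr_deriv Rg
    filter_upwards [Cm hv] with w hw using e w hw
  refine ⟨Ps, ⟨z, fun v hv w hw hvw => ?_, fun v hv => ?_, ?_, fun v hv => ?_⟩, e⟩
  · have hw0 : 0 < w := (mem_Ici.1 hv).trans_lt hvw
    rw [e w hw0]
    rcases (mem_Ici.1 hv).eq_or_lt with rfl | h0
    · rw [z]
      linarith [lt _ (Ct.2 hw0)]
    · rw [e v h0]
      linarith [sm (Ct.2 hw0) (Ct.2 h0) (one_div_lt_one_div_of_lt h0 hvw)]
  · rcases (mem_Ici.1 hv).eq_or_lt with rfl | h0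
    · rw [← continuousWithinAt_Ioi_iff_Ici, ContinuousWithinAt, z]
      have := (hL.comp tendsto_inv_nhdsGT_zero).const_sub L
      rw [sub_self] at this
      refine this.congr' ?_
      filter_upwards [Bi] with w hw
      rw [e w hw, one_div]
      rfl
    · exact (hd v h0).continuousAt.continuousWithinAt
  · refine ContDiffOn.congr (f := fun v => L - Φ (1 / v)) ?_ fun v hv => e v hv
    refine contDiffOn_const.sub (hs.comp (contDiffOn_const.div contDiffOn_id fun v hv => (mem_Ioi.1 hv).ne') fun v hv => mem_Ioi.2 (Ct.2 (mem_Ioi.1 hv)))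
  · rw [(hd v hv).deriv]
    exact mul_pos (hΦ _ (Ct.2 hv)) Po
theorem init_data {a b c : Re} (hab : a < b) (hc : 0 < c) {u₀ d : Fn} (ha : u₀ a = 0) (hb : u₀ b = 1) (hm : StrictMonoOn u₀ (Icc a b))
    (hd : ∀ x ∈ Icc a b, HasDerivWithinAt u₀ (d x) (Icc a b) x) (hcd : ∀ x ∈ Icc a b, c ≤ d x) :
    (∀ p q, a ≤ p → p ≤ q → q ≤ b → c * (q - p) ≤ u₀ q - u₀ p) ∧
    ∃ X0 : Fn, X0 0 = a ∧ X0 1 = b ∧ (∀ x ∈ Icc a b, u₀ x ∈ I ∧ X0 (u₀ x) = x) ∧ (∀ w ∈ I, X0 w ∈ Icc a b ∧ u₀ (X0 w) = w) ∧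
    (∀ x ∈ I, ∀ y ∈ I, x ≤ y → 0 ≤ X0 y - X0 x ∧ X0 y - X0 x ≤ 1 / c * (y - x)) ∧
    ∀ u ∈ Io, ∃ c d0 : Re, 0 < c ∧ 0 < d0 ∧ ∀ d ∈ Ioo 0 d0, c * d ≤ X0 (u + d) - X0 (u - d) := by
  have cu : Co u₀ (Icc a b) := fun x hx => (hd x hx).continuousWithinAt
  have hd' : ∀ x ∈ interior (Icc a b), Dv u₀ (d x) x := fun x hx => (hd x (interior_subset hx)).hasDerivAt (mem_interior_iff_mem_nhds.1 hx)
  have h0 : ∀ p q, a ≤ p → p ≤ q → q ≤ b → c * (q - p) ≤ u₀ q - u₀ p := fun p q h1 h2 h3 =>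
    (convex_Icc a b).mul_sub_le_image_sub_of_le_deriv cu (fun x hx => (hd' x hx).differentiableAt.differentiableWithinAt)
      (fun x hx => by rw [(hd' x hx).deriv]; exact hcd x (interior_subset hx)) p ⟨h1, h2.trans h3⟩ q ⟨h1.trans h2, h3⟩ h2
  have l : ∀ x ∈ Icc a b, Function.invFunOn u₀ (Icc a b) (u₀ x) = x := fun x hx => hm.injOn.leftInvOn_invFunOn hx
  have am := Cd.2 hab.le
  have bm := Ef.2 hab.le
  set X0 := Function.invFunOn u₀ (Icc a b)
  have r : ∀ w ∈ I, X0 w ∈ Icc a b ∧ u₀ (X0 w) = w := fun w hw => by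
    obtain ⟨x, hx, rfl⟩ := intermediate_value_Icc hab.le cu (by rwa [ha, hb] : w ∈ _)
    rw [l x hx]
    exact ⟨hx, rfl⟩
  have lip : ∀ x ∈ I, ∀ y ∈ I, x ≤ y → 0 ≤ X0 y - X0 x ∧ X0 y - X0 x ≤ 1 / c * (y - x) := fun x hx y hy hxy => by
    have h1 : X0 x ≤ X0 y := (hm.le_iff_le (r x hx).1 (r y hy).1).1 (by rwa [(r x hx).2, (r y hy).2])
    refine ⟨sub_nonneg.2 h1, ?_⟩
    have := h0 _ _ (r x hx).1.1 h1 (r y hy).1.2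
    rw [(r x hx).2, (r y hy).2] at this
    rwa [Db, le_div_iff₀' hc]
  refine ⟨h0, X0, ha ▸ l a am, hb ▸ l b bm, fun x hx => ⟨?_, l x hx⟩, r, lip, fun u hu => ?_⟩
  · rw [← ha, ← hb]
    exact ⟨hm.monotoneOn am hx hx.1, hm.monotoneOn hx bm hx.2⟩
  · have hu' := Ai hu
    obtain ⟨C, C0, hC⟩ := (hd _ (r u hu').1).differentiableWithinAt.isBigO_sub.exists_pos
    obtain ⟨ad, eg, ak⟩ := Metric.mem_nhdsWithin_iff.1 hC.bound
    refine ⟨1 / C, min (min u (1 - u)) (c * ad), Po, Eb (Eb hu.1 (Lx hu.2)) Po, fun e he => ?_⟩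
    obtain ⟨he1, he2⟩ := lt_min_iff.1 he.2
    obtain ⟨he3, he4⟩ := lt_min_iff.1 he1
    have e0 := he.1
    have hp : u + e ∈ I := ⟨Lx hu.1, Li⟩
    have q1 := lip u hu' _ hp Li
    have q2 := lip (u - e) ⟨Li, Lx hu.2⟩ u hu' Li
    rw [Ee, Db] at q1
    have := ak ⟨by
      rw [Metric.mem_ball, Bb, Ak q1.1]
      exact q1.2.trans_lt ((div_lt_iff₀' hc).2 he2), (r _ hp).1⟩
    simp only [mem_setOf_eq] at this
    rw [(r _ hp).2, (r u hu').2, Ee, Real.norm_of_nonneg e0.le, Real.norm_of_nonneg q1.1, ← div_le_iff₀' C0] at this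
    rw [Db]
    linarith [q2.1]
/-- Theorem 6.1 of Barenblatt–Vázquez.
Let `Φ : (0,∞) → ℝ` be smooth with `Φ' > 0` and `Φ(∞)` finite. For every increasing
differentiable initial datum `u₀` on `[a,b]` with `u₀(a) = 0`, `u₀(b) = 1` and
`u₀' ≥ c > 0`, there is a Type II solution `(u,l,r)` on some time interval `(0,T)`,
`T ∈ (0,∞]`, which is smooth and strictly monotone in `x` inside `Ω`, satisfies
`∂ₓu ≥ c` wherever `0 < u < 1`, and is unique. -/
theorem typeII_existence_uniqueness
    (Φ : ℝ → ℝ) (hΦsmooth : ContDiffOn ℝ (⊤ : ℕ∞) Φ (Ioi 0))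
    (hΦ' : ∀ s : ℝ, 0 < s → 0 < deriv Φ s)
    (hPhiInf : ∃ L : ℝ, Tendsto Φ atTop (𝓝 L))
    (a b c : ℝ) (hab : a < b) (hc : 0 < c)
    (u₀ : ℝ → ℝ) (hu₀a : u₀ a = 0) (hu₀b : u₀ b = 1)
    (hu₀mono : StrictMonoOn u₀ (Icc a b))
    (d : ℝ → ℝ) (hu₀diff : ∀ x ∈ Icc a b, HasDerivWithinAt u₀ (d x) (Icc a b) x)
    (hu₀d : ∀ x ∈ Icc a b, c ≤ d x) :
    ∃ (T : EReal) (u : ℝ → ℝ → ℝ) (l r : ℝ → ℝ),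
      0 < T ∧
      IsTypeIISolution Φ T a b u₀ u l r ∧
      (∀ t : ℝ, 0 < t → (t : EReal) < T → StrictMonoOn (fun z => u z t) (Ioo (l t) (r t))) ∧
      (∀ x t : ℝ, (x, t) ∈ typeIIDomain T l r → 0 < u x t → u x t < 1 →
        c ≤ deriv (fun z => u z t) x) ∧
      ∀ (u' : ℝ → ℝ → ℝ) (l' r' : ℝ → ℝ), IsTypeIISolution Φ T a b u₀ u' l' r' →
        (∀ t : ℝ, 0 ≤ t → (t : EReal) < T → l' t = l t ∧ r' t = r t) ∧
        ∀ x t : ℝ, (x, t) ∈ typeIIDomain T l r → u' x t = u x t := by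
  obtain ⟨L, hL⟩ := hPhiInf
  obtain ⟨Ψ, hΨ, psi⟩ := psi_data hΦsmooth hΦ' hL
  obtain ⟨h0, X0, xa, xb, x1, x2, x3, x4⟩ := init_data hab hc hu₀a hu₀b hu₀mono hu₀diff hu₀d
  obtain ⟨T, X, v, S, T0, ss, xc, xi, hS, hS', rest⟩ := exists_X hΨ (one_div_pos.2 hc) x3 (by rwa [xa, xb]) x4
  have z0 : (0:ℝ) ∈ Icc (0:ℝ) 1 := ⟨le_rfl, zero_le_one⟩
  have z1 : (1:ℝ) ∈ Icc (0:ℝ) 1 := ⟨zero_le_one, le_rfl⟩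
  have H : FW Φ Ψ T c L X v S := ⟨T0, hc, ss, xc, fun w hw y hy hwy => by
    simp only [xi w hw, xi y hy]
    exact (hu₀mono.lt_iff_lt (x2 w hw).1 (x2 y hy).1).1 (by rwa [(x2 w hw).2, (x2 y hy).2]), psi, rest⟩
  have ea : X 0 0 = a := (xi 0 z0).trans xa
  have eb : X 1 0 = b := (xi 1 z1).trans xb
  have sol := H.sol (u₀ := u₀) (fun x hx => by
    rw [ea, eb] at hx
    exact ⟨(x1 x hx).1, by rw [xi _ (x1 x hx).1, (x1 x hx).2]⟩)
  rw [ea, eb] at sol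
  refine ⟨T, uF X, X 0, X 1, EReal.coe_pos.2 T0, sol, fun t h1 h2 => (H.extra ⟨h1, EReal.coe_lt_coe_iff.1 h2⟩).1,
    fun x t hx _ _ => (H.extra ⟨hx.1, EReal.coe_lt_coe_iff.1 hx.2.1⟩).2 x hx.2.2, fun u' l' r' h' => ?_⟩
  have U := @FW.uniq _ _ _ _ _ _ _ _ _ _ _ _ _ _ hΨ H h' hab hΦ' h0 hu₀a hu₀b (fun w hw => by rw [xi w hw]; exact x2 w hw)
    (fun w hw => by rw [xi w (Ioo_subset_Icc_self hw)]; exact hS w hw) hS'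
  refine ⟨fun t h1 h2 => ?_, fun x t hx => (U ⟨hx.1, EReal.coe_lt_coe_iff.1 hx.2.1⟩).2.2 x hx.2.2⟩
  rcases h1.eq_or_lt with rfl | h1
  · rw [h'.l_init, h'.r_init, ea, eb]
    exact ⟨rfl, rfl⟩
  · have := U ⟨h1, EReal.coe_lt_coe_iff.1 h2⟩
    exact ⟨this.1, this.2.1⟩
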